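/- Fix θ₀ = (σ₀,δ₀,α₀) with σ₀ > 0, δ₀ > 0 and α₀ ∈ (0,2). For n ≥ 2 define the statistic T_n : ℝⁿ → ℝ³ by T_n¹(y₁,…,y_n) = −n^{−1/2} Σ_{i=1}^n (1/σ₀)(g_{α₀}/f_{α₀})(√n y_i/σ₀, w_n(θ₀)), T_n²(y₁,…,y_n) = −((ln n)^{α₀/4}/n^{α₀/4}) Σ_{i=1}^n (1/δ₀)(h_{α₀}/f_{α₀})(√n y_i/σ₀, w_n(θ₀)), T_n³(y₁,…,y_n) = ((ln n)^{α₀/4}/n^{α₀/4}) Σ_{i=1}^n (l_{α₀}/f_{α₀})(√n y_i/σ₀, w_n(θ₀)) (this is u_n(θ₀)ᵀ applied to the score ∇_θ Σ_i ln p_{1/n}(y_i,θ) at θ₀). Then I(θ₀) is a symmetric positive definite matrix and the law of T_n under ℙ_n converges weakly, as n → ∞, to the centered Gaussian distribution on ℝ³ with covariance matrix I(θ₀). -/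

import Mathlib

open MeasureTheory Filter Set Topology Matrix

noncomputable section

namespace LevyLAN

/-- Standard Gaussian density `φ`. -/
def gauss (y : ℝ) : ℝ := (Real.sqrt (2 * Real.pi))⁻¹ * Real.exp (-(y ^ 2) / 2)

/-- Symmetric `α`-stable density `φ_α`, defined by Fourier inversion. -/
def stableDensity (α z : ℝ) : ℝ :=
  (2 * Real.pi)⁻¹ * ∫ u : ℝ, Real.cos (z * u) * Real.exp (-(|u| ^ α))

/-- `∂_α φ_α`. -/
def stableDensityDalpha (α z : ℝ) : ℝ :=
  -(2 * Real.pi)⁻¹ * ∫ u : ℝ, Real.cos (z * u) * |u| ^ α * Real.log |u| * Real.exp (-(|u| ^ α))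

/-- The operator `(D f) y = (y * f y)' = f y + y * f' y`. -/
def Dop (f : ℝ → ℝ) (y : ℝ) : ℝ := f y + y * deriv f y

/-- `f_α(y, w)`. -/
def fFun (α y w : ℝ) : ℝ := ∫ z : ℝ, gauss (y - w * z) * stableDensity α z

/-- `g_α(y, w)`. -/
def gFun (α y w : ℝ) : ℝ := ∫ z : ℝ, Dop gauss (y - w * z) * stableDensity α z

/-- `h_α(y, w)`. -/
def hFun (α y w : ℝ) : ℝ := ∫ z : ℝ, gauss (y - w * z) * Dop (stableDensity α) z

/-- `k_α(y, w)`. -/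
def kFun (α y w : ℝ) : ℝ := ∫ z : ℝ, gauss (y - w * z) * stableDensityDalpha α z

/-- `c_α`. -/
def cAlpha (α : ℝ) : ℝ :=
  if α = 1 then 1 / Real.pi
  else -(α * (α - 1)) / (2 * Real.Gamma (2 - α) * Real.cos (Real.pi * α / 2))

/-- `w_n(θ) = n^{1/2 - 1/α} δ / σ`. -/
def wn (n : ℕ) (σ δ α : ℝ) : ℝ := (n : ℝ) ^ ((1 : ℝ) / 2 - 1 / α) * δ / σ

/-- `l_α(y, w)` (it depends on `n`). -/
def lFun (n : ℕ) (α y w : ℝ) : ℝ :=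
  ((Real.log n - Real.log (Real.log n)) / (2 * α) - Real.log n / α ^ 2) * hFun α y w
    + kFun α y w

def kappa0 (σ δ α : ℝ) : ℝ := 2 * cAlpha α / (α * (2 - α) ^ (α / 2)) * (δ / σ) ^ α

def kappa1 (σ δ α : ℝ) : ℝ :=
  Real.log (δ / σ) + deriv cAlpha α / cAlpha α - Real.log (2 - α) / 2 - 1 / α

/-- The density `p_{1/n}(y, θ)`, with parameter `θ = (σ, δ, α) : Fin 3 → ℝ`. -/
def pdens (n : ℕ) (θ : Fin 3 → ℝ) (y : ℝ) : ℝ :=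
  Real.sqrt n / θ 0 * fFun (θ 2) (Real.sqrt n * y / θ 0) (wn n (θ 0) (θ 1) (θ 2))

/-- The log-likelihood `ln L_n(θ)`. -/
def logLik (n : ℕ) (θ : Fin 3 → ℝ) (x : Fin n → ℝ) : ℝ :=
  ∑ i, Real.log (pdens n θ (x i))

/-- Partial derivative in the `j`-th parameter coordinate. -/
def pderiv (j : Fin 3) (F : (Fin 3 → ℝ) → ℝ) (θ : Fin 3 → ℝ) : ℝ :=
  deriv (fun t => F (Function.update θ j t)) (θ j)

/-- The score `G_n(θ) = ∇_θ ln L_n(θ)`. -/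
def scoreVec (n : ℕ) (θ : Fin 3 → ℝ) (x : Fin n → ℝ) : Fin 3 → ℝ :=
  fun j => pderiv j (fun θ' => logLik n θ' x) θ

/-- The Hessian matrix `J_n(θ)` of the log-likelihood. -/
def hessMat (n : ℕ) (θ : Fin 3 → ℝ) (x : Fin n → ℝ) : Matrix (Fin 3) (Fin 3) ℝ :=
  Matrix.of fun i j => pderiv i (fun θ' => pderiv j (fun θ'' => logLik n θ'' x) θ') θ

def rate (n : ℕ) (α : ℝ) : ℝ := Real.log n ^ (α / 4) / (n : ℝ) ^ (α / 4)

/-- The rate matrix `u_n(θ)`. -/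
def un (n : ℕ) (θ : Fin 3 → ℝ) : Matrix (Fin 3) (Fin 3) ℝ :=
  !![1 / Real.sqrt n, 0, 0;
     0, rate n (θ 2), -(rate n (θ 2) * (θ 1 / (2 * θ 2)) * (Real.log n - Real.log (Real.log n)));
     0, 0, rate n (θ 2)]

/-- The information matrix `I(θ)`. -/
def Imat (θ : Fin 3 → ℝ) : Matrix (Fin 3) (Fin 3) ℝ :=
  !![2 / θ 0 ^ 2, 0, 0;
     0, θ 2 ^ 2 / θ 1 ^ 2 * kappa0 (θ 0) (θ 1) (θ 2),
        θ 2 / θ 1 * kappa0 (θ 0) (θ 1) (θ 2) * kappa1 (θ 0) (θ 1) (θ 2);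
     0, θ 2 / θ 1 * kappa0 (θ 0) (θ 1) (θ 2) * kappa1 (θ 0) (θ 1) (θ 2),
        kappa0 (θ 0) (θ 1) (θ 2) * (kappa1 (θ 0) (θ 1) (θ 2) ^ 2 + 1 / θ 2 ^ 2)]

/-- `ℙ_n`, the `n`-fold product of the law with Lebesgue density `p_{1/n}(·, θ)`. -/
def Pn (n : ℕ) (θ : Fin 3 → ℝ) : Measure (Fin n → ℝ) :=
  Measure.pi fun _ => MeasureTheory.volume.withDensity fun y => ENNReal.ofReal (pdens n θ y)

/-- The standard Gaussian measure on `ℝ³`. -/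
def stdGauss3 : Measure (Fin 3 → ℝ) :=
  Measure.pi fun _ => ProbabilityTheory.gaussianReal 0 1

/-- Euclidean (Frobenius) norm of a real 3×3 matrix. -/
def frobNorm (M : Matrix (Fin 3) (Fin 3) ℝ) : ℝ := Real.sqrt (∑ i, ∑ j, M i j ^ 2)

/-- Euclidean norm of a vector of `ℝ³`. -/
def vecNorm (v : Fin 3 → ℝ) : ℝ := Real.sqrt (∑ j, v j ^ 2)

/-- The admissible families of functions `ψ_α^{(p)}`. -/
structure IsPsiFamily (ψ : ℝ → ℕ → ℝ → ℝ) : Prop where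
  contDiff : ∀ α ∈ Set.Ioo (0 : ℝ) 2, ∀ p : ℕ, ContDiff ℝ 2 (ψ α p)
  pos : ∀ α ∈ Set.Ioo (0 : ℝ) 2, ∀ p : ℕ, ∀ y : ℝ, 0 < ψ α p y
  even : ∀ α ∈ Set.Ioo (0 : ℝ) 2, ∀ p : ℕ, ∀ y : ℝ, ψ α p (-y) = ψ α p y
  eq_one : ∀ α ∈ Set.Ioo (0 : ℝ) 2, ∀ p : ℕ, ∀ y : ℝ, |y| ≤ 1 → ψ α p y = 1
  eq_tail : ∀ α ∈ Set.Ioo (0 : ℝ) 2, ∀ p : ℕ, ∀ y : ℝ, 3 ≤ |y| →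
    ψ α p y = Real.log |y| ^ p / |y| ^ (α + 1)
  unifBound : ∀ K : Set ℝ, K ⊆ Set.Ioo (0 : ℝ) 2 → IsCompact K → ∀ p : ℕ,
    ∃ c > (0 : ℝ), ∃ C : ℝ, ∀ α ∈ K, ∀ y : ℝ, 1 ≤ |y| → |y| ≤ 3 →
      c ≤ ψ α p y ∧ ψ α p y ≤ C

/-- `𝓘_α^{(k,l)}`. -/
def Ical (ψ : ℝ → ℕ → ℝ → ℝ) (α : ℝ) (k l : ℕ) (y : ℝ) : ℝ :=
  ∫ z in {z : ℝ | 1 < |z|}, Dop^[k] gauss (y - z) * ψ α l z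

/-- `f_α^{(k,l,m)}`. -/
def fklm (α : ℝ) (k l m : ℕ) (y w : ℝ) : ℝ :=
  ∫ z : ℝ, Dop^[k] gauss (y - w * z)
    * Dop^[l] (fun z' => iteratedDeriv m (fun a => stableDensity a z') α) z

def Gamman (n : ℕ) (α : ℝ) : ℝ := Real.sqrt ((1 - α / 2) * Real.log n)

def Mn (n : ℕ) (α : ℝ) : ℝ := Real.sqrt ((2 - α) * Real.log n)

def Kconst (σ δ α : ℝ) : ℝ := deriv cAlpha α + cAlpha α * Real.log (δ / σ)
/-- The statistic `T_n = u_n(θ₀)ᵀ G_n(θ₀)` written out explicitly. -/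
def Tstat (σ₀ δ₀ α₀ : ℝ) (n : ℕ) (x : Fin n → ℝ) : Fin 3 → ℝ :=
  ![-(1 / Real.sqrt n) * ∑ i, 1 / σ₀ *
      (gFun α₀ (Real.sqrt n * x i / σ₀) (wn n σ₀ δ₀ α₀) /
        fFun α₀ (Real.sqrt n * x i / σ₀) (wn n σ₀ δ₀ α₀)),
    -(rate n α₀) * ∑ i, 1 / δ₀ *
      (hFun α₀ (Real.sqrt n * x i / σ₀) (wn n σ₀ δ₀ α₀) /
        fFun α₀ (Real.sqrt n * x i / σ₀) (wn n σ₀ δ₀ α₀)),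
    rate n α₀ * ∑ i,
      lFun n α₀ (Real.sqrt n * x i / σ₀) (wn n σ₀ δ₀ α₀) /
        fFun α₀ (Real.sqrt n * x i / σ₀) (wn n σ₀ δ₀ α₀)]

/-! ### Contour shift and elementary decay -/

theorem integrable_exp_neg_abs {c : ℝ} (hc : 0 < c) :
    Integrable (fun s : ℝ => Real.exp (-(c * |s|))) := by
  rw [← integrableOn_univ, ← Set.Iic_union_Ioi (a := (0 : ℝ))]
  refine IntegrableOn.union ?_ ?_
  · have h := integrableOn_exp_mul_Iic hc 0
    refine h.congr_fun ?_ measurableSet_Iic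
    intro s hs
    simp only [Set.mem_Iic] at hs
    simp [abs_of_nonpos hs]
  · have h := integrableOn_exp_mul_Ioi (a := -c) (by linarith) 0
    refine h.congr_fun ?_ measurableSet_Ioi
    intro s hs
    simp only [Set.mem_Ioi] at hs
    simp [abs_of_pos hs]

theorem tendsto_exp_neg_abs_top {c : ℝ} (hc : 0 < c) :
    Tendsto (fun s : ℝ => Real.exp (-(c * |s|))) atTop (𝓝 0) := by
  refine Real.tendsto_exp_neg_atTop_nhds_zero.comp ?_
  exact (tendsto_abs_atTop_atTop).const_mul_atTop hc

theorem tendsto_exp_neg_abs_bot {c : ℝ} (hc : 0 < c) :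
    Tendsto (fun s : ℝ => Real.exp (-(c * |s|))) atBot (𝓝 0) := by
  refine Real.tendsto_exp_neg_atTop_nhds_zero.comp ?_
  exact (tendsto_abs_atBot_atTop).const_mul_atTop hc

/-- Shift of a horizontal contour. -/
theorem contour_shift (H : ℂ → ℂ) (hd : Differentiable ℂ H) (a b C : ℝ) (hab : a ≤ b)
    (hbd : ∀ s θ : ℝ, a ≤ θ → θ ≤ b → ‖H (s + θ * Complex.I)‖ ≤ C * Real.exp (-(1 / 2 * |s|))) :
    (∫ s : ℝ, H (s + a * Complex.I)) = ∫ s : ℝ, H (s + b * Complex.I) := by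
  have hintg : ∀ θ : ℝ, a ≤ θ → θ ≤ b → Integrable (fun s : ℝ => H (s + θ * Complex.I)) := by
    intro θ h1 h2
    refine ((integrable_exp_neg_abs (c := 1 / 2) (by norm_num)).const_mul C).mono' ?_ ?_
    · have : Continuous (fun s : ℝ => H (s + θ * Complex.I)) :=
        hd.continuous.comp (by fun_prop)
      exact this.aestronglyMeasurable
    · exact Filter.Eventually.of_forall fun s => hbd s θ h1 h2
  have hA := intervalIntegral_tendsto_integral (hintg a le_rfl hab) tendsto_neg_atTop_atBot tendsto_id
  have hB := intervalIntegral_tendsto_integral (hintg b hab le_rfl) tendsto_neg_atTop_atBot tendsto_id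
  have hv : ∀ f : ℝ → ℝ, Tendsto (fun T : ℝ => Real.exp (-(1 / 2 * |f T|))) atTop (𝓝 0) →
      Tendsto (fun T : ℝ => Complex.I • ∫ y : ℝ in a..b, H (f T + y * Complex.I)) atTop (𝓝 0) := by
    intro f hf
    rw [tendsto_zero_iff_norm_tendsto_zero]
    have h2 : Tendsto (fun T : ℝ => C * Real.exp (-(1 / 2 * |f T|)) * |b - a|) atTop (𝓝 0) := by
      simpa using (hf.const_mul C).mul_const |b - a|
    refine squeeze_zero (fun _ => norm_nonneg _) (fun T => ?_) h2
    rw [norm_smul, Complex.norm_I, one_mul]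
    refine intervalIntegral.norm_integral_le_of_norm_le_const ?_
    intro y hy
    rw [Set.uIoc_of_le hab] at hy
    exact hbd _ _ hy.1.le hy.2
  have hR := hv id (tendsto_exp_neg_abs_top (by norm_num))
  have hL := hv (fun T => -T) ((tendsto_exp_neg_abs_bot (by norm_num)).comp tendsto_neg_atTop_atBot)
  have key : ∀ T : ℝ, (∫ x : ℝ in (-T)..T, H (x + a * Complex.I)) -
      (∫ x : ℝ in (-T)..T, H (x + b * Complex.I)) +
      Complex.I • (∫ y : ℝ in a..b, H ((T : ℝ) + y * Complex.I)) -
      Complex.I • (∫ y : ℝ in a..b, H ((-T : ℝ) + y * Complex.I)) = 0 := by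
    intro T
    have := Complex.integral_boundary_rect_eq_zero_of_differentiableOn H
      (⟨-T, a⟩ : ℂ) (⟨T, b⟩ : ℂ) hd.differentiableOn
    simpa using this
  have hlim := ((hA.sub hB).add hR).sub hL
  have hz : Tendsto (fun _ : ℝ => (0 : ℂ)) atTop (𝓝 0) := tendsto_const_nhds
  have := tendsto_nhds_unique (hlim.congr fun T => by simpa using key T) hz
  simp only [add_zero, sub_zero] at this
  exact sub_eq_zero.mp this

/-- `e^{ps} exp(-m e^{qs})` decays exponentially at both ends, even with a linear factor. -/
theorem decay_bound {p m q : ℝ} (hp : 1 ≤ p) (hm : 0 < m) (hq : 0 < q) :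
    ∃ C : ℝ, 0 < C ∧ ∀ s : ℝ, (|s| + 2) * (Real.exp (p * s) * Real.exp (-(m * Real.exp (q * s))))
      ≤ C * Real.exp (-(1 / 2 * |s|)) := by
  obtain ⟨N, hN⟩ := exists_nat_ge ((p + 1) / q)
  have hN' : p + 1 ≤ N * q := by rwa [div_le_iff₀ hq] at hN
  set D : ℝ := max 1 (N.factorial / m ^ N) with hD
  have hD0 : 0 < D := lt_of_lt_of_le one_pos (le_max_left _ _)
  refine ⟨4 * D, by positivity, fun s => ?_⟩
  have h1 : |s| + 2 ≤ 4 * Real.exp (1 / 2 * |s|) := by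
    have := Real.add_one_le_exp (1 / 2 * |s|)
    have := abs_nonneg s
    linarith
  have h2 : Real.exp (p * s) * Real.exp (-(m * Real.exp (q * s))) ≤ D * Real.exp (-|s|) := by
    rcases le_total s 0 with hs | hs
    · rw [abs_of_nonpos hs, neg_neg]
      have e1 : Real.exp (p * s) ≤ Real.exp s := Real.exp_le_exp.mpr (by nlinarith)
      have e2 : Real.exp (-(m * Real.exp (q * s))) ≤ 1 :=
        Real.exp_le_one_iff.mpr (by have := Real.exp_pos (q * s); nlinarith)
      calc _ ≤ Real.exp s * 1 := by gcongr
        _ ≤ D * Real.exp s := by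
          rw [mul_comm]; gcongr; exact le_max_left _ _
    · rw [abs_of_nonneg hs]
      have hx : 0 < m * Real.exp (q * s) := by positivity
      have e1 := Real.pow_div_factorial_le_exp _ hx.le N
      have e2 : Real.exp (-(m * Real.exp (q * s))) ≤ N.factorial / (m * Real.exp (q * s)) ^ N := by
        rw [Real.exp_neg, inv_le_comm₀ (Real.exp_pos _) (by positivity), inv_div]
        exact e1
      have e3 : (N.factorial : ℝ) / (m * Real.exp (q * s)) ^ N
          = N.factorial / m ^ N * Real.exp (-(N * q * s)) := by
        rw [mul_pow, ← Real.exp_nat_mul, Real.exp_neg, mul_assoc]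
        field_simp
      rw [e3] at e2
      calc Real.exp (p * s) * Real.exp (-(m * Real.exp (q * s)))
          ≤ Real.exp (p * s) * (D * Real.exp (-(N * q * s))) := by
            gcongr
            exact e2.trans (by gcongr; exact le_max_right _ _)
        _ = D * Real.exp (p * s - N * q * s) := by
            rw [sub_eq_add_neg, Real.exp_add]; ring
        _ ≤ D * Real.exp (-s) := by
            gcongr
            nlinarith
  calc _ ≤ (4 * Real.exp (1 / 2 * |s|)) * (D * Real.exp (-|s|)) := by gcongr
    _ = 4 * D * (Real.exp (1 / 2 * |s|) * Real.exp (-|s|)) := by ring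
    _ = 4 * D * Real.exp (-(1 / 2 * |s|)) := by
        rw [← Real.exp_add]; congr 2; ring

/-- Substitution `u = e^s`. -/
theorem integral_Ioi_exp {E : Type*} [NormedAddCommGroup E] [NormedSpace ℝ E] (g : ℝ → E) :
    ∫ u in Ioi (0 : ℝ), g u = ∫ s : ℝ, Real.exp s • g (Real.exp s) := by
  have him : Ioi (0 : ℝ) = Real.exp '' univ := by
    rw [image_univ, Real.range_exp]
  rw [him]
  simpa [abs_of_pos (Real.exp_pos _)] using integral_image_eq_integral_abs_deriv_smul
      (MeasurableSet.univ) (fun x _ ↦ (Real.hasDerivAt_exp x).hasDerivWithinAt)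
      (fun x _ y _ hxy ↦ Real.exp_injective hxy) g

theorem integrableOn_Ioi_exp {E : Type*} [NormedAddCommGroup E] [NormedSpace ℝ E] (g : ℝ → E) :
    IntegrableOn g (Ioi (0 : ℝ)) ↔ Integrable (fun s : ℝ => Real.exp s • g (Real.exp s)) := by
  have him : Ioi (0 : ℝ) = Real.exp '' univ := by
    rw [image_univ, Real.range_exp]
  rw [him]
  simpa [abs_of_pos (Real.exp_pos _)] using integrableOn_image_iff_integrableOn_abs_deriv_smul
      (MeasurableSet.univ) (fun x _ ↦ (Real.hasDerivAt_exp x).hasDerivWithinAt)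
      (fun x _ y _ hxy ↦ Real.exp_injective hxy) g

theorem norm_exp_neg_sub_one_le {v : ℂ} (hv : 0 ≤ v.re) : ‖Complex.exp (-v) - 1‖ ≤ ‖v‖ := by
  have hconv : Convex ℝ {z : ℂ | 0 ≤ z.re} := convex_halfSpace_re_ge 0
  have := hconv.norm_image_sub_le_of_norm_hasDerivWithin_le (𝕜 := ℂ)
    (f := fun z => Complex.exp (-z)) (f' := fun z => -Complex.exp (-z)) (C := 1) (x := 0) (y := v)
    (fun z _ => by
      have := ((hasDerivAt_neg z).cexp).hasDerivWithinAt (s := {z : ℂ | 0 ≤ z.re})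
      simpa using this)
    (fun z hz => by
      rw [norm_neg, Complex.norm_exp, Complex.neg_re]
      exact Real.exp_le_one_iff.mpr (by simpa using hz)) (by simp) hv
  simpa using this

theorem norm_exp_neg_sub_one_add_le {v : ℂ} (hv : 0 ≤ v.re) :
    ‖Complex.exp (-v) - 1 + v‖ ≤ ‖v‖ ^ 2 := by
  have hconv : Convex ℝ ({z : ℂ | 0 ≤ z.re} ∩ Metric.closedBall 0 ‖v‖) :=
    (convex_halfSpace_re_ge 0).inter (convex_closedBall _ _)
  have := hconv.norm_image_sub_le_of_norm_hasDerivWithin_le (𝕜 := ℂ)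
    (f := fun z => Complex.exp (-z) + z) (f' := fun z => -Complex.exp (-z) + 1) (C := ‖v‖)
    (x := 0) (y := v)
    (fun z _ => by
      have := (((hasDerivAt_neg z).cexp).fun_add (hasDerivAt_id z)).hasDerivWithinAt
        (s := {z : ℂ | 0 ≤ z.re} ∩ Metric.closedBall 0 ‖v‖)
      simpa using this)
    (fun z hz => by
      have h1 := norm_exp_neg_sub_one_le (v := z) hz.1
      have h2 : ‖z‖ ≤ ‖v‖ := by simpa using hz.2
      have : -Complex.exp (-z) + 1 = -(Complex.exp (-z) - 1) := by ring
      rw [this, norm_neg]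
      exact h1.trans h2) (by simp) ⟨hv, by simp⟩
  simp only [neg_zero, Complex.exp_zero, add_zero, sub_zero] at this
  have e : Complex.exp (-v) - 1 + v = Complex.exp (-v) + v - 1 := by ring
  rw [sq, e]
  exact this

/-! ### Rotated Fourier integrals -/

/-- Pure power oscillating integrand in logarithmic coordinates. -/
def Pc (z : ℝ) (j : ℕ) (p : ℝ) (ζ : ℂ) : ℂ :=
  ζ ^ j * Complex.exp (p * ζ) * Complex.exp (Complex.I * z * Complex.exp ζ)

/-- The factor `exp (- u^α)` in logarithmic coordinates. -/
def Ec (α : ℝ) (ζ : ℂ) : ℂ := Complex.exp (-Complex.exp (α * ζ))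

theorem differentiable_Pc (z : ℝ) (j : ℕ) (p : ℝ) : Differentiable ℂ (Pc z j p) := by
  unfold Pc; fun_prop

theorem differentiable_Ec (α : ℝ) : Differentiable ℂ (Ec α) := by
  unfold Ec; fun_prop

theorem exp_mul_re (a s θ : ℝ) : (Complex.exp (a * ((s : ℂ) + θ * Complex.I))).re
    = Real.exp (a * s) * Real.cos (a * θ) := by
  rw [Complex.exp_re]; simp

theorem norm_exp_mul (a s θ : ℝ) : ‖Complex.exp (a * ((s : ℂ) + θ * Complex.I))‖
    = Real.exp (a * s) := by
  rw [Complex.norm_exp]; simp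

theorem norm_exp_osc (z s θ : ℝ) :
    ‖Complex.exp (Complex.I * z * Complex.exp ((s : ℂ) + θ * Complex.I))‖
      = Real.exp (-(z * Real.sin θ * Real.exp s)) := by
  have h1 : (Complex.exp ((s : ℂ) + θ * Complex.I)).im = Real.exp s * Real.sin θ := by
    rw [Complex.exp_im]; simp
  rw [Complex.norm_exp]
  congr 1
  rw [mul_assoc, Complex.I_mul_re, Complex.im_ofReal_mul, h1]
  ring

theorem norm_pow_le {j : ℕ} (hj : j ≤ 1) {s θ : ℝ} (h0 : 0 ≤ θ) (h2 : θ ≤ 2) :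
    ‖((s : ℂ) + θ * Complex.I) ^ j‖ ≤ |s| + 2 := by
  have hb : ‖(s : ℂ) + θ * Complex.I‖ ≤ |s| + 2 := by
    refine (norm_add_le _ _).trans ?_
    simp only [Complex.norm_real, norm_mul, Complex.norm_I, mul_one, Real.norm_eq_abs]
    rw [abs_of_nonneg h0]; linarith
  interval_cases j
  · simp; have := abs_nonneg s; linarith
  · simpa using hb

theorem norm_Pc_le {z : ℝ} {j : ℕ} (hj : j ≤ 1) {p s θ : ℝ} (h0 : 0 ≤ θ) (h2 : θ ≤ 2) :
    ‖Pc z j p (s + θ * Complex.I)‖ ≤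
      (|s| + 2) * (Real.exp (p * s) * Real.exp (-(z * Real.sin θ * Real.exp s))) := by
  unfold Pc
  rw [norm_mul, norm_mul, norm_exp_mul, norm_exp_osc, mul_assoc]
  gcongr
  exact norm_pow_le hj h0 h2

theorem pi_div_eight_le : Real.pi / 8 ≤ 2 := by linarith [Real.pi_le_four]
theorem pi_div_two_le : Real.pi / 2 ≤ 2 := by linarith [Real.pi_le_four]

theorem sin_eighth_pos : 0 < Real.sin (Real.pi / 8) :=
  Real.sin_pos_of_pos_of_lt_pi (by positivity) (by linarith [Real.pi_pos])

theorem cos_ge_half {α θ : ℝ} (hα0 : 0 < α) (hα2 : α < 2) (h0 : 0 ≤ θ) (h1 : θ ≤ Real.pi / 8) :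
    1 / 2 ≤ Real.cos (α * θ) := by
  rw [← Real.cos_pi_div_three]
  refine Real.cos_le_cos_of_nonneg_of_le_pi (by positivity) (by linarith [Real.pi_pos]) ?_
  nlinarith [Real.pi_pos]

theorem Ec_re_nonneg {α θ s : ℝ} (hα0 : 0 < α) (hα2 : α < 2) (h0 : 0 ≤ θ)
    (h1 : θ ≤ Real.pi / 8) : 0 ≤ (Complex.exp (α * ((s : ℂ) + θ * Complex.I))).re := by
  rw [exp_mul_re]
  have := cos_ge_half hα0 hα2 h0 h1
  have := Real.exp_pos (α * s)
  positivity

theorem norm_Ec_le {α θ s : ℝ} (hα0 : 0 < α) (hα2 : α < 2) (h0 : 0 ≤ θ) (h1 : θ ≤ Real.pi / 8) :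
    ‖Ec α (s + θ * Complex.I)‖ ≤ Real.exp (-(1 / 2 * Real.exp (α * s))) := by
  unfold Ec
  rw [Complex.norm_exp, Complex.neg_re, exp_mul_re]
  apply Real.exp_le_exp.mpr
  have := cos_ge_half hα0 hα2 h0 h1
  have := Real.exp_pos (α * s)
  nlinarith

theorem norm_PE_le {α : ℝ} (hα0 : 0 < α) (hα2 : α < 2) {z : ℝ} (hz : 0 ≤ z) {j : ℕ} (hj : j ≤ 1)
    {p : ℝ} {s θ : ℝ} (h0 : 0 ≤ θ) (h1 : θ ≤ Real.pi / 8) :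
    ‖Pc z j p (s + θ * Complex.I) * Ec α (s + θ * Complex.I)‖ ≤
      (|s| + 2) * (Real.exp (p * s) * Real.exp (-(1 / 2 * Real.exp (α * s)))) := by
  rw [norm_mul]
  have a1 := norm_Pc_le (z := z) hj (p := p) (s := s) h0 (h1.trans pi_div_eight_le)
  have a2 := norm_Ec_le (s := s) hα0 hα2 h0 h1
  have a3 : Real.exp (-(z * Real.sin θ * Real.exp s)) ≤ 1 := by
    apply Real.exp_le_one_iff.mpr
    have : 0 ≤ Real.sin θ := Real.sin_nonneg_of_nonneg_of_le_pi h0 (by linarith [Real.pi_pos])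
    have := Real.exp_pos s
    simp only [Left.neg_nonpos_iff]; positivity
  calc _ ≤ (|s| + 2) * (Real.exp (p * s) * 1) * Real.exp (-(1 / 2 * Real.exp (α * s))) := by
        gcongr
        exact a1.trans (by gcongr)
    _ = _ := by ring

theorem integrable_of_decay {H : ℂ → ℂ} (hd : Continuous H) (C θ : ℝ)
    (hbd : ∀ s : ℝ, ‖H (s + θ * Complex.I)‖ ≤ C * Real.exp (-(1 / 2 * |s|))) :
    Integrable (fun s : ℝ => H (s + θ * Complex.I)) := by
  refine ((integrable_exp_neg_abs (c := 1 / 2) (by norm_num)).const_mul C).mono' ?_ ?_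
  · have : Continuous (fun s : ℝ => H (s + θ * Complex.I)) := hd.comp (by fun_prop)
    exact this.aestronglyMeasurable
  · exact Filter.Eventually.of_forall hbd

theorem integrable_PE {α : ℝ} (hα0 : 0 < α) (hα2 : α < 2) {z : ℝ} (hz : 0 ≤ z) {j : ℕ} (hj : j ≤ 1)
    {p : ℝ} (hp : 1 ≤ p) {θ : ℝ} (h0 : 0 ≤ θ) (h1 : θ ≤ Real.pi / 8) :
    Integrable (fun s : ℝ => Pc z j p (s + θ * Complex.I) * Ec α (s + θ * Complex.I)) := by
  obtain ⟨C, -, hC⟩ := decay_bound hp (one_half_pos (α := ℝ)) hα0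
  exact integrable_of_decay (H := fun ζ => Pc z j p ζ * Ec α ζ)
    ((differentiable_Pc z j p).mul (differentiable_Ec α)).continuous C θ
    fun s => (norm_PE_le hα0 hα2 hz hj h0 h1).trans (hC s)

theorem shift_PE {α : ℝ} (hα0 : 0 < α) (hα2 : α < 2) {z : ℝ} (hz : 0 ≤ z) {j : ℕ} (hj : j ≤ 1)
    {p : ℝ} (hp : 1 ≤ p) :
    (∫ s : ℝ, Pc z j p s * Ec α s) =
      ∫ s : ℝ, Pc z j p (s + (Real.pi / 8 : ℝ) * Complex.I) *
        Ec α (s + (Real.pi / 8 : ℝ) * Complex.I) := by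
  obtain ⟨C, -, hC⟩ := decay_bound hp (one_half_pos (α := ℝ)) hα0
  have := contour_shift (fun ζ => Pc z j p ζ * Ec α ζ)
    ((differentiable_Pc z j p).mul (differentiable_Ec α)) 0 (Real.pi / 8) C (by positivity)
    fun s θ h0 h1 => (norm_PE_le hα0 hα2 hz hj h0 h1).trans (hC s)
  simpa using this

theorem norm_Pc_le' {z : ℝ} (hz : 0 ≤ z) {j : ℕ} (hj : j ≤ 1) {p s θ : ℝ} (h0 : Real.pi / 8 ≤ θ)
    (h2 : θ ≤ Real.pi / 2) : ‖Pc z j p (s + θ * Complex.I)‖ ≤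
      (|s| + 2) * (Real.exp (p * s) * Real.exp (-(z * Real.sin (Real.pi / 8) * Real.exp s))) := by
  have hpi := Real.pi_pos
  refine (norm_Pc_le hj (by linarith) (h2.trans pi_div_two_le)).trans ?_
  have := Real.sin_le_sin_of_le_of_le_pi_div_two (by linarith) h2 h0
  gcongr

theorem integrable_Pc {z : ℝ} (hz : 0 < z) {j : ℕ} (hj : j ≤ 1)
    {p : ℝ} (hp : 1 ≤ p) {θ : ℝ} (h0 : Real.pi / 8 ≤ θ) (h2 : θ ≤ Real.pi / 2) :
    Integrable (fun s : ℝ => Pc z j p (s + θ * Complex.I)) := by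
  obtain ⟨C, -, hC⟩ := decay_bound hp (mul_pos hz sin_eighth_pos) one_pos
  simp only [one_mul] at hC
  exact integrable_of_decay (differentiable_Pc z j p).continuous C θ
    fun s => (norm_Pc_le' hz.le hj h0 h2).trans (hC s)

theorem shift_Pc {z : ℝ} (hz : 0 < z) {j : ℕ} (hj : j ≤ 1) {p : ℝ} (hp : 1 ≤ p) :
    (∫ s : ℝ, Pc z j p (s + (Real.pi / 8 : ℝ) * Complex.I)) =
      ∫ s : ℝ, Pc z j p (s + (Real.pi / 2 : ℝ) * Complex.I) := by
  obtain ⟨C, -, hC⟩ := decay_bound hp (mul_pos hz sin_eighth_pos) one_pos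
  simp only [one_mul] at hC
  exact contour_shift (Pc z j p) (differentiable_Pc z j p) _ _ C
    (by linarith [Real.pi_pos])
    fun s θ h0 h1 => (norm_Pc_le' hz.le hj h0 h1).trans (hC s)

/-- Error bound on the rotated line. -/
theorem err_bound (α : ℝ) (hα0 : 0 < α) : ∃ C : ℝ, 0 < C ∧ ∀ z : ℝ, 1 ≤ z → ∀ F : ℝ → ℂ,
    (∀ s : ℝ, ‖F s‖ ≤ (|s| + 2) * (Real.exp ((1 + 2 * α) * s) *
      Real.exp (-(z * Real.sin (Real.pi / 8) * Real.exp s)))) →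
    ‖∫ s : ℝ, F s‖ ≤ C * z ^ (-(1 + 3 * α / 2)) := by
  obtain ⟨C, hC0, hC⟩ := decay_bound (p := 1 + 2 * α) (by linarith) sin_eighth_pos one_pos
  simp only [one_mul] at hC
  have hI := (integrable_exp_neg_abs (c := 1 / 2) (by norm_num))
  set D : ℝ := ∫ s : ℝ, Real.exp (-(1 / 2 * |s|)) with hD
  have hD0 : 0 ≤ D := integral_nonneg fun _ => (Real.exp_pos _).le
  refine ⟨(1 + 2 / α) * C * (D + 1), by positivity, fun z hz F hF => ?_⟩
  have hz0 : 0 < z := by linarith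
  have hlz : 0 ≤ Real.log z := Real.log_nonneg hz
  rw [← integral_sub_right_eq_self F (Real.log z)]
  have hb : ∀ s : ℝ, ‖F (s - Real.log z)‖ ≤
      (1 + Real.log z) * z ^ (-(1 + 2 * α)) * (C * Real.exp (-(1 / 2 * |s|))) := by
    intro s
    refine (hF _).trans ?_
    have e1 : Real.exp (s - Real.log z) = Real.exp s / z := by
      rw [Real.exp_sub, Real.exp_log hz0]
    have e2 : Real.exp ((1 + 2 * α) * (s - Real.log z)) =
        z ^ (-(1 + 2 * α)) * Real.exp ((1 + 2 * α) * s) := by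
      rw [Real.rpow_def_of_pos hz0, ← Real.exp_add]; congr 1; ring
    have e3 : z * Real.sin (Real.pi / 8) * (Real.exp s / z) =
        Real.sin (Real.pi / 8) * Real.exp s := by field_simp
    have e4 : |s - Real.log z| + 2 ≤ (1 + Real.log z) * (|s| + 2) := by
      have := abs_sub s (Real.log z)
      rw [abs_of_nonneg hlz] at this
      nlinarith [abs_nonneg s]
    rw [e1, e2, e3]
    calc _ ≤ ((1 + Real.log z) * (|s| + 2)) * (z ^ (-(1 + 2 * α)) * Real.exp ((1 + 2 * α) * s) *
            Real.exp (-(Real.sin (Real.pi / 8) * Real.exp s))) := by gcongr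
      _ = (1 + Real.log z) * z ^ (-(1 + 2 * α)) * ((|s| + 2) * (Real.exp ((1 + 2 * α) * s) *
            Real.exp (-(Real.sin (Real.pi / 8) * Real.exp s)))) := by ring
      _ ≤ _ := mul_le_mul_of_nonneg_left (hC s) (by positivity)
  have h1 := norm_integral_le_of_norm_le ((hI.const_mul C).const_mul _)
    (Filter.Eventually.of_forall hb)
  rw [integral_const_mul, integral_const_mul] at h1
  refine h1.trans ?_
  have h2 : 1 + Real.log z ≤ (1 + 2 / α) * z ^ (α / 2) := by
    have a1 := Real.log_le_rpow_div hz0.le (show 0 < α / 2 by positivity)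
    have a2 : 1 ≤ z ^ (α / 2) := Real.one_le_rpow hz (by positivity)
    have a3 : z ^ (α / 2) / (α / 2) = 2 / α * z ^ (α / 2) := by field_simp
    linarith
  calc (1 + Real.log z) * z ^ (-(1 + 2 * α)) * (C * D)
      ≤ ((1 + 2 / α) * z ^ (α / 2)) * z ^ (-(1 + 2 * α)) * (C * (D + 1)) := by
        gcongr; linarith
    _ = (1 + 2 / α) * C * (D + 1) * (z ^ (α / 2) * z ^ (-(1 + 2 * α))) := by ring
    _ = _ := by
        rw [← Real.rpow_add hz0]; congr 2; ring

/-! ### Gamma integrals and the constant `c_α` -/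

def G0 (α : ℝ) : ℝ := ∫ s : ℝ, Real.exp ((1 + α) * s) * Real.exp (-Real.exp s)
def G1 (α : ℝ) : ℝ := ∫ s : ℝ, s * (Real.exp ((1 + α) * s) * Real.exp (-Real.exp s))

theorem G0_eq {α : ℝ} (hα0 : 0 < α) : G0 α = Real.Gamma (1 + α) := by
  rw [Real.Gamma_eq_integral (by linarith), integral_Ioi_exp]
  unfold G0
  congr 1; ext s
  rw [smul_eq_mul, Real.rpow_def_of_pos (Real.exp_pos s), Real.log_exp, ← Real.exp_add,
    ← Real.exp_add, ← Real.exp_add]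
  congr 1; ring

theorem hasDerivAt_Gamma {α : ℝ} (hα0 : 0 < α) : HasDerivAt Real.Gamma (G1 α) (1 + α) := by
  have h1 := Complex.hasDerivAt_GammaIntegral (s := ((1 + α : ℝ) : ℂ)) (by simp; linarith)
  have h2 : HasDerivAt Complex.Gamma
      (∫ t : ℝ in Ioi 0, (t : ℂ) ^ (((1 + α : ℝ) : ℂ) - 1) * (Real.log t * Real.exp (-t)))
      ((1 + α : ℝ) : ℂ) := by
    refine h1.congr_of_eventuallyEq ?_
    have : {s : ℂ | 0 < s.re} ∈ 𝓝 ((1 + α : ℝ) : ℂ) :=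
      (isOpen_lt continuous_const Complex.continuous_re).mem_nhds (by simp; linarith)
    filter_upwards [this] with s hs
    exact Complex.Gamma_eq_integral hs
  have h3 := h2.real_of_complex
  have h4 : (∫ t : ℝ in Ioi 0, (t : ℂ) ^ (((1 + α : ℝ) : ℂ) - 1) * (Real.log t * Real.exp (-t))).re
      = G1 α := by
    have : (∫ t : ℝ in Ioi 0, (t : ℂ) ^ (((1 + α : ℝ) : ℂ) - 1) * (Real.log t * Real.exp (-t)))
        = ((∫ t : ℝ in Ioi 0, t ^ α * (Real.log t * Real.exp (-t)) : ℝ) : ℂ) := by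
      rw [← integral_complex_ofReal]
      refine setIntegral_congr_fun measurableSet_Ioi fun t ht => ?_
      have ht' : (0 : ℝ) ≤ t := le_of_lt ht
      push_cast [Complex.ofReal_cpow ht']
      congr 2; ring
    rw [this, Complex.ofReal_re, integral_Ioi_exp]
    unfold G1
    congr 1; ext s
    rw [smul_eq_mul, Real.rpow_def_of_pos (Real.exp_pos s), Real.log_exp]
    have : Real.exp ((1 + α) * s) = Real.exp s * Real.exp (s * α) := by
      rw [← Real.exp_add]; congr 1; ring
    rw [this]; ring
  rw [h4] at h3
  exact h3

theorem cAlpha_eq {α : ℝ} (hα0 : 0 < α) (hα2 : α < 2) :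
    cAlpha α = Real.Gamma (1 + α) * Real.sin (Real.pi * α / 2) / Real.pi := by
  have hpi := Real.pi_pos
  unfold cAlpha
  split_ifs with h
  · subst h
    have : Real.Gamma (1 + 1) = 1 := by
      have := Real.Gamma_add_one (s := 1) one_ne_zero
      rw [this]; simp
    simp [this]
  · have hc : Real.cos (Real.pi * α / 2) ≠ 0 := by
      rcases lt_or_gt_of_ne h with h1 | h1
      · exact (Real.cos_pos_of_mem_Ioo ⟨by nlinarith, by nlinarith⟩).ne'
      · exact (Real.cos_neg_of_pi_div_two_lt_of_lt (by nlinarith) (by nlinarith)).ne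
    have hs : Real.sin (Real.pi * α) = 2 * Real.sin (Real.pi * α / 2) * Real.cos (Real.pi * α / 2) := by
      rw [← Real.sin_two_mul]; congr 1; ring
    have hsin : Real.sin (Real.pi * α / 2) ≠ 0 :=
      (Real.sin_pos_of_pos_of_lt_pi (by positivity) (by nlinarith)).ne'
    have h1 := Real.Gamma_mul_Gamma_one_sub α
    have h2 : Real.Gamma (2 - α) = (1 - α) * Real.Gamma (1 - α) := by
      rw [← Real.Gamma_add_one (by intro h'; apply h; linarith)]; congr 1; ring
    have h3 : Real.Gamma (1 + α) = α * Real.Gamma α := by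
      rw [← Real.Gamma_add_one hα0.ne']; congr 1; ring
    have h4 : Real.Gamma α ≠ 0 := (Real.Gamma_pos_of_pos hα0).ne'
    have h5 : Real.Gamma (1 - α) = Real.pi / Real.sin (Real.pi * α) / Real.Gamma α := by
      field_simp at h1 ⊢; linarith
    have h6 : (1 - α) ≠ 0 := by intro h'; apply h; linarith
    rw [h2, h3, h5, hs]
    generalize Real.cos (Real.pi * α / 2) = c at *
    generalize Real.sin (Real.pi * α / 2) = t at *
    field_simp
    ring

theorem cAlpha_pos {α : ℝ} (hα0 : 0 < α) (hα2 : α < 2) : 0 < cAlpha α := by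
  rw [cAlpha_eq hα0 hα2]
  have hpi := Real.pi_pos
  have h1 := Real.Gamma_pos_of_pos (show 0 < 1 + α by linarith)
  have h2 : 0 < Real.sin (Real.pi * α / 2) :=
    Real.sin_pos_of_pos_of_lt_pi (by positivity) (by nlinarith)
  positivity

theorem deriv_cAlpha {α : ℝ} (hα0 : 0 < α) (hα2 : α < 2) :
    deriv cAlpha α = (G1 α * Real.sin (Real.pi * α / 2) +
      Real.Gamma (1 + α) * (Real.cos (Real.pi * α / 2) * (Real.pi / 2))) / Real.pi := by
  have h1 : HasDerivAt (fun a => Real.Gamma (1 + a) * Real.sin (Real.pi * a / 2) / Real.pi)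
      ((G1 α * Real.sin (Real.pi * α / 2) +
      Real.Gamma (1 + α) * (Real.cos (Real.pi * α / 2) * (Real.pi / 2))) / Real.pi) α := by
    have a1 : HasDerivAt (fun a : ℝ => Real.Gamma (1 + a)) (G1 α) α :=
      HasDerivAt.comp_const_add 1 α (hasDerivAt_Gamma hα0)
    have a2 : HasDerivAt (fun a : ℝ => Real.pi * a / 2) (Real.pi / 2) α := by
      have := ((hasDerivAt_id α).const_mul Real.pi).div_const 2
      simpa using this
    exact (a1.mul a2.sin).div_const _
  refine HasDerivAt.deriv (h1.congr_of_eventuallyEq ?_)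
  filter_upwards [Ioo_mem_nhds hα0 hα2] with a ha
  exact cAlpha_eq ha.1 ha.2

/-! ### Pure integrals on the imaginary half-line -/

theorem Pc_half (z : ℝ) (j : ℕ) (p s : ℝ) : Pc z j p (s + (Real.pi / 2 : ℝ) * Complex.I) =
    ((s : ℂ) + (Real.pi / 2 : ℝ) * Complex.I) ^ j *
      Complex.exp ((p * (Real.pi / 2) : ℝ) * Complex.I) *
      ((Real.exp (p * s) * Real.exp (-(z * Real.exp s)) : ℝ) : ℂ) := by
  unfold Pc
  have h1 : Complex.exp ((s : ℂ) + (Real.pi / 2 : ℝ) * Complex.I) = Complex.I * Real.exp s := by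
    rw [Complex.exp_add]; push_cast; rw [Complex.exp_pi_div_two_mul_I]; ring
  have h2 : Complex.I * z * (Complex.I * Real.exp s) = ((-(z * Real.exp s) : ℝ) : ℂ) := by
    push_cast
    linear_combination (z * Complex.exp s) * Complex.I_mul_I
  have h3 : (p : ℂ) * ((s : ℂ) + (Real.pi / 2 : ℝ) * Complex.I) =
      ((p * s : ℝ) : ℂ) + (p * (Real.pi / 2) : ℝ) * Complex.I := by push_cast; ring
  rw [h1, h2, h3, Complex.exp_add]
  push_cast
  ring

theorem re_Pc_zero_one (z s : ℝ) : (Pc z 0 1 (s + (Real.pi / 2 : ℝ) * Complex.I)).re = 0 := by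
  rw [Pc_half, Complex.re_mul_ofReal, pow_zero, one_mul, Complex.exp_ofReal_mul_I_re]
  simp

theorem cos_aux (α : ℝ) : Real.cos ((1 + α) * (Real.pi / 2)) = -Real.sin (Real.pi * α / 2) := by
  rw [← Real.cos_add_pi_div_two]; congr 1; ring

theorem sin_aux (α : ℝ) : Real.sin ((1 + α) * (Real.pi / 2)) = Real.cos (Real.pi * α / 2) := by
  rw [← Real.sin_add_pi_div_two]; congr 1; ring

theorem re_Pc_zero (z α s : ℝ) : (Pc z 0 (1 + α) (s + (Real.pi / 2 : ℝ) * Complex.I)).re =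
    -Real.sin (Real.pi * α / 2) * (Real.exp ((1 + α) * s) * Real.exp (-(z * Real.exp s))) := by
  rw [Pc_half, Complex.re_mul_ofReal, pow_zero, one_mul, Complex.exp_ofReal_mul_I_re, cos_aux]

theorem re_Pc_one (z α s : ℝ) : (Pc z 1 (1 + α) (s + (Real.pi / 2 : ℝ) * Complex.I)).re =
    (-Real.sin (Real.pi * α / 2) * s - Real.pi / 2 * Real.cos (Real.pi * α / 2)) *
      (Real.exp ((1 + α) * s) * Real.exp (-(z * Real.exp s))) := by
  rw [Pc_half, Complex.re_mul_ofReal, pow_one, Complex.mul_re, Complex.exp_ofReal_mul_I_re,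
    Complex.exp_ofReal_mul_I_im, cos_aux, sin_aux]
  simp
  ring

theorem integrable_G (α : ℝ) (hα0 : 0 < α) {j : ℕ} (hj : j ≤ 1) :
    Integrable (fun s : ℝ => s ^ j * (Real.exp ((1 + α) * s) * Real.exp (-Real.exp s))) := by
  obtain ⟨C, -, hC⟩ := decay_bound (p := 1 + α) (by linarith) one_pos one_pos
  simp only [one_mul] at hC
  refine ((integrable_exp_neg_abs (c := 1 / 2) (by norm_num)).const_mul C).mono' ?_ ?_
  · have : Continuous (fun s : ℝ => s ^ j * (Real.exp ((1 + α) * s) * Real.exp (-Real.exp s))) := by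
      fun_prop
    exact this.aestronglyMeasurable
  · refine Filter.Eventually.of_forall fun s => le_trans ?_ (hC s)
    rw [norm_mul, Real.norm_of_nonneg (show 0 ≤ Real.exp ((1 + α) * s) * Real.exp (-Real.exp s) by positivity)]
    gcongr
    have := abs_nonneg s
    interval_cases j
    · simp; linarith
    · simp

theorem G_shift {z : ℝ} (hz : 0 < z) (α : ℝ) (g : ℝ → ℝ) :
    ∫ s : ℝ, g s * (Real.exp ((1 + α) * s) * Real.exp (-(z * Real.exp s))) =
    z ^ (-(1 + α)) * ∫ s : ℝ, g (s - Real.log z) *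
      (Real.exp ((1 + α) * s) * Real.exp (-Real.exp s)) := by
  rw [← integral_sub_right_eq_self _ (Real.log z), ← integral_const_mul]
  congr 1; ext s
  have e1 : z * Real.exp (s - Real.log z) = Real.exp s := by
    rw [Real.exp_sub, Real.exp_log hz]; field_simp
  have e2 : Real.exp ((1 + α) * (s - Real.log z)) =
      z ^ (-(1 + α)) * Real.exp ((1 + α) * s) := by
    rw [Real.rpow_def_of_pos hz, ← Real.exp_add]; congr 1; ring
  rw [e1, e2]; ring

theorem re_int_Pc_zero {z : ℝ} (hz : 0 < z) {α : ℝ} (hα0 : 0 < α) (hα2 : α < 2) :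
    (∫ s : ℝ, Pc z 0 (1 + α) (s + (Real.pi / 2 : ℝ) * Complex.I)).re =
      -(Real.pi * cAlpha α * z ^ (-(1 + α))) := by
  have hpi := Real.pi_pos
  have := integral_re (integrable_Pc hz (j := 0) (by norm_num) (p := 1 + α) (by linarith)
    (θ := Real.pi / 2) (by linarith) le_rfl)
  simp only [RCLike.re_to_complex] at this
  rw [← this]
  simp only [re_Pc_zero]
  rw [G_shift hz α (fun _ => -Real.sin (Real.pi * α / 2)), integral_const_mul, ← G0, G0_eq hα0,
    cAlpha_eq hα0 hα2]
  field_simp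

theorem re_int_Pc_zero_one {z : ℝ} (hz : 0 < z) :
    (∫ s : ℝ, Pc z 0 1 (s + (Real.pi / 2 : ℝ) * Complex.I)).re = 0 := by
  have hpi := Real.pi_pos
  have := integral_re (integrable_Pc hz (j := 0) (by norm_num) (p := 1) le_rfl
    (θ := Real.pi / 2) (by linarith) le_rfl)
  simp only [RCLike.re_to_complex] at this
  rw [← this]
  simp only [re_Pc_zero_one, integral_zero]

theorem re_int_Pc_one {z : ℝ} (hz : 0 < z) {α : ℝ} (hα0 : 0 < α) (hα2 : α < 2) :
    (∫ s : ℝ, Pc z 1 (1 + α) (s + (Real.pi / 2 : ℝ) * Complex.I)).re =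
      -(Real.pi * (deriv cAlpha α - cAlpha α * Real.log z) * z ^ (-(1 + α))) := by
  have hpi := Real.pi_pos
  have := integral_re (integrable_Pc hz (j := 1) (by norm_num) (p := 1 + α) (by linarith)
    (θ := Real.pi / 2) (by linarith) le_rfl)
  simp only [RCLike.re_to_complex] at this
  rw [← this]
  simp only [re_Pc_one]
  rw [G_shift hz α (fun s => -Real.sin (Real.pi * α / 2) * s - Real.pi / 2 * Real.cos (Real.pi * α / 2))]
  have i0 := integrable_G α hα0 (j := 0) (by norm_num)
  have i1 := integrable_G α hα0 (j := 1) (by norm_num)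
  simp only [pow_zero, one_mul, pow_one] at i0 i1
  have e : ∀ s : ℝ, (-Real.sin (Real.pi * α / 2) * (s - Real.log z) - Real.pi / 2 * Real.cos (Real.pi * α / 2)) *
      (Real.exp ((1 + α) * s) * Real.exp (-Real.exp s)) =
      -Real.sin (Real.pi * α / 2) * (s * (Real.exp ((1 + α) * s) * Real.exp (-Real.exp s))) +
      (Real.sin (Real.pi * α / 2) * Real.log z - Real.pi / 2 * Real.cos (Real.pi * α / 2)) *
      (Real.exp ((1 + α) * s) * Real.exp (-Real.exp s)) := by intro s; ring
  simp only [e]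
  rw [integral_add (i1.const_mul _) (i0.const_mul _), integral_const_mul, integral_const_mul,
    ← G0, ← G1, G0_eq hα0, deriv_cAlpha hα0 hα2, cAlpha_eq hα0 hα2]
  field_simp
  ring

/-! ### Cosine integrals and the kernels -/

/-- Weight on the positive half-line. -/
def Wt (α : ℝ) (j : ℕ) (p u : ℝ) : ℝ := Real.log u ^ j * u ^ p * Real.exp (-(u ^ α))

def Kint (α : ℝ) (j : ℕ) (p z : ℝ) : ℝ := ∫ u in Ioi (0 : ℝ), Real.cos (z * u) * Wt α j p u

theorem measurable_Wt (α : ℝ) (j : ℕ) (p : ℝ) : Measurable (Wt α j p) := by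
  unfold Wt; fun_prop

theorem integrableOn_Wt {α : ℝ} (hα0 : 0 < α) {j : ℕ} (hj : j ≤ 1) {p : ℝ} (hp : 0 ≤ p) :
    IntegrableOn (Wt α j p) (Ioi (0 : ℝ)) := by
  rw [integrableOn_Ioi_exp]
  obtain ⟨C, -, hC⟩ := decay_bound (p := 1 + p) (by linarith) one_pos hα0
  simp only [one_mul] at hC
  refine ((integrable_exp_neg_abs (c := 1 / 2) (by norm_num)).const_mul C).mono' ?_ ?_
  · exact (Real.measurable_exp.smul ((measurable_Wt α j p).comp Real.measurable_exp)).aestronglyMeasurable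
  · refine Filter.Eventually.of_forall fun s => le_trans ?_ (hC s)
    unfold Wt
    rw [← Real.exp_mul, ← Real.exp_mul, Real.log_exp, smul_eq_mul]
    have e : Real.exp s * (s ^ j * Real.exp (s * p) * Real.exp (-Real.exp (s * α))) =
        s ^ j * (Real.exp ((1 + p) * s) * Real.exp (-Real.exp (α * s))) := by
      rw [show (1 + p) * s = s + s * p by ring, Real.exp_add, mul_comm α s]; ring
    rw [e, norm_mul, Real.norm_of_nonneg (show 0 ≤ Real.exp ((1 + p) * s) * Real.exp (-Real.exp (α * s)) by positivity)]
    gcongr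
    have := abs_nonneg s
    interval_cases j
    · simp; linarith
    · simp

theorem integrableOn_cos_Wt {α : ℝ} (hα0 : 0 < α) {j : ℕ} (hj : j ≤ 1) {p : ℝ} (hp : 0 ≤ p) (z : ℝ) :
    IntegrableOn (fun u => Real.cos (z * u) * Wt α j p u) (Ioi (0 : ℝ)) := by
  refine (integrableOn_Wt hα0 hj hp).bdd_mul (c := 1) (by fun_prop) ?_
  exact Filter.Eventually.of_forall fun u => by simpa using Real.abs_cos_le_one _

theorem Kint_neg (α : ℝ) (j : ℕ) (p z : ℝ) : Kint α j p (-z) = Kint α j p z := by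
  unfold Kint; simp [neg_mul, Real.cos_neg]

theorem Kint_abs (α : ℝ) (j : ℕ) (p z : ℝ) : Kint α j p |z| = Kint α j p z := by
  rcases abs_choice z with h | h <;> rw [h]
  exact Kint_neg _ _ _ _

theorem continuous_Kint {α : ℝ} (hα0 : 0 < α) {j : ℕ} (hj : j ≤ 1) {p : ℝ} (hp : 0 ≤ p) :
    Continuous (Kint α j p) := by
  unfold Kint
  refine continuous_of_dominated (bound := fun u => |Wt α j p u|) ?_ ?_ ?_ ?_
  · exact fun z => (integrableOn_cos_Wt hα0 hj hp z).aestronglyMeasurable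
  · refine fun z => Filter.Eventually.of_forall fun u => ?_
    rw [norm_mul, Real.norm_eq_abs, Real.norm_eq_abs]
    exact mul_le_of_le_one_left (abs_nonneg _) (Real.abs_cos_le_one _)
  · exact (integrableOn_Wt hα0 hj hp).abs
  · exact Filter.Eventually.of_forall fun u => by fun_prop

theorem abs_Kint_le {α : ℝ} (hα0 : 0 < α) {j : ℕ} (hj : j ≤ 1) {p : ℝ} (hp : 0 ≤ p) (z : ℝ) :
    |Kint α j p z| ≤ ∫ u in Ioi (0 : ℝ), |Wt α j p u| := by
  unfold Kint
  rw [← Real.norm_eq_abs]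
  refine norm_integral_le_of_norm_le (integrableOn_Wt hα0 hj hp).abs ?_
  refine Filter.Eventually.of_forall fun u => ?_
  rw [norm_mul, Real.norm_eq_abs, Real.norm_eq_abs]
  exact mul_le_of_le_one_left (abs_nonneg _) (Real.abs_cos_le_one _)

theorem Kint_eq {α : ℝ} (hα0 : 0 < α) (hα2 : α < 2) {z : ℝ} (hz : 0 ≤ z) {j : ℕ} (hj : j ≤ 1)
    {p : ℝ} (hp : 0 ≤ p) :
    Kint α j p z = (∫ s : ℝ, Pc z j (1 + p) s * Ec α s).re := by
  have h0 := integrable_PE hα0 hα2 hz hj (p := 1 + p) (by linarith) le_rfl (by positivity : (0:ℝ) ≤ Real.pi / 8)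
  simp only [Complex.ofReal_zero, zero_mul, add_zero] at h0
  have := integral_re h0
  simp only [RCLike.re_to_complex] at this
  rw [← this]
  unfold Kint
  rw [integral_Ioi_exp]
  congr 1; ext s
  unfold Pc Ec Wt
  have e1 : (s : ℂ) ^ j * Complex.exp (((1 + p : ℝ) : ℂ) * s) * Complex.exp (Complex.I * z * Complex.exp s) *
      Complex.exp (-Complex.exp (α * s)) =
      ((s ^ j * Real.exp ((1 + p) * s) * Real.exp (-Real.exp (α * s)) : ℝ) : ℂ) *
        Complex.exp ((z * Real.exp s : ℝ) * Complex.I) := by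
    push_cast
    rw [show Complex.I * z * Complex.exp s = z * Complex.exp s * Complex.I by ring]; ring
  rw [e1, Complex.re_ofReal_mul, Complex.exp_ofReal_mul_I_re, ← Real.exp_mul, ← Real.exp_mul,
    Real.log_exp, smul_eq_mul, show (1 + p) * s = s + s * p by ring, Real.exp_add, mul_comm α s]
  ring

theorem Kint_zero_asymp {α : ℝ} (hα0 : 0 < α) (hα2 : α < 2) : ∃ C : ℝ, 0 < C ∧ ∀ z : ℝ, 1 ≤ z →
    |Kint α 0 0 z - Real.pi * cAlpha α * z ^ (-(1 + α))| ≤ C * z ^ (-(1 + 3 * α / 2)) := by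
  obtain ⟨C, hC0, hC⟩ := err_bound α hα0
  refine ⟨C, hC0, fun z hz => ?_⟩
  have hz0 : 0 < z := by linarith
  have hpi := Real.pi_pos
  rw [Kint_eq hα0 hα2 hz0.le (by norm_num) le_rfl, shift_PE hα0 hα2 hz0.le (by norm_num) (by norm_num)]
  set θ : ℝ := Real.pi / 8
  have hθ2 : θ ≤ Real.pi / 2 := by simp only [θ]; linarith
  have i1 := integrable_PE hα0 hα2 hz0.le (j := 0) (by norm_num) (p := 1 + 0) (by norm_num) (θ := θ) (by positivity) le_rfl
  have i2 := integrable_Pc hz0 (j := 0) (by norm_num) (p := 1) le_rfl (θ := θ) le_rfl hθ2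
  have i3 := integrable_Pc hz0 (j := 0) (by norm_num) (p := 1 + α) (by linarith) (θ := θ) le_rfl hθ2
  have key := hC z hz (fun s : ℝ => Pc z 0 (1 + 0) (s + θ * Complex.I) * Ec α (s + θ * Complex.I)
      - (Pc z 0 1 (s + θ * Complex.I) - Pc z 0 (1 + α) (s + θ * Complex.I))) (fun s => by
    have e : Pc z 0 (1 + 0) (s + θ * Complex.I) * Ec α (s + θ * Complex.I)
      - (Pc z 0 1 (s + θ * Complex.I) - Pc z 0 (1 + α) (s + θ * Complex.I)) =
      Pc z 0 1 (s + θ * Complex.I) * (Complex.exp (-Complex.exp (α * (s + θ * Complex.I))) - 1 +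
        Complex.exp (α * (s + θ * Complex.I))) := by
      have : Pc z 0 (1 + α) (s + θ * Complex.I) = Pc z 0 1 (s + θ * Complex.I) *
          Complex.exp (α * (s + θ * Complex.I)) := by
        unfold Pc
        push_cast
        rw [show (1 + (α : ℂ)) * (s + θ * Complex.I) = 1 * (s + θ * Complex.I) + α * (s + θ * Complex.I) by ring,
          Complex.exp_add (1 * _)]; ring
      rw [this]; unfold Ec; simp only [add_zero]; ring
    rw [e, norm_mul]
    have b1 := norm_Pc_le (z := z) (j := 0) (by norm_num) (p := 1) (s := s) (θ := θ) (by positivity) pi_div_eight_le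
    have b2 := norm_exp_neg_sub_one_add_le (Ec_re_nonneg (s := s) hα0 hα2 (θ := θ) (by positivity) le_rfl)
    rw [norm_exp_mul] at b2
    calc _ ≤ _ := mul_le_mul b1 b2 (norm_nonneg _) (by positivity)
      _ = _ := by
        rw [show (1 + 2 * α) * s = 1 * s + (α * s + α * s) by ring, Real.exp_add (1 * s), Real.exp_add (α * s)]
        ring)
  have i23 : Integrable (fun s : ℝ => Pc z 0 1 (s + θ * Complex.I) - Pc z 0 (1 + α) (s + θ * Complex.I)) :=
    i2.sub i3
  rw [integral_sub i1 i23, integral_sub i2 i3, shift_Pc hz0 (by norm_num) le_rfl,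
    shift_Pc hz0 (by norm_num) (by linarith)] at key
  refine le_trans ?_ key
  refine le_trans (le_of_eq ?_) (Complex.abs_re_le_norm _)
  rw [Complex.sub_re, Complex.sub_re, re_int_Pc_zero_one hz0, re_int_Pc_zero hz0 hα0 hα2]
  congr 1; ring

theorem Kint_one_asymp {α : ℝ} (hα0 : 0 < α) (hα2 : α < 2) {j : ℕ} (hj : j ≤ 1) :
    ∃ C : ℝ, 0 < C ∧ ∀ z : ℝ, 1 ≤ z →
    |Kint α j α z - (∫ s : ℝ, Pc z j (1 + α) (s + (Real.pi / 2 : ℝ) * Complex.I)).re|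
      ≤ C * z ^ (-(1 + 3 * α / 2)) := by
  obtain ⟨C, hC0, hC⟩ := err_bound α hα0
  refine ⟨C, hC0, fun z hz => ?_⟩
  have hz0 : 0 < z := by linarith
  have hpi := Real.pi_pos
  rw [Kint_eq hα0 hα2 hz0.le hj hα0.le, shift_PE hα0 hα2 hz0.le hj (by linarith)]
  set θ : ℝ := Real.pi / 8
  have hθ2 : θ ≤ Real.pi / 2 := by simp only [θ]; linarith
  have i1 := integrable_PE hα0 hα2 hz0.le hj (p := 1 + α) (by linarith) (θ := θ) (by positivity) le_rfl
  have i3 := integrable_Pc hz0 hj (p := 1 + α) (by linarith) (θ := θ) le_rfl hθ2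
  have key := hC z hz (fun s : ℝ => Pc z j (1 + α) (s + θ * Complex.I) * Ec α (s + θ * Complex.I)
      - Pc z j (1 + α) (s + θ * Complex.I)) (fun s => by
    have e : Pc z j (1 + α) (s + θ * Complex.I) * Ec α (s + θ * Complex.I)
      - Pc z j (1 + α) (s + θ * Complex.I) =
      Pc z j (1 + α) (s + θ * Complex.I) * (Complex.exp (-Complex.exp (α * (s + θ * Complex.I))) - 1) := by
      unfold Ec; ring
    rw [e, norm_mul]
    have b1 := norm_Pc_le (z := z) hj (p := 1 + α) (s := s) (θ := θ) (by positivity) pi_div_eight_le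
    have b2 := norm_exp_neg_sub_one_le (Ec_re_nonneg (s := s) hα0 hα2 (θ := θ) (by positivity) le_rfl)
    rw [norm_exp_mul] at b2
    calc _ ≤ _ := mul_le_mul b1 b2 (norm_nonneg _) (by positivity)
      _ = _ := by
        rw [show (1 + 2 * α) * s = (1 + α) * s + α * s by ring, Real.exp_add ((1 + α) * s)]
        ring)
  rw [integral_sub i1 i3, shift_Pc hz0 hj (by linarith)] at key
  refine le_trans ?_ key
  refine le_trans (le_of_eq ?_) (Complex.abs_re_le_norm _)
  rw [Complex.sub_re]

/-! ### Identification of the kernels -/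

theorem stableDensity_eq (α z : ℝ) : stableDensity α z = Real.pi⁻¹ * Kint α 0 0 z := by
  unfold stableDensity Kint
  have : ∀ u : ℝ, Real.cos (z * u) * Real.exp (-(|u| ^ α)) =
      (fun v => Real.cos (z * v) * Wt α 0 0 v) |u| := by
    intro u
    have : Real.cos (z * |u|) = Real.cos (z * u) := by
      rcases abs_choice u with h | h <;> rw [h]; rw [mul_neg, Real.cos_neg]
    simp [Wt, this]
  rw [integral_congr_ae (Filter.Eventually.of_forall this),
    integral_comp_abs (f := fun v => Real.cos (z * v) * Wt α 0 0 v)]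
  rw [mul_inv]; ring

theorem stableDensityDalpha_eq (α z : ℝ) :
    stableDensityDalpha α z = -(Real.pi⁻¹ * Kint α 1 α z) := by
  unfold stableDensityDalpha Kint
  have : ∀ u : ℝ, Real.cos (z * u) * |u| ^ α * Real.log |u| * Real.exp (-(|u| ^ α)) =
      (fun v => Real.cos (z * v) * Wt α 1 α v) |u| := by
    intro u
    have : Real.cos (z * |u|) = Real.cos (z * u) := by
      rcases abs_choice u with h | h <;> rw [h]; rw [mul_neg, Real.cos_neg]
    simp only [Wt, this]; ring
  rw [integral_congr_ae (Filter.Eventually.of_forall this),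
    integral_comp_abs (f := fun v => Real.cos (z * v) * Wt α 1 α v)]
  rw [mul_inv]; ring

theorem hasDerivAt_Kint {α : ℝ} (hα0 : 0 < α) (z : ℝ) :
    HasDerivAt (Kint α 0 0) (∫ u in Ioi (0 : ℝ), -Real.sin (z * u) * Wt α 0 1 u) z := by
  unfold Kint
  refine (hasDerivAt_integral_of_dominated_loc_of_deriv_le (s := univ) (F := fun z u => Real.cos (z * u) * Wt α 0 0 u)
    (F' := fun z u => -Real.sin (z * u) * Wt α 0 1 u)
    (bound := fun u => |Wt α 0 1 u|) univ_mem ?_ ?_ ?_ ?_ ?_ ?_).2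
  · exact Filter.Eventually.of_forall fun z => (integrableOn_cos_Wt hα0 (by norm_num) le_rfl z).aestronglyMeasurable
  · exact integrableOn_cos_Wt hα0 (by norm_num) le_rfl z
  · have := measurable_Wt α 0 1
    exact Measurable.aestronglyMeasurable (by fun_prop)
  · refine Filter.Eventually.of_forall fun u z _ => ?_
    rw [norm_mul, Real.norm_eq_abs, Real.norm_eq_abs, abs_neg]
    exact mul_le_of_le_one_left (abs_nonneg _) (Real.abs_sin_le_one _)
  · exact (integrableOn_Wt hα0 (by norm_num) zero_le_one).abs
  · filter_upwards with u z _
    have h1 : HasDerivAt (fun z : ℝ => z * u) u z := hasDerivAt_mul_const u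
    have h2 := h1.cos.mul_const (Wt α 0 0 u)
    refine h2.congr_deriv ?_
    simp [Wt]; ring

theorem Kint_ibp {α : ℝ} (hα0 : 0 < α) (z : ℝ) :
    Kint α 0 0 z + z * (∫ u in Ioi (0 : ℝ), -Real.sin (z * u) * Wt α 0 1 u) = α * Kint α 0 α z := by
  have i1 := integrableOn_cos_Wt hα0 (j := 0) (by norm_num) le_rfl z
  have i2 : IntegrableOn (fun u => -Real.sin (z * u) * Wt α 0 1 u) (Ioi (0 : ℝ)) := by
    refine (integrableOn_Wt hα0 (by norm_num) zero_le_one).bdd_mul (c := 1) (by fun_prop) ?_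
    exact Filter.Eventually.of_forall fun u => by simpa using Real.abs_sin_le_one _
  have i3 := integrableOn_cos_Wt hα0 (j := 0) (by norm_num) hα0.le z
  have key := integral_Ioi_of_hasDerivAt_of_tendsto (a := (0 : ℝ)) (m := 0)
    (f := fun u => u * (Real.cos (z * u) * Real.exp (-(u ^ α))))
    (f' := fun u => (Real.cos (z * u) * Wt α 0 0 u + z * (-Real.sin (z * u) * Wt α 0 1 u)) -
      α * (Real.cos (z * u) * Wt α 0 α u)) ?_ ?_ ?_ ?_
  · have i12 : IntegrableOn (fun u => Real.cos (z * u) * Wt α 0 0 u + z * (-Real.sin (z * u) * Wt α 0 1 u)) (Ioi (0 : ℝ)) :=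
      i1.add (i2.const_mul z)
    rw [integral_sub i12 (i3.const_mul α), integral_add i1 (i2.const_mul z),
      integral_const_mul, integral_const_mul] at key
    simp only [zero_mul, sub_zero] at key
    unfold Kint
    linarith
  · have : Continuous fun u : ℝ => u * (Real.cos (z * u) * Real.exp (-(u ^ α))) := by
      have : Continuous fun u : ℝ => u ^ α := Real.continuous_rpow_const hα0.le
      fun_prop
    exact this.continuousWithinAt
  · intro u hu
    have hu0 : (0 : ℝ) < u := hu
    have h1 : HasDerivAt (fun u : ℝ => z * u) z u := hasDerivAt_const_mul z
    have h2 : HasDerivAt (fun u : ℝ => -(u ^ α)) (-(α * u ^ (α - 1))) u :=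
      (Real.hasDerivAt_rpow_const (Or.inl hu0.ne')).neg
    have h3 := (hasDerivAt_id u).mul (h1.cos.mul h2.exp)
    refine h3.congr_deriv ?_
    have : u ^ α = u * u ^ (α - 1) := by
      rw [Real.rpow_sub_one hu0.ne']; field_simp
    simp only [Wt, pow_zero, Real.rpow_zero, Real.rpow_one, id, Pi.mul_apply]
    rw [this]; ring
  · exact (i1.add (i2.const_mul z)).sub (i3.const_mul α)
  · have h1 := (tendsto_rpow_mul_exp_neg_mul_atTop_nhds_zero (1 / α) 1 one_pos).comp (tendsto_rpow_atTop hα0)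
    refine squeeze_zero_norm' ?_ h1
    filter_upwards [Filter.eventually_gt_atTop 0] with u hu
    simp only [Function.comp]
    rw [← Real.rpow_mul hu.le, mul_one_div_cancel hα0.ne', Real.rpow_one, neg_mul, one_mul, norm_mul, norm_mul,
      Real.norm_of_nonneg hu.le, Real.norm_of_nonneg (Real.exp_pos _).le]
    have := Real.abs_cos_le_one (z * u)
    gcongr
    exact mul_le_of_le_one_left (Real.exp_pos _).le this

theorem Dop_stable_eq {α : ℝ} (hα0 : 0 < α) (z : ℝ) :
    Dop (stableDensity α) z = Real.pi⁻¹ * (α * Kint α 0 α z) := by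
  have h : HasDerivAt (stableDensity α) (Real.pi⁻¹ * ∫ u in Ioi (0 : ℝ), -Real.sin (z * u) * Wt α 0 1 u) z := by
    have := (hasDerivAt_Kint hα0 z).const_mul Real.pi⁻¹
    refine this.congr_of_eventuallyEq ?_
    exact Filter.Eventually.of_forall fun z => stableDensity_eq α z
  unfold Dop
  rw [h.deriv, stableDensity_eq, ← Kint_ibp hα0]; ring

/-! ### Kernel asymptotics, bounds and masses -/

theorem rpow_abs_pos {z : ℝ} (hz : 1 ≤ |z|) (r : ℝ) : 0 < |z| ^ r :=
  Real.rpow_pos_of_pos (by linarith) r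

theorem stable_asymp {α : ℝ} (hα0 : 0 < α) (hα2 : α < 2) : ∃ C : ℝ, 0 < C ∧ ∀ z : ℝ, 1 ≤ |z| →
    |stableDensity α z - cAlpha α * |z| ^ (-(1 + α))| ≤ C * |z| ^ (-(1 + 3 * α / 2)) := by
  obtain ⟨C, hC0, hC⟩ := Kint_zero_asymp hα0 hα2
  have hpi := Real.pi_pos
  refine ⟨Real.pi⁻¹ * C, by positivity, fun z hz => ?_⟩
  have h := hC |z| hz
  rw [Kint_abs] at h
  rw [stableDensity_eq, mul_assoc]
  have e : Real.pi⁻¹ * Kint α 0 0 z - cAlpha α * |z| ^ (-(1 + α)) =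
      Real.pi⁻¹ * (Kint α 0 0 z - Real.pi * cAlpha α * |z| ^ (-(1 + α))) := by field_simp
  rw [e, abs_mul, abs_of_pos (inv_pos.mpr hpi)]
  gcongr

theorem Dstable_asymp {α : ℝ} (hα0 : 0 < α) (hα2 : α < 2) : ∃ C : ℝ, 0 < C ∧ ∀ z : ℝ, 1 ≤ |z| →
    |Dop (stableDensity α) z - (-(α * cAlpha α)) * |z| ^ (-(1 + α))| ≤ C * |z| ^ (-(1 + 3 * α / 2)) := by
  obtain ⟨C, hC0, hC⟩ := Kint_one_asymp hα0 hα2 (j := 0) (by norm_num)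
  have hpi := Real.pi_pos
  refine ⟨Real.pi⁻¹ * α * C, by positivity, fun z hz => ?_⟩
  have h := hC |z| hz
  rw [Kint_abs, re_int_Pc_zero (by linarith) hα0 hα2] at h
  rw [Dop_stable_eq hα0]
  have e : Real.pi⁻¹ * (α * Kint α 0 α z) - -(α * cAlpha α) * |z| ^ (-(1 + α)) =
      Real.pi⁻¹ * α * (Kint α 0 α z - -(Real.pi * cAlpha α * |z| ^ (-(1 + α)))) := by
    field_simp
  rw [e, abs_mul, abs_of_pos (by positivity : 0 < Real.pi⁻¹ * α), mul_assoc (Real.pi⁻¹ * α)]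
  exact mul_le_mul_of_nonneg_left h (by positivity)

theorem dalpha_asymp {α : ℝ} (hα0 : 0 < α) (hα2 : α < 2) : ∃ C : ℝ, 0 < C ∧ ∀ z : ℝ, 1 ≤ |z| →
    |stableDensityDalpha α z - (deriv cAlpha α - cAlpha α * Real.log |z|) * |z| ^ (-(1 + α))|
      ≤ C * |z| ^ (-(1 + 3 * α / 2)) := by
  obtain ⟨C, hC0, hC⟩ := Kint_one_asymp hα0 hα2 (j := 1) (by norm_num)
  have hpi := Real.pi_pos
  refine ⟨Real.pi⁻¹ * C, by positivity, fun z hz => ?_⟩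
  have h := hC |z| hz
  rw [Kint_abs, re_int_Pc_one (by linarith) hα0 hα2] at h
  rw [stableDensityDalpha_eq, mul_assoc]
  have e : -(Real.pi⁻¹ * Kint α 1 α z) - (deriv cAlpha α - cAlpha α * Real.log |z|) * |z| ^ (-(1 + α)) =
      -(Real.pi⁻¹ * (Kint α 1 α z - -(Real.pi * (deriv cAlpha α - cAlpha α * Real.log |z|) * |z| ^ (-(1 + α))))) := by
    field_simp; ring
  rw [e, abs_neg, abs_mul, abs_of_pos (inv_pos.mpr hpi)]
  gcongr

/-- Polynomial decay bound. -/
def KB (β : ℝ) (K : ℝ → ℝ) : Prop := ∃ C : ℝ, 0 < C ∧ ∀ z : ℝ, |K z| ≤ C * (1 + |z|) ^ (-(1 + β))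

theorem KB_of {β : ℝ} (hβ : 0 < β) {K : ℝ → ℝ} {C1 C2 : ℝ} (h1 : ∀ z, |K z| ≤ C1)
    (h2 : ∀ z, 1 ≤ |z| → |K z| ≤ C2 * |z| ^ (-(1 + β))) : KB β K := by
  have hC1 : 0 ≤ C1 := (abs_nonneg _).trans (h1 0)
  have hC2 : 0 ≤ C2 := by
    have := (abs_nonneg _).trans (h2 1 (by simp)); simpa using this
  refine ⟨(C1 + C2 + 1) * 2 ^ (1 + β), by positivity, fun z => ?_⟩
  have hp : (0:ℝ) < 1 + |z| := by positivity
  rcases le_total |z| 1 with h | h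
  · have e : (1:ℝ) ≤ 2 ^ (1 + β) * (1 + |z|) ^ (-(1 + β)) := by
      rw [Real.rpow_neg hp.le, ← div_eq_mul_inv, le_div_iff₀ (by positivity), one_mul]
      exact Real.rpow_le_rpow hp.le (by linarith) (by linarith)
    calc |K z| ≤ C1 := h1 z
      _ ≤ (C1 + C2 + 1) * 1 := by linarith
      _ ≤ (C1 + C2 + 1) * (2 ^ (1 + β) * (1 + |z|) ^ (-(1 + β))) := by gcongr
      _ = _ := by ring
  · have hz : 0 < |z| := by linarith
    have e : |z| ^ (-(1 + β)) ≤ 2 ^ (1 + β) * (1 + |z|) ^ (-(1 + β)) := by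
      have : (2 * |z|) ^ (-(1 + β)) ≤ (1 + |z|) ^ (-(1 + β)) :=
        Real.rpow_le_rpow_of_nonpos hp (by linarith) (by linarith)
      calc |z| ^ (-(1 + β)) = 2 ^ (1 + β) * (2 * |z|) ^ (-(1 + β)) := by
            rw [Real.mul_rpow (by norm_num) hz.le, ← mul_assoc, ← Real.rpow_add (by norm_num)]
            simp
        _ ≤ _ := by gcongr
    calc |K z| ≤ C2 * |z| ^ (-(1 + β)) := h2 z h
      _ ≤ (C1 + C2 + 1) * (2 ^ (1 + β) * (1 + |z|) ^ (-(1 + β))) := by gcongr; linarith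
      _ = _ := by ring

theorem KB.integrable {β : ℝ} (hβ : 0 < β) {K : ℝ → ℝ} (h : KB β K) (hc : Continuous K) : Integrable K := by
  obtain ⟨C, -, hC⟩ := h
  have := (integrable_one_add_norm (E := ℝ) (μ := volume) (r := 1 + β) (by simp; linarith)).const_mul C
  exact this.mono' hc.aestronglyMeasurable (Filter.Eventually.of_forall fun z => by simpa using hC z)

/-- From the asymptotics to the decay bound. -/
theorem KB_of_asymp {α β : ℝ} (hβ : 0 < β) (hβα : β < α) {K : ℝ → ℝ} {C1 C a b : ℝ}
    (hC : 0 ≤ C) (h1 : ∀ z, |K z| ≤ C1)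
    (h2 : ∀ z, 1 ≤ |z| → |K z - (a - b * Real.log |z|) * |z| ^ (-(1 + α))| ≤ C * |z| ^ (-(1 + 3 * α / 2))) :
    KB β K := by
  refine KB_of hβ (C2 := C + |a| + |b| / (α - β)) h1 fun z hz => ?_
  have hz0 : 0 < |z| := by linarith
  have b1 : |z| ^ (-(1 + 3 * α / 2)) ≤ |z| ^ (-(1 + β)) :=
    Real.rpow_le_rpow_of_exponent_le hz (by linarith)
  have b2 : |z| ^ (-(1 + α)) ≤ |z| ^ (-(1 + β)) :=
    Real.rpow_le_rpow_of_exponent_le hz (by linarith)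
  have b3 : Real.log |z| * |z| ^ (-(1 + α)) ≤ |z| ^ (-(1 + β)) / (α - β) := by
    have := Real.log_le_rpow_div hz0.le (show 0 < α - β by linarith)
    calc _ ≤ |z| ^ (α - β) / (α - β) * |z| ^ (-(1 + α)) := by gcongr
      _ = |z| ^ (α - β) * |z| ^ (-(1 + α)) / (α - β) := by ring
      _ = _ := by rw [← Real.rpow_add hz0]; congr 2; ring
  have hl : 0 ≤ Real.log |z| := Real.log_nonneg hz
  have hp := rpow_abs_pos hz (-(1 + α))
  have h3 : |(a - b * Real.log |z|) * |z| ^ (-(1 + α))| ≤ |a| * |z| ^ (-(1 + β)) + |b| * (|z| ^ (-(1 + β)) / (α - β)) := by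
    rw [abs_mul, abs_of_pos hp]
    calc _ ≤ (|a| + |b| * Real.log |z|) * |z| ^ (-(1 + α)) := by
          gcongr
          refine (abs_sub _ _).trans ?_
          rw [abs_mul, abs_of_nonneg hl]
      _ = |a| * |z| ^ (-(1 + α)) + |b| * (Real.log |z| * |z| ^ (-(1 + α))) := by ring
      _ ≤ _ := by gcongr
  have h4 := abs_sub_abs_le_abs_sub (K z) ((a - b * Real.log |z|) * |z| ^ (-(1 + α)))
  have h5 := h2 z hz
  have h6 : C * |z| ^ (-(1 + 3 * α / 2)) ≤ C * |z| ^ (-(1 + β)) := by gcongr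
  have h7 : |b| * (|z| ^ (-(1 + β)) / (α - β)) = |b| / (α - β) * |z| ^ (-(1 + β)) := by ring
  nlinarith

theorem continuous_stable {α : ℝ} (hα0 : 0 < α) : Continuous (stableDensity α) := by
  rw [show stableDensity α = fun z => Real.pi⁻¹ * Kint α 0 0 z from funext (stableDensity_eq α)]
  exact continuous_const.mul (continuous_Kint hα0 (by norm_num) le_rfl)

theorem continuous_Dstable {α : ℝ} (hα0 : 0 < α) : Continuous (Dop (stableDensity α)) := by
  rw [show Dop (stableDensity α) = fun z => Real.pi⁻¹ * (α * Kint α 0 α z) from funext (Dop_stable_eq hα0)]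
  exact continuous_const.mul (continuous_const.mul (continuous_Kint hα0 (by norm_num) hα0.le))

theorem continuous_dalpha {α : ℝ} (hα0 : 0 < α) : Continuous (stableDensityDalpha α) := by
  rw [show stableDensityDalpha α = fun z => -(Real.pi⁻¹ * Kint α 1 α z) from funext (stableDensityDalpha_eq α)]
  exact (continuous_const.mul (continuous_Kint hα0 le_rfl hα0.le)).neg

theorem stable_neg (α z : ℝ) : stableDensity α (-z) = stableDensity α z := by
  simp only [stableDensity_eq, Kint_neg]

theorem Dstable_neg {α : ℝ} (hα0 : 0 < α) (z : ℝ) : Dop (stableDensity α) (-z) = Dop (stableDensity α) z := by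
  simp only [Dop_stable_eq hα0, Kint_neg]

theorem dalpha_neg (α z : ℝ) : stableDensityDalpha α (-z) = stableDensityDalpha α z := by
  simp only [stableDensityDalpha_eq, Kint_neg]

theorem KB_stable {α β : ℝ} (hα0 : 0 < α) (hα2 : α < 2) (hβ : 0 < β) (hβα : β < α) :
    KB β (stableDensity α) := by
  obtain ⟨C, hC0, hC⟩ := stable_asymp hα0 hα2
  refine KB_of_asymp hβ hβα (a := cAlpha α) (b := 0) hC0.le (C1 := Real.pi⁻¹ * ∫ u in Ioi (0 : ℝ), |Wt α 0 0 u|) (fun z => ?_) (fun z hz => ?_)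
  · rw [stableDensity_eq, abs_mul, abs_of_pos (inv_pos.mpr Real.pi_pos)]
    exact mul_le_mul_of_nonneg_left (abs_Kint_le hα0 (by norm_num) le_rfl z) (inv_pos.mpr Real.pi_pos).le
  · simpa using hC z hz

theorem KB_Dstable {α β : ℝ} (hα0 : 0 < α) (hα2 : α < 2) (hβ : 0 < β) (hβα : β < α) :
    KB β (Dop (stableDensity α)) := by
  obtain ⟨C, hC0, hC⟩ := Dstable_asymp hα0 hα2
  refine KB_of_asymp hβ hβα (a := -(α * cAlpha α)) (b := 0) hC0.le (C1 := Real.pi⁻¹ * (α * ∫ u in Ioi (0 : ℝ), |Wt α 0 α u|)) (fun z => ?_) (fun z hz => ?_)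
  · rw [Dop_stable_eq hα0, abs_mul, abs_mul, abs_of_pos (inv_pos.mpr Real.pi_pos), abs_of_pos hα0]
    exact mul_le_mul_of_nonneg_left (mul_le_mul_of_nonneg_left (abs_Kint_le hα0 (by norm_num) hα0.le z) hα0.le)
      (inv_pos.mpr Real.pi_pos).le
  · simpa using hC z hz

theorem KB_dalpha {α β : ℝ} (hα0 : 0 < α) (hα2 : α < 2) (hβ : 0 < β) (hβα : β < α) :
    KB β (stableDensityDalpha α) := by
  obtain ⟨C, hC0, hC⟩ := dalpha_asymp hα0 hα2
  refine KB_of_asymp hβ hβα (a := deriv cAlpha α) (b := cAlpha α) hC0.le (C1 := Real.pi⁻¹ * ∫ u in Ioi (0 : ℝ), |Wt α 1 α u|) (fun z => ?_) hC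
  rw [stableDensityDalpha_eq, abs_neg, abs_mul, abs_of_pos (inv_pos.mpr Real.pi_pos)]
  exact mul_le_mul_of_nonneg_left (abs_Kint_le hα0 le_rfl hα0.le z) (inv_pos.mpr Real.pi_pos).le

/-! Masses. -/

theorem integrable_comp_abs' {f : ℝ → ℝ} (hf : IntegrableOn f (Ioi 0)) : Integrable (fun x => f |x|) :=
  by
  have hf' : IntegrableOn (fun x => f |x|) (Ioi 0) :=
    hf.congr_fun (fun x hx => by rw [abs_of_pos hx]) measurableSet_Ioi
  have int_Iic : IntegrableOn (fun x ↦ f |x|) (Iic 0) := by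
    rw [← Measure.map_neg_eq_self (volume : Measure ℝ)]
    let m : MeasurableEmbedding fun x : ℝ => -x := (Homeomorph.neg ℝ).measurableEmbedding
    rw [m.integrableOn_map_iff]
    simp_rw [Function.comp_def, abs_neg, neg_preimage, neg_Iic, neg_zero]
    exact Iff.mpr integrableOn_Ici_iff_integrableOn_Ioi hf'
  rw [← integrableOn_univ, ← Iic_union_Ioi (a := (0 : ℝ))]
  exact int_Iic.union hf'

theorem Kint_mass {α : ℝ} (hα0 : 0 < α) {j : ℕ} (hj : j ≤ 1) {p : ℝ} (hp : 0 ≤ p)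
    (hK : Integrable (Kint α j p)) (hc : ContinuousAt (fun u : ℝ => Wt α j p |u|) 0) :
    Real.pi⁻¹ * ∫ z, Kint α j p z = Wt α j p 0 := by
  set f : ℝ → ℂ := fun u => (Wt α j p |u| : ℂ) with hf
  have hWi : Integrable (fun u : ℝ => Wt α j p |u|) := integrable_comp_abs' (integrableOn_Wt hα0 hj hp)
  have hfi : Integrable f := hWi.ofReal
  have hF : ∀ ξ : ℝ, FourierTransform.fourier f ξ = ((2 * Kint α j p (2 * Real.pi * ξ) : ℝ) : ℂ) := by
    intro ξ
    rw [Real.fourier_real_eq_integral_exp_smul]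
    have i1 : Integrable (fun v : ℝ => Real.cos (2 * Real.pi * ξ * v) * Wt α j p |v|) :=
      hWi.bdd_mul (c := 1) (by fun_prop) (Filter.Eventually.of_forall fun u => by simpa using Real.abs_cos_le_one _)
    have i2 : Integrable (fun v : ℝ => Real.sin (2 * Real.pi * ξ * v) * Wt α j p |v|) :=
      hWi.bdd_mul (c := 1) (by fun_prop) (Filter.Eventually.of_forall fun u => by simpa using Real.abs_sin_le_one _)
    have e : ∀ v : ℝ, Complex.exp (((-2 * Real.pi * v * ξ : ℝ) : ℂ) * Complex.I) • f v =
        ((Real.cos (2 * Real.pi * ξ * v) * Wt α j p |v| : ℝ) : ℂ) -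
          Complex.I * ((Real.sin (2 * Real.pi * ξ * v) * Wt α j p |v| : ℝ) : ℂ) := by
      intro v
      rw [show -2 * Real.pi * v * ξ = -(2 * Real.pi * ξ * v) by ring, Complex.exp_mul_I, ← Complex.ofReal_cos,
        ← Complex.ofReal_sin, Real.cos_neg, Real.sin_neg, hf, smul_eq_mul]
      push_cast; ring
    rw [integral_congr_ae (Filter.Eventually.of_forall e), integral_sub i1.ofReal (i2.ofReal.const_mul _),
      integral_const_mul, integral_complex_ofReal, integral_complex_ofReal]
    have e2 : ∫ v : ℝ, Real.sin (2 * Real.pi * ξ * v) * Wt α j p |v| = 0 := by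
      have := integral_neg_eq_self (fun v : ℝ => Real.sin (2 * Real.pi * ξ * v) * Wt α j p |v|) volume
      simp only [abs_neg, mul_neg, Real.sin_neg, neg_mul, integral_neg] at this
      linarith
    have e1 : ∫ v : ℝ, Real.cos (2 * Real.pi * ξ * v) * Wt α j p |v| = 2 * Kint α j p (2 * Real.pi * ξ) := by
      unfold Kint
      rw [← integral_comp_abs (f := fun u => Real.cos (2 * Real.pi * ξ * u) * Wt α j p u)]
      congr 1; ext v
      rcases abs_choice v with h | h <;> rw [h]
      rw [mul_neg, Real.cos_neg]
    rw [e1, e2]; simp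
  have hFi : Integrable (FourierTransform.fourier f) := by
    rw [show FourierTransform.fourier f = fun ξ : ℝ => ((2 * Kint α j p (2 * Real.pi * ξ) : ℝ) : ℂ) from funext hF]
    exact ((hK.comp_mul_left' (by positivity)).const_mul 2).ofReal
  have hinv := hfi.fourierInv_fourier_eq hFi (v := 0) (Complex.continuous_ofReal.continuousAt.comp hc)
  rw [Real.fourierInv_eq'] at hinv
  simp only [inner_zero_right, mul_zero, Complex.ofReal_zero, zero_mul, Complex.exp_zero, one_smul] at hinv
  rw [integral_congr_ae (Filter.Eventually.of_forall hF), integral_complex_ofReal, hf] at hinv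
  have h := Complex.ofReal_injective hinv
  rw [integral_const_mul, Measure.integral_comp_mul_left, abs_zero] at h
  rw [← h, smul_eq_mul, abs_of_pos (by positivity), mul_inv]
  ring

theorem integral_stable {α : ℝ} (hα0 : 0 < α) (hα2 : α < 2) : ∫ z, stableDensity α z = 1 := by
  have hi := (KB_stable hα0 hα2 (β := α / 2) (by linarith) (by linarith)).integrable (by linarith) (continuous_stable hα0)
  have e : stableDensity α = fun z => Real.pi⁻¹ * Kint α 0 0 z := funext (stableDensity_eq α)
  have hK : Integrable (Kint α 0 0) := by
    rw [e] at hi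
    exact (integrable_const_mul_iff (IsUnit.mk0 _ (inv_ne_zero Real.pi_ne_zero)) _).mp hi
  rw [e, integral_const_mul, Kint_mass hα0 (by norm_num) le_rfl hK]
  · simp [Wt, Real.zero_rpow hα0.ne']
  · have h1 : Continuous fun u : ℝ => |u| ^ α := (Real.continuous_rpow_const hα0.le).comp continuous_abs
    have : Continuous fun u : ℝ => Wt α 0 0 |u| := by
      simp only [Wt, pow_zero, Real.rpow_zero, one_mul]; fun_prop
    exact this.continuousAt

theorem integral_Dstable {α : ℝ} (hα0 : 0 < α) (hα2 : α < 2) : ∫ z, Dop (stableDensity α) z = 0 := by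
  have hi := (KB_Dstable hα0 hα2 (β := α / 2) (by linarith) (by linarith)).integrable (by linarith) (continuous_Dstable hα0)
  have e : Dop (stableDensity α) = fun z => Real.pi⁻¹ * α * Kint α 0 α z :=
    funext fun z => by rw [Dop_stable_eq hα0, mul_assoc]
  have hK : Integrable (Kint α 0 α) := by
    rw [e] at hi
    exact (integrable_const_mul_iff (IsUnit.mk0 _ (mul_ne_zero (inv_ne_zero Real.pi_ne_zero) hα0.ne')) _).mp hi
  rw [e, integral_const_mul]
  have := Kint_mass hα0 (by norm_num) hα0.le hK ?_
  · rw [mul_comm _ α, mul_assoc, this]; simp [Wt, Real.zero_rpow hα0.ne']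
  · have h1 : Continuous fun u : ℝ => |u| ^ α := (Real.continuous_rpow_const hα0.le).comp continuous_abs
    have : Continuous fun u : ℝ => Wt α 0 α |u| := by
      simp only [Wt, pow_zero, one_mul]; fun_prop
    exact this.continuousAt

theorem integral_dalpha {α : ℝ} (hα0 : 0 < α) (hα2 : α < 2) : ∫ z, stableDensityDalpha α z = 0 := by
  have hi := (KB_dalpha hα0 hα2 (β := α / 2) (by linarith) (by linarith)).integrable (by linarith) (continuous_dalpha hα0)
  have e : stableDensityDalpha α = fun z => -Real.pi⁻¹ * Kint α 1 α z :=
    funext fun z => by rw [stableDensityDalpha_eq, neg_mul]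
  have hK : Integrable (Kint α 1 α) := by
    rw [e] at hi
    exact (integrable_const_mul_iff (IsUnit.mk0 _ (neg_ne_zero.mpr (inv_ne_zero Real.pi_ne_zero))) _).mp hi
  rw [e, integral_const_mul]
  have := Kint_mass hα0 le_rfl hα0.le hK ?_
  · rw [neg_mul, this]; simp [Wt, Real.zero_rpow hα0.ne']
  · have hr : Continuous fun u : ℝ => |u| ^ (α / 2) := (Real.continuous_rpow_const (by linarith)).comp continuous_abs
    unfold ContinuousAt
    have h0 : Wt α 1 α |0| = 0 := by simp [Wt]
    show Tendsto (fun u : ℝ => Wt α 1 α |u|) (𝓝 0) (𝓝 (Wt α 1 α |0|))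
    rw [h0]
    have hlim : Tendsto (fun u : ℝ => 2 / α * |u| ^ (α / 2)) (𝓝 0) (𝓝 0) := by
      have := (hr.tendsto 0).const_mul (2 / α)
      simpa [Real.zero_rpow (show α / 2 ≠ 0 by positivity)] using this
    refine squeeze_zero_norm' ?_ hlim
    have : Ioo (-1 : ℝ) 1 ∈ 𝓝 (0 : ℝ) := Ioo_mem_nhds (by norm_num) (by norm_num)
    filter_upwards [this] with u hu
    rcases eq_or_ne u 0 with rfl | hu0
    · rw [h0]; simp only [norm_zero]; positivity
    have hu1 : |u| ≤ 1 := (abs_lt.mpr hu).le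
    have hup : 0 < |u| := abs_pos.mpr hu0
    have b := (Real.abs_log_mul_self_rpow_lt |u| (α / 2) hup hu1 (by positivity)).le
    unfold Wt
    have hee : Real.exp (-(|u| ^ α)) ≤ 1 := Real.exp_le_one_iff.mpr (by simp; positivity)
    have e2 : |u| ^ α = |u| ^ (α / 2) * |u| ^ (α / 2) := by rw [← Real.rpow_add hup]; congr 1; ring
    rw [norm_mul, Real.norm_of_nonneg (Real.exp_pos _).le, pow_one, Real.norm_eq_abs]
    calc |Real.log |u| * |u| ^ α| * Real.exp (-(|u| ^ α)) ≤ |Real.log |u| * |u| ^ α| * 1 := by gcongr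
      _ = |Real.log |u| * |u| ^ (α / 2)| * |u| ^ (α / 2) := by
        rw [mul_one, e2, ← mul_assoc, abs_mul _ (|u| ^ (α / 2)), abs_of_pos (Real.rpow_pos_of_pos hup (α / 2))]
      _ ≤ 1 / (α / 2) * |u| ^ (α / 2) := by gcongr
      _ = _ := by field_simp

/-! ### Nonnegativity of the stable density -/

/-- A class of functions with nonnegative regularized cosine transform. -/
structure PD (F : ℝ → ℝ) : Prop where
  cont : Continuous F
  bdd : ∀ u, |F u| ≤ 1
  nonneg : ∀ s : ℝ, 0 < s → ∀ z : ℝ, 0 ≤ ∫ u : ℝ, F u * Real.exp (-s * u ^ 2) * Real.cos (z * u)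

theorem PD_integrable {F : ℝ → ℝ} (hc : Continuous F) (hb : ∀ u, |F u| ≤ 1) {s : ℝ} (hs : 0 < s) (z : ℝ) :
    Integrable (fun u : ℝ => F u * Real.exp (-s * u ^ 2) * Real.cos (z * u)) := by
  refine (integrable_exp_neg_mul_sq hs).mono' (by fun_prop) (Filter.Eventually.of_forall fun u => ?_)
  rw [norm_mul, norm_mul, Real.norm_eq_abs, Real.norm_eq_abs, Real.norm_eq_abs, abs_of_pos (Real.exp_pos _)]
  have h1 := hb u
  have h2 := Real.abs_cos_le_one (z * u)
  calc _ ≤ 1 * Real.exp (-s * u ^ 2) * 1 := by gcongr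
    _ = _ := by ring

theorem PD_one : PD (fun _ => 1) := by
  refine ⟨by fun_prop, by simp, fun s hs z => ?_⟩
  have h := fourierIntegral_gaussian (b := (s : ℂ)) (by simpa using hs) (z : ℂ)
  have e : ∀ u : ℝ, 1 * Real.exp (-s * u ^ 2) * Real.cos (z * u) =
      (Complex.exp (Complex.I * z * u) * Complex.exp (-s * u ^ 2)).re := by
    intro u
    rw [show Complex.I * z * u = ((z * u : ℝ) : ℂ) * Complex.I by push_cast; ring,
      show -(s : ℂ) * u ^ 2 = ((-s * u ^ 2 : ℝ) : ℂ) by push_cast; ring, ← Complex.ofReal_exp,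
      Complex.re_mul_ofReal, Complex.exp_ofReal_mul_I_re]; ring
  have hi : Integrable (fun u : ℝ => Complex.exp (Complex.I * z * u) * Complex.exp (-s * u ^ 2)) := by
    refine (integrable_exp_neg_mul_sq hs).mono' (by fun_prop) (Filter.Eventually.of_forall fun u => ?_)
    rw [show Complex.I * z * u = ((z * u : ℝ) : ℂ) * Complex.I by push_cast; ring,
      show -(s : ℂ) * u ^ 2 = ((-s * u ^ 2 : ℝ) : ℂ) by push_cast; ring, norm_mul, Complex.norm_exp_ofReal_mul_I,
      ← Complex.ofReal_exp, Complex.norm_real, one_mul, Real.norm_of_nonneg (Real.exp_pos _).le]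
  have := integral_re hi
  simp only [RCLike.re_to_complex] at this
  simp only [e]
  rw [this, h]
  have e2 : ((Real.pi : ℂ) / s) ^ (1 / 2 : ℂ) * Complex.exp (-(z : ℂ) ^ 2 / (4 * s)) =
      (((Real.pi / s) ^ (1 / 2 : ℝ) * Real.exp (-z ^ 2 / (4 * s)) : ℝ) : ℂ) := by
    push_cast [Complex.ofReal_cpow (show 0 ≤ Real.pi / s by positivity)]
    norm_num
  rw [e2, Complex.ofReal_re]
  positivity

theorem PD.cos_mul {F : ℝ → ℝ} (h : PD F) (x : ℝ) {s : ℝ} (hs : 0 < s) (z : ℝ) :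
    0 ≤ ∫ u : ℝ, (F u * Real.exp (-s * u ^ 2) * Real.cos (z * u)) * Real.cos (x * u) := by
  have e : ∀ u : ℝ, (F u * Real.exp (-s * u ^ 2) * Real.cos (z * u)) * Real.cos (x * u) =
      (1 / 2) * (F u * Real.exp (-s * u ^ 2) * Real.cos ((z + x) * u)) +
      (1 / 2) * (F u * Real.exp (-s * u ^ 2) * Real.cos ((z - x) * u)) := by
    intro u; rw [add_mul, sub_mul, Real.cos_add, Real.cos_sub]; ring
  simp only [e]
  rw [integral_add ((PD_integrable h.cont h.bdd hs _).const_mul _) ((PD_integrable h.cont h.bdd hs _).const_mul _),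
    integral_const_mul, integral_const_mul]
  have h1 := h.nonneg s hs (z + x)
  have h2 := h.nonneg s hs (z - x)
  positivity

/-- Pareto characteristic function. -/
def chiP (α u : ℝ) : ℝ := ∫ x in Ioi (1 : ℝ), Real.cos (x * u) * (α * x ^ (-(1 + α)))

theorem integrableOn_pareto {α : ℝ} (hα0 : 0 < α) : IntegrableOn (fun x : ℝ => α * x ^ (-(1 + α))) (Ioi 1) :=
  (integrableOn_Ioi_rpow_of_lt (by linarith) one_pos).const_mul α

theorem integral_pareto {α : ℝ} (hα0 : 0 < α) : ∫ x in Ioi (1 : ℝ), α * x ^ (-(1 + α)) = 1 := by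
  rw [integral_const_mul, integral_Ioi_rpow_of_lt (by linarith) one_pos]
  simp
  field_simp

theorem integrableOn_cos_pareto {α : ℝ} (hα0 : 0 < α) (u : ℝ) :
    IntegrableOn (fun x : ℝ => Real.cos (x * u) * (α * x ^ (-(1 + α)))) (Ioi 1) :=
  (integrableOn_pareto hα0).bdd_mul (c := 1) (by fun_prop)
    (Filter.Eventually.of_forall fun u => by simpa using Real.abs_cos_le_one _)

theorem pareto_nonneg {α : ℝ} (hα0 : 0 < α) : ∀ᵐ x ∂(volume.restrict (Ioi (1:ℝ))), 0 ≤ α * x ^ (-(1 + α)) := by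
  filter_upwards [ae_restrict_mem measurableSet_Ioi] with x hx
  have : (0:ℝ) < x := lt_trans one_pos hx
  positivity

theorem abs_chiP_le {α : ℝ} (hα0 : 0 < α) (u : ℝ) : |chiP α u| ≤ 1 := by
  unfold chiP
  have h := norm_integral_le_of_norm_le (μ := volume.restrict (Ioi (1:ℝ)))
    (f := fun x => Real.cos (x * u) * (α * x ^ (-(1 + α)))) (integrableOn_pareto hα0) ?_
  · rw [integral_pareto hα0, Real.norm_eq_abs] at h
    exact h
  filter_upwards [pareto_nonneg hα0] with x hx
  rw [norm_mul, Real.norm_of_nonneg hx, Real.norm_eq_abs]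
  exact mul_le_of_le_one_left hx (Real.abs_cos_le_one _)

theorem continuous_chiP {α : ℝ} (hα0 : 0 < α) : Continuous (chiP α) := by
  unfold chiP
  refine continuous_of_dominated (bound := fun x => α * x ^ (-(1 + α))) ?_ ?_ (integrableOn_pareto hα0) ?_
  · exact fun u => (integrableOn_cos_pareto hα0 u).aestronglyMeasurable
  · intro u
    filter_upwards [pareto_nonneg hα0] with x hx
    rw [norm_mul, Real.norm_of_nonneg hx, Real.norm_eq_abs]
    exact mul_le_of_le_one_left hx (Real.abs_cos_le_one _)
  · exact Filter.Eventually.of_forall fun u => by fun_prop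

theorem PD.chi_mul {F : ℝ → ℝ} (h : PD F) {α : ℝ} (hα0 : 0 < α) (c : ℝ) :
    PD (fun u => F u * chiP α (c * u)) := by
  refine ⟨h.cont.mul ((continuous_chiP hα0).comp (by fun_prop)), fun u => ?_, fun s hs z => ?_⟩
  · rw [abs_mul]
    exact mul_le_one₀ (h.bdd u) (abs_nonneg _) (abs_chiP_le hα0 _)
  · have hF := PD_integrable h.cont h.bdd hs z
    have e : ∀ u : ℝ, F u * chiP α (c * u) * Real.exp (-s * u ^ 2) * Real.cos (z * u) =
        ∫ x in Ioi (1 : ℝ), (F u * Real.exp (-s * u ^ 2) * Real.cos (z * u)) *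
          (α * x ^ (-(1 + α))) * Real.cos (x * c * u) := by
      intro u
      unfold chiP
      rw [mul_right_comm (F u), mul_right_comm _ _ (Real.cos (z * u)), ← integral_const_mul]
      congr 1; ext x; rw [mul_assoc x c u]; ring
    simp only [e]
    rw [integral_integral_swap]
    · refine integral_nonneg_of_ae ?_
      filter_upwards [pareto_nonneg hα0] with x hx
      have e2 : ∀ u : ℝ, (F u * Real.exp (-s * u ^ 2) * Real.cos (z * u)) *
          (α * x ^ (-(1 + α))) * Real.cos (x * c * u) = (α * x ^ (-(1 + α))) *
          ((F u * Real.exp (-s * u ^ 2) * Real.cos (z * u)) * Real.cos (x * c * u)) := by intro u; ring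
      simp only [e2]
      rw [integral_const_mul]
      exact mul_nonneg hx (h.cos_mul (x * c) hs z)
    · have := (hF.mul_prod (integrableOn_pareto hα0)).mul_bdd (c := 1)
        (g := fun q : ℝ × ℝ => Real.cos (q.2 * c * q.1)) (by fun_prop)
        (Filter.Eventually.of_forall fun u => by simpa using Real.abs_cos_le_one _)
      exact this

theorem PD_chi_pow {α : ℝ} (hα0 : 0 < α) (c : ℝ) (N : ℕ) : PD (fun u => chiP α (c * u) ^ N) := by
  induction N with
  | zero => simpa using PD_one
  | succ N ih => simpa [pow_succ] using ih.chi_mul hα0 c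

def Cst (α : ℝ) : ℝ := ∫ v in Ioi (0 : ℝ), (1 - Real.cos v) * v ^ (-(1 + α))

theorem integrableOn_Cst {α : ℝ} (hα0 : 0 < α) (hα2 : α < 2) :
    IntegrableOn (fun v : ℝ => (1 - Real.cos v) * v ^ (-(1 + α))) (Ioi 0) := by
  have hm : Measurable (fun v : ℝ => (1 - Real.cos v) * v ^ (-(1 + α))) := by fun_prop
  rw [← Ioc_union_Ioi_eq_Ioi zero_le_one]
  refine IntegrableOn.union ?_ ?_
  · have h1 : IntegrableOn (fun v : ℝ => v ^ (1 - α)) (Ioc 0 1) := by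
      rw [← intervalIntegrable_iff_integrableOn_Ioc_of_le zero_le_one]
      exact intervalIntegral.intervalIntegrable_rpow' (by linarith)
    refine Integrable.mono' h1 hm.aestronglyMeasurable ?_
    filter_upwards [ae_restrict_mem measurableSet_Ioc] with v hv
    have hv0 : 0 < v := hv.1
    have a1 : 0 ≤ 1 - Real.cos v := by linarith [Real.cos_le_one v]
    have a2 := Real.one_sub_sq_div_two_le_cos (x := v)
    rw [Real.norm_of_nonneg (by positivity)]
    calc (1 - Real.cos v) * v ^ (-(1 + α)) ≤ v ^ 2 * v ^ (-(1 + α)) := by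
          gcongr; nlinarith
      _ = v ^ (1 - α) := by
          rw [← Real.rpow_natCast, ← Real.rpow_add hv0]; congr 1; push_cast; ring
  · have h1 := (integrableOn_Ioi_rpow_of_lt (a := -(1 + α)) (by linarith) one_pos).const_mul 2
    refine Integrable.mono' h1 hm.aestronglyMeasurable ?_
    filter_upwards [ae_restrict_mem measurableSet_Ioi] with v hv
    have hv0 : 0 < v := lt_trans one_pos hv
    have a1 : 0 ≤ 1 - Real.cos v := by linarith [Real.cos_le_one v]
    rw [Real.norm_of_nonneg (by positivity)]
    gcongr
    linarith [Real.neg_one_le_cos v]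

theorem Cst_pos {α : ℝ} (hα0 : 0 < α) (hα2 : α < 2) : 0 < Cst α := by
  unfold Cst
  rw [setIntegral_pos_iff_support_of_nonneg_ae _ (integrableOn_Cst hα0 hα2)]
  · refine lt_of_lt_of_le (b := volume (Ioo (0:ℝ) 1)) (by simp) (measure_mono fun v hv => ?_)
    refine ⟨?_, hv.1⟩
    have h1 : Real.cos v < 1 := by
      have := Real.cos_lt_cos_of_nonneg_of_le_pi (x := 0) (y := v) le_rfl (by linarith [hv.2, Real.pi_gt_three]) hv.1
      simpa using this
    have h2 := Real.rpow_pos_of_pos hv.1 (-(1 + α))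
    exact (mul_pos (by linarith) h2).ne'
  · filter_upwards [ae_restrict_mem measurableSet_Ioi] with v hv
    have hv0 : 0 < v := hv
    have a1 : 0 ≤ 1 - Real.cos v := by linarith [Real.cos_le_one v]
    simp only [Pi.zero_apply]; positivity

theorem chiP_eq {α : ℝ} (hα0 : 0 < α) {u : ℝ} (hu : 0 < u) :
    1 - chiP α u = α * u ^ α * ∫ v in Ioi u, (1 - Real.cos v) * v ^ (-(1 + α)) := by
  have h := integral_comp_mul_left_Ioi' (fun v : ℝ => (1 - Real.cos v) * v ^ (-(1 + α))) 1 hu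
  rw [mul_one] at h
  rw [← h]
  nth_rewrite 1 [← integral_pareto hα0]
  unfold chiP
  rw [← integral_sub (integrableOn_pareto hα0) (integrableOn_cos_pareto hα0 u), smul_eq_mul, ← mul_assoc,
    ← integral_const_mul]
  refine setIntegral_congr_fun measurableSet_Ioi fun x hx => ?_
  have hx0 : (0:ℝ) < x := lt_trans one_pos hx
  rw [Real.mul_rpow hu.le hx0.le, mul_comm x u]
  have : u ^ α * u * u ^ (-(1 + α)) = 1 := by
    nth_rewrite 2 [← Real.rpow_one u]
    rw [← Real.rpow_add hu, ← Real.rpow_add hu]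
    have : α + 1 + -(1 + α) = 0 := by ring
    rw [this, Real.rpow_zero]
  linear_combination (-(α * (1 - Real.cos (u * x)) * x ^ (-(1 + α)))) * this

theorem chiP_neg (α u : ℝ) : chiP α (-u) = chiP α u := by
  unfold chiP; simp [mul_neg, Real.cos_neg]

theorem chiP_lim {α : ℝ} (hα0 : 0 < α) (hα2 : α < 2) (u : ℝ) :
    Tendsto (fun N : ℕ => chiP α ((α * Cst α * (N + 1)) ^ (-(1 / α)) * u) ^ (N + 1)) atTop
      (𝓝 (Real.exp (-(|u| ^ α)))) := by
  have hC := Cst_pos hα0 hα2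
  wlog hu : 0 < u generalizing u
  · rcases eq_or_lt_of_le (not_lt.mp hu) with h | h
    · subst h
      have h0 : chiP α 0 = 1 := by unfold chiP; simpa using integral_pareto hα0
      simp [h0, Real.zero_rpow hα0.ne']
    · have := this (-u) (by linarith)
      simpa [mul_neg, chiP_neg] using this
  set lam : ℕ → ℝ := fun N => (α * Cst α * N) ^ (-(1 / α)) with hlam
  have hlt : Tendsto lam atTop (𝓝 0) := by
    have h1 : Tendsto (fun N : ℕ => α * Cst α * (N : ℝ)) atTop atTop :=
      tendsto_natCast_atTop_atTop.const_mul_atTop (by positivity)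
    exact (tendsto_rpow_neg_atTop (by positivity : 0 < 1 / α)).comp h1
  have hintg : Tendsto (fun N => ∫ v in Ioi (lam N * u), (1 - Real.cos v) * v ^ (-(1 + α))) atTop (𝓝 (Cst α)) := by
    have e : ∀ᶠ N in atTop, ∫ v in Ioi (lam N * u), (1 - Real.cos v) * v ^ (-(1 + α)) =
        ∫ v in Ioi (0:ℝ), (Ioi (lam N * u)).indicator (fun v => (1 - Real.cos v) * v ^ (-(1 + α))) v := by
      refine Filter.Eventually.of_forall fun N => ?_
      have : 0 ≤ lam N * u := by simp only [hlam]; positivity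
      rw [setIntegral_indicator measurableSet_Ioi, inter_eq_self_of_subset_right (Ioi_subset_Ioi this)]
    rw [tendsto_congr' e]
    unfold Cst
    refine tendsto_integral_of_dominated_convergence (fun v => (1 - Real.cos v) * v ^ (-(1 + α))) ?_
      (integrableOn_Cst hα0 hα2) ?_ ?_
    · intro N
      exact (Measurable.indicator (by fun_prop) measurableSet_Ioi).aestronglyMeasurable
    · intro N
      filter_upwards [ae_restrict_mem measurableSet_Ioi] with v hv
      have hv0 : 0 < v := hv
      have a1 : 0 ≤ 1 - Real.cos v := by linarith [Real.cos_le_one v]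
      refine (norm_indicator_le_norm_self _ _).trans ?_
      rw [Real.norm_of_nonneg (by positivity)]
    · filter_upwards [ae_restrict_mem measurableSet_Ioi] with v hv
      have hv0 : 0 < v := hv
      have : Tendsto (fun N => lam N * u) atTop (𝓝 0) := by simpa using hlt.mul_const u
      refine tendsto_const_nhds.congr' ?_
      filter_upwards [this.eventually_lt_const hv0] with N hN
      rw [indicator_of_mem (show v ∈ Ioi (lam N * u) from hN)]
  have key : Tendsto (fun N : ℕ => (N : ℝ) * (chiP α (lam N * u) - 1)) atTop (𝓝 (-(u ^ α))) := by
    have h1 : Tendsto (fun N : ℕ => -(u ^ α) * ((Cst α)⁻¹ *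
        ∫ v in Ioi (lam N * u), (1 - Real.cos v) * v ^ (-(1 + α)))) atTop (𝓝 (-(u ^ α))) := by
      have := (hintg.const_mul (Cst α)⁻¹).const_mul (-(u ^ α))
      simpa [inv_mul_cancel₀ hC.ne'] using this
    refine h1.congr' ?_
    filter_upwards [Filter.eventually_gt_atTop 0] with N hN
    have hN0 : (0:ℝ) < N := by exact_mod_cast hN
    have hl : 0 < lam N := by simp only [hlam]; positivity
    have h2 := chiP_eq hα0 (mul_pos hl hu)
    have h3 : (lam N * u) ^ α = (α * Cst α * N)⁻¹ * u ^ α := by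
      rw [Real.mul_rpow hl.le hu.le, hlam, ← Real.rpow_mul (by positivity)]
      rw [show -(1 / α) * α = -1 by field_simp, Real.rpow_neg_one]
    rw [h3] at h2
    rw [show chiP α (lam N * u) - 1 = -(1 - chiP α (lam N * u)) by ring, h2]
    field_simp
  have h4 := Real.tendsto_one_add_pow_exp_of_tendsto key
  rw [abs_of_pos hu]
  have h5 := h4.comp (tendsto_add_atTop_nat 1)
  simp only [add_sub_cancel] at h5
  refine h5.congr fun N => ?_
  simp [hlam, Function.comp]

theorem stable_nonneg {α : ℝ} (hα0 : 0 < α) (hα2 : α < 2) (z : ℝ) : 0 ≤ stableDensity α z := by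
  have hcα : Continuous fun u : ℝ => |u| ^ α := (Real.continuous_rpow_const hα0.le).comp continuous_abs
  have step1 : ∀ s : ℝ, 0 < s → 0 ≤ ∫ u : ℝ, Real.exp (-(|u| ^ α)) * Real.exp (-s * u ^ 2) * Real.cos (z * u) := by
    intro s hs
    refine ge_of_tendsto' (tendsto_integral_of_dominated_convergence (fun u => Real.exp (-s * u ^ 2)) (F := fun N u =>
      chiP α ((α * Cst α * ((N : ℕ) + 1)) ^ (-(1 / α)) * u) ^ (N + 1) * Real.exp (-s * u ^ 2) * Real.cos (z * u))
      ?_ (integrable_exp_neg_mul_sq hs) ?_ ?_) (fun N => (PD_chi_pow hα0 _ (N + 1)).nonneg s hs z)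
    · intro N
      exact (PD_integrable (PD_chi_pow hα0 _ (N + 1)).cont (PD_chi_pow hα0 _ (N + 1)).bdd hs z).aestronglyMeasurable
    · refine fun N => Filter.Eventually.of_forall fun u => ?_
      rw [norm_mul, norm_mul, Real.norm_eq_abs, Real.norm_eq_abs, Real.norm_eq_abs, abs_of_pos (Real.exp_pos _)]
      have h1 := (PD_chi_pow hα0 ((α * Cst α * ((N : ℕ) + 1)) ^ (-(1 / α))) (N + 1)).bdd u
      have h2 := Real.abs_cos_le_one (z * u)
      calc _ ≤ 1 * Real.exp (-s * u ^ 2) * 1 := by gcongr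
        _ = _ := by ring
    · exact Filter.Eventually.of_forall fun u => ((chiP_lim hα0 hα2 u).mul_const _).mul_const _
  have hW : Integrable (fun u : ℝ => Real.exp (-(|u| ^ α))) := by
    have := integrable_comp_abs' (integrableOn_Wt hα0 (j := 0) (by norm_num) (p := 0) le_rfl)
    simpa [Wt] using this
  unfold stableDensity
  refine mul_nonneg (by positivity) ?_
  refine ge_of_tendsto' (tendsto_integral_of_dominated_convergence (fun u => Real.exp (-(|u| ^ α))) (F := fun (N : ℕ) u =>
      Real.exp (-(|u| ^ α)) * Real.exp (-(1 / ((N : ℝ) + 1)) * u ^ 2) * Real.cos (z * u))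
      ?_ hW ?_ ?_) (fun N => step1 (1 / ((N : ℝ) + 1)) (by positivity))
  · intro N; exact Continuous.aestronglyMeasurable (by fun_prop)
  · refine fun N => Filter.Eventually.of_forall fun u => ?_
    rw [norm_mul, norm_mul, Real.norm_eq_abs, Real.norm_eq_abs, Real.norm_eq_abs, abs_of_pos (Real.exp_pos _), abs_of_pos (Real.exp_pos _)]
    have h1 : Real.exp (-(1 / ((N : ℝ) + 1)) * u ^ 2) ≤ 1 := by
      apply Real.exp_le_one_iff.mpr
      have : 0 ≤ 1 / ((N : ℝ) + 1) := by positivity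
      nlinarith [sq_nonneg u]
    have h2 := Real.abs_cos_le_one (z * u)
    calc _ ≤ Real.exp (-(|u| ^ α)) * 1 * 1 := by gcongr
      _ = _ := by ring
  · refine Filter.Eventually.of_forall fun u => ?_
    have h1 : Tendsto (fun N : ℕ => Real.exp (-(1 / ((N : ℝ) + 1)) * u ^ 2)) atTop (𝓝 1) := by
      have h := ((tendsto_one_div_add_atTop_nhds_zero_nat (𝕜 := ℝ)).neg.mul_const (u ^ 2))
      have := (Real.continuous_exp.tendsto _).comp h
      simpa [Function.comp_def] using this
    have := ((h1.const_mul (Real.exp (-(|u| ^ α)))).mul_const (Real.cos (z * u)))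
    rw [mul_one] at this
    rw [mul_comm (Real.cos (z * u))]
    exact this

theorem stable_zero_pos {α : ℝ} (hα0 : 0 < α) : 0 < stableDensity α 0 := by
  have hW : Integrable (fun u : ℝ => Real.exp (-(|u| ^ α))) := by
    have := integrable_comp_abs' (integrableOn_Wt hα0 (j := 0) (by norm_num) (p := 0) le_rfl)
    simpa [Wt] using this
  unfold stableDensity
  simp only [zero_mul, Real.cos_zero, one_mul]
  refine mul_pos (by positivity) ?_
  exact integral_exp_pos hW


theorem continuous_gauss : Continuous gauss := by unfold gauss; fun_prop

theorem gauss_pos (y : ℝ) : 0 < gauss y := by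
  unfold gauss
  have : 0 < Real.sqrt (2 * Real.pi) := Real.sqrt_pos.mpr (by positivity)
  positivity

theorem gauss_neg (y : ℝ) : gauss (-y) = gauss y := by unfold gauss; simp

theorem gauss_eq (y : ℝ) : gauss y = ProbabilityTheory.gaussianPDFReal 0 1 y := by
  unfold gauss ProbabilityTheory.gaussianPDFReal; simp

theorem integrable_gauss : Integrable gauss := by
  have := ProbabilityTheory.integrable_gaussianPDFReal 0 1
  exact this.congr (Filter.Eventually.of_forall fun y => (gauss_eq y).symm)

theorem integral_gauss : ∫ y, gauss y = 1 := by
  simp only [gauss_eq]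
  exact ProbabilityTheory.integral_gaussianPDFReal_eq_one 0 (by norm_num)

theorem gauss_const_le : (Real.sqrt (2 * Real.pi))⁻¹ ≤ 1 := by
  refine inv_le_one_of_one_le₀ ?_
  rw [Real.one_le_sqrt]
  linarith [Real.pi_gt_three]

theorem gauss_const_pos : 0 < (Real.sqrt (2 * Real.pi))⁻¹ :=
  inv_pos.mpr (Real.sqrt_pos.mpr (by positivity))

theorem gauss_le_exp (y : ℝ) : gauss y ≤ Real.exp (-(y ^ 2) / 2) := by
  unfold gauss
  exact mul_le_of_le_one_left (Real.exp_pos _).le gauss_const_le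

theorem gauss_le_one (y : ℝ) : gauss y ≤ 1 :=
  (gauss_le_exp y).trans (Real.exp_le_one_iff.mpr (by nlinarith [sq_nonneg y]))

theorem abs_gauss_le_one (y : ℝ) : |gauss y| ≤ 1 := by
  rw [abs_of_pos (gauss_pos y)]; exact gauss_le_one y

/-- convolution of `P` with a scaled kernel `K` -/
def cv (P K : ℝ → ℝ) (w y : ℝ) : ℝ := ∫ z : ℝ, P (y - w * z) * K z

theorem cv_integrand {P K : ℝ → ℝ} {B : ℝ} (hP : Continuous P) (hB : ∀ u, |P u| ≤ B) (hK : Integrable K)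
    (w y : ℝ) : Integrable (fun z => P (y - w * z) * K z) :=
  hK.bdd_mul (c := B) (by fun_prop) (Filter.Eventually.of_forall fun z => by simpa using hB _)

theorem continuous_cv {P K : ℝ → ℝ} {B : ℝ} (hP : Continuous P) (hB : ∀ u, |P u| ≤ B) (hK : Integrable K)
    (w : ℝ) : Continuous (cv P K w) := by
  unfold cv
  refine continuous_of_dominated (bound := fun z => B * |K z|) ?_ ?_ (hK.abs.const_mul B) ?_
  · exact fun y => (cv_integrand hP hB hK w y).aestronglyMeasurable
  · intro y
    refine Filter.Eventually.of_forall fun z => ?_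
    rw [norm_mul, Real.norm_eq_abs, Real.norm_eq_abs]
    exact mul_le_mul_of_nonneg_right (hB _) (abs_nonneg _)
  · exact Filter.Eventually.of_forall fun z => by fun_prop

theorem cv_prod {P K : ℝ → ℝ} (hP : Continuous P) (hPi : Integrable P) (hKc : Continuous K) (hK : Integrable K)
    (w : ℝ) : Integrable (Function.uncurry fun y z => P (y - w * z) * K z) (volume.prod volume) := by
  rw [integrable_prod_iff']
  · constructor
    · refine Filter.Eventually.of_forall fun z => ?_
      exact (hPi.comp_sub_right (w * z)).mul_const (K z)
    · have : ∀ z, ∫ y, ‖Function.uncurry (fun y z => P (y - w * z) * K z) (y, z)‖ = (∫ y, ‖P y‖) * ‖K z‖ := by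
        intro z
        simp only [Function.uncurry, norm_mul]
        rw [integral_mul_const, integral_sub_right_eq_self (fun y => ‖P y‖) (w * z)]
      simp only [this]
      exact hK.norm.const_mul _
  · refine Continuous.aestronglyMeasurable ?_
    unfold Function.uncurry
    fun_prop

theorem integrable_cv {P K : ℝ → ℝ} (hP : Continuous P) (hPi : Integrable P) (hKc : Continuous K) (hK : Integrable K)
    (w : ℝ) : Integrable (cv P K w) :=
  (cv_prod hP hPi hKc hK w).integral_prod_left

theorem integral_cv {P K : ℝ → ℝ} (hP : Continuous P) (hPi : Integrable P) (hKc : Continuous K) (hK : Integrable K)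
    (w : ℝ) : ∫ y, cv P K w y = (∫ y, P y) * ∫ z, K z := by
  unfold cv
  rw [integral_integral_swap (cv_prod hP hPi hKc hK w)]
  have : ∀ z, ∫ y, P (y - w * z) * K z = (∫ y, P y) * K z := by
    intro z
    rw [integral_mul_const, integral_sub_right_eq_self P (w * z)]
  simp only [this]
  rw [integral_const_mul]

/-- `K` even: symmetrised form -/
theorem sym_gauss (y x : ℝ) : (gauss (y - x) + gauss (y + x)) / 2 = gauss y * (Real.exp (-(x ^ 2) / 2) * Real.cosh (x * y)) := by
  unfold gauss
  rw [Real.cosh_eq]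
  have h1 : Real.exp (-((y - x) ^ 2) / 2) = Real.exp (-(y ^ 2) / 2) * (Real.exp (-(x ^ 2) / 2) * Real.exp (x * y)) := by
    rw [← Real.exp_add, ← Real.exp_add]; congr 1; ring
  have h2 : Real.exp (-((y + x) ^ 2) / 2) = Real.exp (-(y ^ 2) / 2) * (Real.exp (-(x ^ 2) / 2) * Real.exp (-(x * y))) := by
    rw [← Real.exp_add, ← Real.exp_add]; congr 1; ring
  rw [h1, h2]; ring

theorem cosh_sub_one_le (t : ℝ) : Real.cosh t - 1 ≤ t ^ 2 * Real.exp |t| := by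
  have h1 : Real.cosh t = Real.cosh |t| := (Real.cosh_abs t).symm
  have h2 : Real.cosh |t| - 1 = 2 * Real.sinh (|t| / 2) ^ 2 := by
    have := Real.cosh_two_mul (|t| / 2)
    have h3 := Real.cosh_sq (|t| / 2)
    rw [mul_div_cancel₀ _ (two_ne_zero)] at this
    linarith
  have h4 : ∀ s : ℝ, 0 ≤ s → Real.sinh s ≤ s * Real.exp s := by
    intro s hs
    rw [Real.sinh_eq]
    have h5 : Real.exp s * (1 - 2 * s) ≤ Real.exp (-s) := by
      have h6 : 1 - 2 * s ≤ Real.exp (-(2 * s)) := by linarith [Real.add_one_le_exp (-(2 * s))]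
      calc _ ≤ Real.exp s * Real.exp (-(2 * s)) := mul_le_mul_of_nonneg_left h6 (Real.exp_pos _).le
        _ = _ := by rw [← Real.exp_add]; congr 1; ring
    linarith
  have h5 := h4 (|t| / 2) (by positivity)
  have h6 : 0 ≤ Real.sinh (|t| / 2) := Real.sinh_nonneg_iff.mpr (by positivity)
  rw [h1, h2]
  calc 2 * Real.sinh (|t| / 2) ^ 2 ≤ 2 * (|t| / 2 * Real.exp (|t| / 2)) ^ 2 := by gcongr
    _ = |t| ^ 2 / 2 * (Real.exp (|t| / 2) * Real.exp (|t| / 2)) := by ring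
    _ = t ^ 2 / 2 * Real.exp |t| := by rw [← Real.exp_add, sq_abs]; congr 2; ring
    _ ≤ _ := by nlinarith [mul_nonneg (sq_nonneg t) (Real.exp_pos |t|).le]

theorem sym_gauss_bound : ∃ C : ℝ, 0 < C ∧ ∀ y x : ℝ, |x| ≤ 1 →
    |(gauss (y - x) + gauss (y + x)) / 2 - gauss y| ≤ C * x ^ 2 * Real.exp (-(y ^ 2) / 8) := by
  refine ⟨2 * Real.exp (8 / 3) + 1, by positivity, fun y x hx => ?_⟩
  rw [sym_gauss]
  have e1 : 1 - x ^ 2 / 2 ≤ Real.exp (-(x ^ 2) / 2) := by linarith [Real.add_one_le_exp (-(x ^ 2) / 2)]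
  have e2 : Real.exp (-(x ^ 2) / 2) ≤ 1 := Real.exp_le_one_iff.mpr (by nlinarith [sq_nonneg x])
  have e0 := Real.exp_pos (-(x ^ 2) / 2)
  have c1 := Real.one_le_cosh (x * y)
  have c2 := cosh_sub_one_le (x * y)
  have c3 : Real.exp |x * y| ≤ Real.exp |y| := by
    rw [Real.exp_le_exp, abs_mul]; exact mul_le_of_le_one_left (abs_nonneg _) hx
  have c4 : Real.cosh (x * y) - 1 ≤ x ^ 2 * (y ^ 2 * Real.exp |y|) := by
    calc _ ≤ (x * y) ^ 2 * Real.exp |x * y| := c2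
      _ ≤ (x * y) ^ 2 * Real.exp |y| := by gcongr
      _ = _ := by ring
  have key : |Real.exp (-(x ^ 2) / 2) * Real.cosh (x * y) - 1| ≤ x ^ 2 * (y ^ 2 * Real.exp |y| + 1) := by
    rw [abs_le]; constructor <;> nlinarith [sq_nonneg x, mul_nonneg (sq_nonneg x) (mul_nonneg (sq_nonneg y) (Real.exp_pos |y|).le)]
  have hy : y ^ 2 * Real.exp |y| + 1 ≤ (2 * Real.exp (8 / 3) + 1) * Real.exp (3 * y ^ 2 / 8) := by
    have k1 : y ^ 2 ≤ 2 * Real.exp |y| := by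
      have := Real.quadratic_le_exp_of_nonneg (abs_nonneg y)
      rw [sq_abs] at this; nlinarith [abs_nonneg y]
    have k2 : Real.exp |y| * Real.exp |y| ≤ Real.exp (8 / 3) * Real.exp (3 * y ^ 2 / 8) := by
      rw [← Real.exp_add, ← Real.exp_add, Real.exp_le_exp]
      nlinarith [sq_nonneg (3 * |y| - 8), sq_abs y]
    have k3 : 1 ≤ Real.exp (3 * y ^ 2 / 8) := Real.one_le_exp (by positivity)
    nlinarith [Real.exp_pos |y|]
  have hg : gauss y * Real.exp (3 * y ^ 2 / 8) ≤ Real.exp (-(y ^ 2) / 8) := by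
    calc _ ≤ Real.exp (-(y ^ 2) / 2) * Real.exp (3 * y ^ 2 / 8) := by gcongr; exact gauss_le_exp y
      _ = _ := by rw [← Real.exp_add]; congr 1; ring
  rw [show gauss y * (Real.exp (-(x ^ 2) / 2) * Real.cosh (x * y)) - gauss y
    = gauss y * (Real.exp (-(x ^ 2) / 2) * Real.cosh (x * y) - 1) by ring, abs_mul, abs_of_pos (gauss_pos y)]
  have gp := gauss_pos y
  calc _ ≤ gauss y * (x ^ 2 * ((2 * Real.exp (8 / 3) + 1) * Real.exp (3 * y ^ 2 / 8))) := by
        refine mul_le_mul_of_nonneg_left (key.trans ?_) gp.le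
        gcongr
    _ = (2 * Real.exp (8 / 3) + 1) * x ^ 2 * (gauss y * Real.exp (3 * y ^ 2 / 8)) := by ring
    _ ≤ _ := by gcongr

/-- inner and outer parts -/
def cvIn (K : ℝ → ℝ) (w y : ℝ) : ℝ := ∫ z in {z : ℝ | |w * z| ≤ 1}, gauss (y - w * z) * K z
def cvOut (K : ℝ → ℝ) (w y : ℝ) : ℝ := ∫ z in {z : ℝ | |w * z| ≤ 1}ᶜ, gauss (y - w * z) * K z

theorem meas_in (w : ℝ) : MeasurableSet {z : ℝ | |w * z| ≤ 1} :=
  measurableSet_le (by fun_prop) measurable_const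

theorem cv_split {K : ℝ → ℝ} (hK : Integrable K) (w y : ℝ) : cv gauss K w y = cvIn K w y + cvOut K w y :=
  (integral_add_compl (meas_in w) (cv_integrand continuous_gauss abs_gauss_le_one hK w y)).symm

theorem tail_le {K : ℝ → ℝ} {β w : ℝ} (hβ : 0 < β) (hw : 0 < w) (hK : Integrable K)
    (hm : Integrable fun z => |z| ^ β * |K z|) {P : ℝ → ℝ} (hP : ∀ z, |P z| ≤ 1) :
    |∫ z in {z : ℝ | |w * z| ≤ 1}ᶜ, P z * K z| ≤ w ^ β * ∫ z, |z| ^ β * |K z| := by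
  rw [← integral_const_mul, ← integral_indicator (meas_in w).compl, ← Real.norm_eq_abs]
  refine norm_integral_le_of_norm_le (hm.const_mul _) (Filter.Eventually.of_forall fun z => ?_)
  by_cases hz : z ∈ {z : ℝ | |w * z| ≤ 1}ᶜ
  · rw [indicator_of_mem hz, norm_mul, Real.norm_eq_abs, Real.norm_eq_abs, ← mul_assoc,
      ← Real.mul_rpow hw.le (abs_nonneg z)]
    have h1 : 1 < |w * z| := by simpa using hz
    rw [abs_mul, abs_of_pos hw] at h1
    have := Real.one_le_rpow h1.le hβ.le
    exact mul_le_mul_of_nonneg_right ((hP z).trans this) (abs_nonneg _)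
  · rw [indicator_of_notMem hz, norm_zero]
    positivity

theorem cvOut_le {K : ℝ → ℝ} {β w : ℝ} (hβ : 0 < β) (hw : 0 < w) (hK : Integrable K)
    (hm : Integrable fun z => |z| ^ β * |K z|) (y : ℝ) :
    |cvOut K w y| ≤ w ^ β * ∫ z, |z| ^ β * |K z| :=
  tail_le hβ hw hK hm (P := fun z => gauss (y - w * z)) fun _ => abs_gauss_le_one _

theorem cvIn_bound : ∃ C : ℝ, 0 < C ∧ ∀ (K : ℝ → ℝ) (β w y : ℝ), 0 < β → β < 2 → 0 < w → Integrable K →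
    (∀ z, K (-z) = K z) → (Integrable fun z => |z| ^ β * |K z|) →
    |cvIn K w y - gauss y * ∫ z, K z| ≤ C * (w ^ β * ∫ z, |z| ^ β * |K z|) * Real.exp (-(y ^ 2) / 8) := by
  obtain ⟨C, hC, hb⟩ := sym_gauss_bound
  refine ⟨C + 1, by positivity, fun K β w y hβ hβ2 hw hK he hm => ?_⟩
  set S := {z : ℝ | |w * z| ≤ 1} with hS
  have hSm : MeasurableSet S := meas_in w
  have hI1 : IntegrableOn (fun z => gauss (y - w * z) * K z) S :=
    (cv_integrand continuous_gauss abs_gauss_le_one hK w y).integrableOn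
  have hI2 : IntegrableOn (fun z => gauss (y + w * z) * K z) S := by
    have := (cv_integrand continuous_gauss abs_gauss_le_one hK (-w) y).integrableOn (s := S)
    simpa using this
  have hsym : ∫ z in S, gauss (y + w * z) * K z = cvIn K w y := by
    unfold cvIn
    rw [← integral_indicator hSm, ← integral_indicator (meas_in w), ← integral_neg_eq_self]
    refine integral_congr_ae (Filter.Eventually.of_forall fun z => ?_)
    simp only [indicator, hS, mem_setOf_eq, mul_neg, abs_neg, he]
    rfl
  have h1 : cvIn K w y = ∫ z in S, ((gauss (y - w * z) + gauss (y + w * z)) / 2) * K z := by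
    have : ∀ z, ((gauss (y - w * z) + gauss (y + w * z)) / 2) * K z
      = (gauss (y - w * z) * K z + gauss (y + w * z) * K z) / 2 := fun z => by ring
    simp only [this]
    rw [integral_div, integral_add hI1 hI2, hsym]
    unfold cvIn; ring
  have hI3 : IntegrableOn (fun z => ((gauss (y - w * z) + gauss (y + w * z)) / 2) * K z) S := by
    refine ((hI1.add hI2).div_const 2).congr (Filter.Eventually.of_forall fun z => ?_)
    simp only [Pi.add_apply]; ring
  have hI4 : IntegrableOn (fun z => gauss y * K z) S := (hK.const_mul _).integrableOn
  have h2 : cvIn K w y - gauss y * ∫ z, K z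
      = (∫ z in S, ((gauss (y - w * z) + gauss (y + w * z)) / 2 - gauss y) * K z)
        - gauss y * ∫ z in Sᶜ, 1 * K z := by
    simp only [sub_mul, one_mul]
    rw [integral_sub hI3 hI4, h1, ← integral_add_compl hSm hK, integral_const_mul]
    ring
  have h3 : |∫ z in S, ((gauss (y - w * z) + gauss (y + w * z)) / 2 - gauss y) * K z|
      ≤ C * Real.exp (-(y ^ 2) / 8) * (w ^ β * ∫ z, |z| ^ β * |K z|) := by
    rw [← integral_const_mul, ← integral_const_mul, ← integral_indicator hSm, ← Real.norm_eq_abs]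
    refine norm_integral_le_of_norm_le ((hm.const_mul _).const_mul _) (Filter.Eventually.of_forall fun z => ?_)
    by_cases hz : z ∈ S
    · rw [indicator_of_mem hz, norm_mul, Real.norm_eq_abs, Real.norm_eq_abs, ← mul_assoc (w ^ β),
        ← Real.mul_rpow hw.le (abs_nonneg z), ← mul_assoc]
      have hz' : |w * z| ≤ 1 := hz
      refine mul_le_mul_of_nonneg_right ((hb y (w * z) hz').trans ?_) (abs_nonneg _)
      have h5 : (w * z) ^ 2 ≤ (w * |z|) ^ β := by
        rw [← sq_abs (w * z), abs_mul, abs_of_pos hw]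
        rw [abs_mul, abs_of_pos hw] at hz'
        rw [← Real.rpow_natCast]
        exact Real.rpow_le_rpow_of_exponent_ge' (by positivity) hz' hβ.le (by exact_mod_cast hβ2.le)
      calc _ ≤ C * (w * |z|) ^ β * Real.exp (-(y ^ 2) / 8) := by gcongr
        _ = _ := by ring
    · rw [indicator_of_notMem hz, norm_zero]; positivity
  have h4 := tail_le hβ hw hK hm (P := fun _ => 1) (by simp)
  have h5 : gauss y ≤ Real.exp (-(y ^ 2) / 8) :=
    (gauss_le_exp y).trans (Real.exp_le_exp.mpr (by nlinarith [sq_nonneg y]))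
  rw [h2]
  refine (abs_sub _ _).trans ?_
  rw [abs_mul, abs_of_pos (gauss_pos y)]
  have h6 : 0 ≤ w ^ β * ∫ z, |z| ^ β * |K z| := mul_nonneg (by positivity) (integral_nonneg fun z => by positivity)
  have h7 := mul_le_mul h5 h4 (abs_nonneg _) (Real.exp_pos _).le
  calc _ ≤ _ := add_le_add h3 h7
    _ = _ := by ring


structure Sc (α d : ℝ) (w M : ℕ → ℝ) : Prop where
  dpos : 0 < d
  wpos : ∀ᶠ n in atTop, 0 < w n
  Mtop : Tendsto M atTop atTop
  rel : ∀ᶠ n in atTop, w n ^ α = d * Real.exp (-(M n) ^ 2 / 2)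

theorem Sc.wpow {α d : ℝ} {w M : ℕ → ℝ} (h : Sc α d w M) (hα0 : 0 < α) (κ : ℝ) :
    ∀ᶠ n in atTop, w n ^ (κ * α) = d ^ κ * Real.exp (-(M n) ^ 2 / 2 * κ) := by
  filter_upwards [h.wpos, h.rel] with n hw hr
  rw [mul_comm κ, Real.rpow_mul hw.le, hr, Real.mul_rpow h.dpos.le (Real.exp_pos _).le, ← Real.exp_mul]

theorem tendsto_pow_exp_sq {c : ℝ} (hc : 0 < c) (k : ℕ) :
    Tendsto (fun x : ℝ => x ^ k * Real.exp (-(c * x ^ 2))) atTop (𝓝 0) := by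
  have h1 := Real.tendsto_pow_mul_exp_neg_atTop_nhds_zero (2 * k)
  have h2 : Tendsto (fun x : ℝ => c * x ^ 2) atTop atTop :=
    (tendsto_pow_atTop two_ne_zero).const_mul_atTop hc
  have h3 := ((h1.comp h2).const_mul ((c ^ (2 * k))⁻¹))
  rw [mul_zero] at h3
  refine squeeze_zero' ?_ ?_ h3
  · filter_upwards [eventually_ge_atTop 0] with x hx
    positivity
  · filter_upwards [eventually_ge_atTop 1] with x hx
    simp only [Function.comp]
    have : (c ^ (2 * k))⁻¹ * ((c * x ^ 2) ^ (2 * k) * Real.exp (-(c * x ^ 2))) = (x ^ 2) ^ (2 * k) * Real.exp (-(c * x ^ 2)) := by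
      rw [mul_pow]; field_simp
    rw [this, ← pow_mul]
    exact mul_le_mul_of_nonneg_right (pow_le_pow_right₀ hx (by omega)) (Real.exp_pos _).le

theorem Sc.absorb {α d : ℝ} {w M : ℕ → ℝ} (h : Sc α d w M) (hα0 : 0 < α) {κ : ℝ} (hκ : 0 < κ) (k : ℕ) :
    Tendsto (fun n => M n ^ k * w n ^ (κ * α)) atTop (𝓝 0) := by
  have h1 := ((tendsto_pow_exp_sq (c := κ / 2) (by positivity) k).comp h.Mtop).const_mul (d ^ κ)
  rw [mul_zero] at h1
  refine h1.congr' ?_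
  filter_upwards [h.wpow hα0 κ] with n hn
  rw [hn]
  simp only [Function.comp]
  rw [show -(M n) ^ 2 / 2 * κ = -(κ / 2 * M n ^ 2) by ring]
  ring

theorem Sc.w_zero {α d : ℝ} {w M : ℕ → ℝ} (h : Sc α d w M) (hα0 : 0 < α) : Tendsto w atTop (𝓝 0) := by
  have := h.absorb hα0 (κ := 1 / α) (by positivity) 0
  simpa [hα0.ne'] using this

structure Ker (α : ℝ) (w M : ℕ → ℝ) (Q : ℕ → ℝ → ℝ) (m A b C : ℝ) (a : ℕ → ℝ) : Prop where
  Cpos : 0 < C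
  cont : ∀ n, Continuous (Q n)
  even : ∀ n z, Q n (-z) = Q n z
  int : ∀ n, Integrable (Q n)
  mass : ∀ n, ∫ z, Q n z = m
  momint : ∀ n, Integrable fun z => |z| ^ (31 / 32 * α) * |Q n z|
  mom : ∀ᶠ n in atTop, ∫ z, |z| ^ (31 / 32 * α) * |Q n z| ≤ C * (1 + M n ^ 2)
  asym : ∀ᶠ n in atTop, ∀ z : ℝ, 1 ≤ |z| → |Q n z - |z| ^ (-(1 + α)) * (a n - b * Real.log |z|)|
    ≤ C * (1 + M n ^ 2) * |z| ^ (-(1 + 3 * α / 2))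
  aA : ∀ᶠ n in atTop, a n + b * (Real.log (w n) - Real.log (M n)) = A

/-- the rescaled outer kernel -/
def Rk (α w M : ℝ) (Q : ℝ → ℝ) (s : ℝ) : ℝ :=
  if |M * s| ≤ 1 then 0 else M ^ (1 + α) * w ^ (-(α + 1)) * Q (M * s / w)

theorem scal_out {α w M : ℝ} (hw : 0 < w) (hM : 0 < M) (Q : ℝ → ℝ) (v : ℝ) :
    M ^ (1 + α) * w ^ (-α) * cvOut Q w (M * v) = ∫ u, gauss u * Rk α w M Q (v - u / M) := by
  unfold cvOut
  rw [← integral_indicator (meas_in w).compl]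
  set F := indicator {z : ℝ | |w * z| ≤ 1}ᶜ fun z => gauss (M * v - w * z) * Q z with hF
  have h1 : ∫ u, F ((M * v - u) / w) = w * ∫ z, F z := by
    rw [integral_sub_left_eq_self (fun x => F (x / w)) volume (M * v), Measure.integral_comp_div F w,
      abs_of_pos hw, smul_eq_mul]
  have h2 : ∀ u, gauss u * Rk α w M Q (v - u / M) = M ^ (1 + α) * w ^ (-(α + 1)) * F ((M * v - u) / w) := by
    intro u
    have e1 : M * (v - u / M) = M * v - u := by field_simp
    have e2 : w * ((M * v - u) / w) = M * v - u := by field_simp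
    unfold Rk
    rw [e1, hF]
    by_cases hz : |M * v - u| ≤ 1
    · rw [if_pos hz, indicator_of_notMem]
      · simp
      · rw [mem_compl_iff, not_not, mem_setOf_eq, e2]; exact hz
    · rw [if_neg hz, indicator_of_mem]
      · rw [e2]; simp only [sub_sub_cancel]; ring
      · rw [mem_compl_iff, mem_setOf_eq, e2]; exact hz
  simp only [h2]
  rw [integral_const_mul, h1, neg_add, Real.rpow_add hw, Real.rpow_neg_one]
  field_simp

theorem Ker.R_asym {α d : ℝ} {w M : ℕ → ℝ} (h : Sc α d w M) (hα0 : 0 < α) {Q : ℕ → ℝ → ℝ} {m A b C : ℝ} {a : ℕ → ℝ}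
    (hQ : Ker α w M Q m A b C a) : ∃ e : ℕ → ℝ, Tendsto e atTop (𝓝 0) ∧ ∀ᶠ n in atTop, ∀ s : ℝ, 1 < |M n * s| →
      |Rk α (w n) (M n) (Q n) s - |s| ^ (-(1 + α)) * (A - b * Real.log |s|)| ≤ e n * |s| ^ (-(1 + 3 * α / 2)) := by
  refine ⟨fun n => C * (1 + M n ^ 2) * w n ^ (1 / 2 * α), ?_, ?_⟩
  · have h0 := h.absorb hα0 (κ := 1 / 2) (by norm_num) 0
    have h2 := h.absorb hα0 (κ := 1 / 2) (by norm_num) 2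
    have := (h0.add h2).const_mul C
    simp only [add_zero, mul_zero] at this
    refine this.congr fun n => ?_
    ring
  · filter_upwards [hQ.asym, hQ.aA, h.wpos, h.Mtop.eventually_ge_atTop 1,
      (h.w_zero hα0).eventually (gt_mem_nhds (show (0:ℝ) < 1 by norm_num))] with n has haA hw hM hw1 s hs
    have hM0 : 0 < M n := by linarith
    have hs0 : 0 < |s| := by
      rw [abs_pos]; rintro rfl; simp at hs; linarith
    unfold Rk
    rw [if_neg (not_le.mpr hs)]
    have hz : |M n * s / w n| = M n * |s| / w n := by
      rw [abs_div, abs_mul, abs_of_pos hw, abs_of_pos hM0]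
    rw [abs_mul, abs_of_pos hM0] at hs
    have h1 := has (M n * s / w n) (by rw [hz, le_div_iff₀ hw]; linarith)
    rw [hz] at h1
    have hlog : Real.log (M n * |s| / w n) = Real.log (M n) + Real.log |s| - Real.log (w n) := by
      rw [Real.log_div (by positivity) hw.ne', Real.log_mul hM0.ne' hs0.ne']
    have hco : a n - b * Real.log (M n * |s| / w n) = A - b * Real.log |s| := by
      rw [hlog, ← haA]; ring
    rw [hco] at h1
    have hp : ∀ r : ℝ, (M n * |s| / w n) ^ (-(1 + r)) = M n ^ (-(1 + r)) * |s| ^ (-(1 + r)) * w n ^ (1 + r) := by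
      intro r
      rw [Real.div_rpow (by positivity) hw.le, Real.mul_rpow hM0.le hs0.le, Real.rpow_neg hw.le, div_inv_eq_mul]
    rw [hp, hp] at h1
    have c1 : M n ^ (1 + α) * M n ^ (-(1 + α)) = 1 := by rw [← Real.rpow_add hM0]; simp
    have c2 : w n ^ (-(α + 1)) * w n ^ (1 + α) = 1 := by
      rw [← Real.rpow_add hw, show -(α + 1) + (1 + α) = 0 by ring, Real.rpow_zero]
    have c3 : M n ^ (1 + α) * M n ^ (-(1 + 3 * α / 2)) ≤ 1 := by
      rw [← Real.rpow_add hM0]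
      exact Real.rpow_le_one_of_one_le_of_nonpos hM (by linarith)
    have c4 : w n ^ (-(α + 1)) * w n ^ (1 + 3 * α / 2) = w n ^ (1 / 2 * α) := by
      rw [← Real.rpow_add hw]; congr 1; ring
    have hpos : 0 < M n ^ (1 + α) * w n ^ (-(α + 1)) := by positivity
    have h2 := mul_le_mul_of_nonneg_left h1 hpos.le
    rw [← abs_of_pos hpos, ← abs_mul, abs_of_pos hpos] at h2
    have e1 : M n ^ (1 + α) * w n ^ (-(α + 1)) * (Q n (M n * s / w n) - M n ^ (-(1 + α)) * |s| ^ (-(1 + α)) * w n ^ (1 + α) * (A - b * Real.log |s|))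
      = M n ^ (1 + α) * w n ^ (-(α + 1)) * Q n (M n * s / w n) - |s| ^ (-(1 + α)) * (A - b * Real.log |s|) := by
      rw [mul_sub]; congr 1
      linear_combination (|s| ^ (-(1 + α)) * (A - b * Real.log |s|) * (w n ^ (-(α + 1)) * w n ^ (1 + α))) * c1 + |s| ^ (-(1 + α)) * (A - b * Real.log |s|) * c2
    rw [e1] at h2
    refine h2.trans ?_
    have e2 : M n ^ (1 + α) * w n ^ (-(α + 1)) * (C * (1 + M n ^ 2) * (M n ^ (-(1 + 3 * α / 2)) * |s| ^ (-(1 + 3 * α / 2)) * w n ^ (1 + 3 * α / 2)))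
      = (M n ^ (1 + α) * M n ^ (-(1 + 3 * α / 2))) * (C * (1 + M n ^ 2) * w n ^ (1 / 2 * α) * |s| ^ (-(1 + 3 * α / 2))) := by
      rw [← c4]; ring
    rw [e2]
    have := hQ.Cpos
    exact mul_le_of_le_one_left (by positivity) c3

theorem rpow_mid {r p q t : ℝ} (hr : 0 < r) (h1 : p ≤ t) (h2 : t ≤ q) : r ^ (-t) ≤ r ^ (-p) + r ^ (-q) := by
  rcases le_total 1 r with h | h
  · have := Real.rpow_le_rpow_of_exponent_le h (show -t ≤ -p by linarith)
    have := Real.rpow_nonneg hr.le (-q)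
    linarith
  · have := Real.rpow_le_rpow_of_exponent_ge hr h (show -q ≤ -t by linarith)
    have := Real.rpow_nonneg hr.le (-p)
    linarith

theorem abs_log_le {r η : ℝ} (hr : 0 < r) (hη : 0 < η) : |Real.log r| ≤ (r ^ η + r ^ (-η)) / η := by
  have h1 := Real.log_le_rpow_div hr.le hη
  have h2 := Real.log_le_rpow_div (inv_pos.mpr hr).le hη
  rw [Real.log_inv, Real.inv_rpow hr.le, ← Real.rpow_neg hr.le] at h2
  have h3 : 0 ≤ r ^ η / η := by positivity
  have h4 : 0 ≤ r ^ (-η) / η := by positivity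
  rw [add_div, abs_le]; constructor <;> linarith

theorem main_bound {α : ℝ} (hα0 : 0 < α) (hα2 : α < 2) (A b : ℝ) : ∃ C : ℝ, 0 < C ∧ ∀ s : ℝ, s ≠ 0 →
    |(|s| ^ (-(1 + α)) * (A - b * Real.log |s|))| ≤ C * (|s| ^ (-(1 + 31 / 32 * α)) + |s| ^ (-(4:ℝ))) := by
  refine ⟨|A| + |b| * (2 / (α / 32)) + 1, by positivity, fun s hs => ?_⟩
  have hr : 0 < |s| := abs_pos.mpr hs
  set r := |s|
  have h1 := abs_log_le hr (show 0 < α / 32 by positivity)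
  have h2 := rpow_mid hr (show 1 + 31 / 32 * α ≤ 1 + α by linarith) (show 1 + α ≤ 4 by linarith)
  have h3 := rpow_mid hr (show 1 + 31 / 32 * α ≤ 1 + α + α / 32 by linarith) (show 1 + α + α / 32 ≤ 4 by linarith)
  set B := r ^ (-(1 + 31 / 32 * α)) + r ^ (-(4:ℝ)) with hB
  have hB0 : 0 ≤ B := by positivity
  have h4 : r ^ (-(1 + α)) * r ^ (α / 32) ≤ B := by
    rw [← Real.rpow_add hr, show -(1 + α) + α / 32 = -(1 + 31 / 32 * α) by ring]
    have : 0 ≤ r ^ (-(4:ℝ)) := by positivity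
    linarith
  have h5 : r ^ (-(1 + α)) * r ^ (-(α / 32)) ≤ B := by
    rw [← Real.rpow_add hr, show -(1 + α) + -(α / 32) = -(1 + α + α / 32) by ring]
    exact h3
  rw [abs_mul, abs_of_pos (Real.rpow_pos_of_pos hr _)]
  have h6 : |A - b * Real.log r| ≤ |A| + |b| * ((r ^ (α / 32) + r ^ (-(α / 32))) / (α / 32)) := by
    refine (abs_sub _ _).trans ?_
    rw [abs_mul]
    gcongr
  calc _ ≤ r ^ (-(1 + α)) * (|A| + |b| * ((r ^ (α / 32) + r ^ (-(α / 32))) / (α / 32))) := by gcongr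
    _ = |A| * r ^ (-(1 + α)) + |b| / (α / 32) * (r ^ (-(1 + α)) * r ^ (α / 32) + r ^ (-(1 + α)) * r ^ (-(α / 32))) := by ring
    _ ≤ |A| * B + |b| / (α / 32) * (B + B) := by gcongr
    _ ≤ _ := by
      have : (|A| + |b| * (2 / (α / 32)) + 1) * B = |A| * B + |b| / (α / 32) * (B + B) + B := by ring
      linarith

theorem Ker.R_bound {α d : ℝ} {w M : ℕ → ℝ} (h : Sc α d w M) (hα0 : 0 < α) (hα2 : α < 2) {Q : ℕ → ℝ → ℝ} {m A b C : ℝ}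
    {a : ℕ → ℝ} (hQ : Ker α w M Q m A b C a) : ∃ C' : ℝ, 0 < C' ∧ ∀ᶠ n in atTop, ∀ s : ℝ,
      |Rk α (w n) (M n) (Q n) s| ≤ C' * (|s| ^ (-(1 + 31 / 32 * α)) + |s| ^ (-(4:ℝ))) := by
  obtain ⟨e, he, hev⟩ := hQ.R_asym h hα0
  obtain ⟨C1, hC1, hb⟩ := main_bound hα0 hα2 A b
  refine ⟨C1 + 1, by positivity, ?_⟩
  filter_upwards [hev, he.eventually (gt_mem_nhds (show (0:ℝ) < 1 by norm_num)), h.Mtop.eventually_ge_atTop 1] with n hn h1 hM s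
  by_cases hs : |M n * s| ≤ 1
  · unfold Rk; rw [if_pos hs, abs_zero]; positivity
  · have hs0 : s ≠ 0 := by rintro rfl; simp at hs
    have hr : 0 < |s| := abs_pos.mpr hs0
    have h2 := hn s (not_le.mp hs)
    have h3 := hb s hs0
    have h4 := rpow_mid hr (show 1 + 31 / 32 * α ≤ 1 + 3 * α / 2 by linarith) (show 1 + 3 * α / 2 ≤ 4 by linarith)
    have h5 : e n * |s| ^ (-(1 + 3 * α / 2)) ≤ 1 * |s| ^ (-(1 + 3 * α / 2)) := by gcongr
    have h6 := abs_sub_abs_le_abs_sub (Rk α (w n) (M n) (Q n) s) (|s| ^ (-(1 + α)) * (A - b * Real.log |s|))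
    linarith

theorem rpow_half {r p q : ℝ} (hr : 1 / 2 ≤ r) (hp : 0 ≤ p) (h : p ≤ q) : r ^ (-q) ≤ 2 ^ q * r ^ (-p) := by
  have hr0 : 0 < r := by linarith
  have h1 := Real.rpow_le_rpow_of_exponent_le (show 1 ≤ 2 * r by linarith) (show -q ≤ -p by linarith)
  rw [Real.mul_rpow (by norm_num) hr0.le, Real.mul_rpow (by norm_num) hr0.le] at h1
  have h2 : (2:ℝ) ^ (-p) ≤ 1 := Real.rpow_le_one_of_one_le_of_nonpos (by norm_num) (by linarith)
  have h3 : (2:ℝ) ^ q * 2 ^ (-q) = 1 := by rw [← Real.rpow_add (by norm_num)]; simp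
  have h4 : 0 < r ^ (-p) := by positivity
  have h5 : (2:ℝ) ^ (-q) * r ^ (-q) ≤ r ^ (-p) := h1.trans (mul_le_of_le_one_left h4.le h2)
  calc r ^ (-q) = 2 ^ q * (2 ^ (-q) * r ^ (-q)) := by rw [← mul_assoc, h3, one_mul]
    _ ≤ _ := by gcongr

theorem Ker.R_shift {α d : ℝ} {w M : ℕ → ℝ} (h : Sc α d w M) (hα0 : 0 < α) (hα2 : α < 2) {Q : ℕ → ℝ → ℝ} {m A b C : ℝ}
    {a : ℕ → ℝ} (hQ : Ker α w M Q m A b C a) : ∃ C' : ℝ, 0 < C' ∧ ∀ᶠ n in atTop, ∀ v u : ℝ, 1 / 2 ≤ |v| →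
      |Rk α (w n) (M n) (Q n) (v - u / M n)| ≤ C' * |v| ^ (-(1 + 31 / 32 * α)) * (1 + u ^ 4) := by
  obtain ⟨C1, hC1, hev⟩ := hQ.R_bound h hα0 hα2
  refine ⟨C1 * 1000, by positivity, ?_⟩
  filter_upwards [hev, h.Mtop.eventually_ge_atTop 1] with n hn hM v u hv
  set s := v - u / M n with hs
  have hM0 : 0 < M n := by linarith
  set p := 1 + 31 / 32 * α with hp
  have hp4 : p ≤ 4 := by rw [hp]; linarith
  have hp1 : 1 ≤ p := by rw [hp]; linarith
  have hv0 : 0 < |v| := by linarith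
  have hv4 : |v| ^ (-(4:ℝ)) ≤ 16 * |v| ^ (-p) := by
    have := rpow_half hv (show 0 ≤ p by linarith) hp4
    have e : (2:ℝ) ^ (4:ℝ) = 16 := by norm_num
    rwa [e] at this
  have hvp : 0 < |v| ^ (-p) := by positivity
  rcases le_or_gt (|v| / 2) |s| with hc | hc
  · have h1 : |s| ^ (-p) ≤ 16 * |v| ^ (-p) := by
      calc |s| ^ (-p) ≤ (|v| / 2) ^ (-p) := Real.rpow_le_rpow_of_nonpos (by positivity) hc (by linarith)
        _ = |v| ^ (-p) * 2 ^ p := by rw [Real.div_rpow hv0.le (by norm_num), Real.rpow_neg (by norm_num : (0:ℝ) ≤ 2), div_inv_eq_mul]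
        _ ≤ |v| ^ (-p) * 2 ^ (4:ℝ) := by gcongr; norm_num
        _ = _ := by norm_num; ring
    have h2 : |s| ^ (-(4:ℝ)) ≤ 256 * |v| ^ (-p) := by
      calc |s| ^ (-(4:ℝ)) ≤ (|v| / 2) ^ (-(4:ℝ)) := Real.rpow_le_rpow_of_nonpos (by positivity) hc (by norm_num)
        _ = |v| ^ (-(4:ℝ)) * 2 ^ (4:ℝ) := by rw [Real.div_rpow hv0.le (by norm_num), Real.rpow_neg (by norm_num : (0:ℝ) ≤ 2), div_inv_eq_mul]
        _ ≤ 16 * |v| ^ (-p) * 2 ^ (4:ℝ) := by gcongr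
        _ = _ := by norm_num; ring
    have h3 : 1 ≤ 1 + u ^ 4 := by have : 0 ≤ u ^ 4 := by positivity
                                  linarith
    calc _ ≤ C1 * (|s| ^ (-p) + |s| ^ (-(4:ℝ))) := hn s
      _ ≤ C1 * (16 * |v| ^ (-p) + 256 * |v| ^ (-p)) := by gcongr
      _ ≤ C1 * 1000 * |v| ^ (-p) * 1 := by nlinarith [mul_pos hC1 hvp]
      _ ≤ _ := by gcongr
  · by_cases hs1 : |M n * s| ≤ 1
    · unfold Rk; rw [if_pos hs1, abs_zero]; positivity
    · have hs2 : 1 / M n ≤ |s| := by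
        rw [abs_mul, abs_of_pos hM0, not_le] at hs1
        rw [div_le_iff₀ hM0]; linarith
      have hinv : ∀ q : ℝ, 0 ≤ q → q ≤ 4 → |s| ^ (-q) ≤ M n ^ 4 := by
        intro q hq0 hq
        calc |s| ^ (-q) ≤ (1 / M n) ^ (-q) := Real.rpow_le_rpow_of_nonpos (by positivity) hs2 (by linarith)
          _ = M n ^ q := by rw [one_div, Real.inv_rpow hM0.le, Real.rpow_neg hM0.le, inv_inv]
          _ ≤ M n ^ (4:ℝ) := Real.rpow_le_rpow_of_exponent_le hM hq
          _ = _ := by norm_cast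
      have hu : M n * |v| ≤ 2 * |u| := by
        have : |v| ≤ |s| + |u / M n| := by
          have e : v = s + u / M n := by rw [hs]; ring
          calc |v| = |s + u / M n| := by rw [← e]
            _ ≤ _ := abs_add_le _ _
        rw [abs_div, abs_of_pos hM0] at this
        have h5 : |v| / 2 ≤ |u| / M n := by linarith
        rw [le_div_iff₀ hM0] at h5
        linarith
      have hM4 : M n ^ 4 ≤ 16 * u ^ 4 * |v| ^ (-(4:ℝ)) := by
        have h5 : (M n * |v|) ^ 4 ≤ (2 * |u|) ^ 4 := by gcongr
        have h6 : |v| ^ (-(4:ℝ)) = (|v| ^ 4)⁻¹ := by rw [Real.rpow_neg hv0.le]; norm_cast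
        rw [h6, ← div_eq_mul_inv, le_div_iff₀ (by positivity), ← mul_pow]
        calc _ ≤ _ := h5
          _ = _ := by rw [mul_pow, Even.pow_abs (by decide)]; norm_num
      calc _ ≤ C1 * (|s| ^ (-p) + |s| ^ (-(4:ℝ))) := hn s
        _ ≤ C1 * (M n ^ 4 + M n ^ 4) := by gcongr; exacts [hinv p (by linarith) hp4, hinv 4 (by norm_num) le_rfl]
        _ ≤ C1 * (16 * u ^ 4 * (16 * |v| ^ (-p)) + 16 * u ^ 4 * (16 * |v| ^ (-p))) := by
            have : M n ^ 4 ≤ 16 * u ^ 4 * (16 * |v| ^ (-p)) := hM4.trans (by gcongr)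
            gcongr
        _ = 512 * (C1 * |v| ^ (-p) * u ^ 4) := by ring
        _ ≤ C1 * 1000 * |v| ^ (-p) * (1 + u ^ 4) := by
            have : 0 ≤ C1 * |v| ^ (-p) * u ^ 4 := by positivity
            nlinarith [mul_pos hC1 hvp]

theorem Ker.R_lim {α d : ℝ} {w M : ℕ → ℝ} (h : Sc α d w M) (hα0 : 0 < α) {Q : ℕ → ℝ → ℝ} {m A b C : ℝ}
    {a : ℕ → ℝ} (hQ : Ker α w M Q m A b C a) {v : ℝ} (hv : v ≠ 0) (u : ℝ) :
    Tendsto (fun n => Rk α (w n) (M n) (Q n) (v - u / M n)) atTop (𝓝 (|v| ^ (-(1 + α)) * (A - b * Real.log |v|))) := by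
  obtain ⟨e, he, hev⟩ := hQ.R_asym h hα0
  have hs : Tendsto (fun n => v - u / M n) atTop (𝓝 v) := by
    have := (h.Mtop.inv_tendsto_atTop.const_mul u).const_sub v
    simpa [div_eq_mul_inv] using this
  have hv0 : |v| ≠ 0 := abs_ne_zero.mpr hv
  have hsa := hs.abs
  have h1 : Tendsto (fun n => |v - u / M n| ^ (-(1 + α)) * (A - b * Real.log |v - u / M n|)) atTop
      (𝓝 (|v| ^ (-(1 + α)) * (A - b * Real.log |v|))) :=
    (hsa.rpow_const (Or.inl hv0)).mul (((hsa.log hv0).const_mul b).const_sub A)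
  have h2 : Tendsto (fun n => e n * |v - u / M n| ^ (-(1 + 3 * α / 2))) atTop (𝓝 0) := by
    have := he.mul (hsa.rpow_const (p := -(1 + 3 * α / 2)) (Or.inl hv0))
    simpa using this
  have h3 : Tendsto (fun n => |M n * (v - u / M n)|) atTop atTop := by
    have := h.Mtop.atTop_mul_pos (abs_pos.mpr hv) hsa
    refine this.congr' ?_
    filter_upwards [h.Mtop.eventually_ge_atTop 1] with n hn
    rw [abs_mul, abs_of_pos (show 0 < M n by linarith)]
  refine (tendsto_iff_of_dist ?_).mpr h1
  refine squeeze_zero' (Filter.Eventually.of_forall fun _ => dist_nonneg) ?_ h2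
  filter_upwards [hev, h3.eventually_gt_atTop 1] with n hn h4
  rw [Real.dist_eq]
  exact hn _ h4


theorem integrable_gauss_pow : Integrable (fun u => gauss u * (1 + u ^ 4)) := by
  have h := integrable_rpow_mul_exp_neg_mul_sq (b := 1 / 2) (by norm_num) (s := 4) (by norm_num)
  have h2 := (h.const_mul (Real.sqrt (2 * Real.pi))⁻¹)
  refine (integrable_gauss.add h2).congr (Filter.Eventually.of_forall fun u => ?_)
  simp only [Pi.add_apply, gauss]
  have e : u ^ (4:ℝ) = u ^ 4 := by norm_cast
  rw [e, show -(1 / 2) * u ^ 2 = -(u ^ 2) / 2 by ring]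
  ring

theorem measurable_Rk {α w M : ℝ} {Q : ℝ → ℝ} (hQ : Continuous Q) : Measurable (Rk α w M Q) := by
  unfold Rk
  refine Measurable.ite (measurableSet_le (by fun_prop) measurable_const) measurable_const ?_
  have := hQ.measurable
  fun_prop

section
variable {α d : ℝ} {w M : ℕ → ℝ} {Q : ℕ → ℝ → ℝ} {m A b C : ℝ} {a : ℕ → ℝ}

theorem Ker.out_bound (h : Sc α d w M) (hα0 : 0 < α) (hα2 : α < 2) (hQ : Ker α w M Q m A b C a) :
    ∃ C' : ℝ, 0 < C' ∧ ∀ᶠ n in atTop, ∀ v : ℝ, 1 / 2 ≤ |v| →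
      |M n ^ (1 + α) * w n ^ (-α) * cvOut (Q n) (w n) (M n * v)| ≤ C' * |v| ^ (-(1 + 31 / 32 * α)) := by
  obtain ⟨C1, hC1, hev⟩ := hQ.R_shift h hα0 hα2
  refine ⟨C1 * (∫ u, gauss u * (1 + u ^ 4)) + 1, ?_, ?_⟩
  · have : 0 ≤ ∫ u, gauss u * (1 + u ^ 4) := integral_nonneg fun u => by have := gauss_pos u; positivity
    positivity
  filter_upwards [hev, h.Mtop.eventually_ge_atTop 1, h.wpos] with n hn hM hw v hv
  rw [scal_out hw (by linarith)]
  have hv0 : 0 < |v| := by linarith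
  have hp : 0 < |v| ^ (-(1 + 31 / 32 * α)) := by positivity
  calc _ ≤ ∫ u, C1 * |v| ^ (-(1 + 31 / 32 * α)) * (gauss u * (1 + u ^ 4)) := by
        rw [← Real.norm_eq_abs]
        refine norm_integral_le_of_norm_le (integrable_gauss_pow.const_mul _) (Filter.Eventually.of_forall fun u => ?_)
        rw [norm_mul, Real.norm_of_nonneg (gauss_pos u).le, Real.norm_eq_abs]
        calc _ ≤ gauss u * (C1 * |v| ^ (-(1 + 31 / 32 * α)) * (1 + u ^ 4)) :=
              mul_le_mul_of_nonneg_left (hn v u hv) (gauss_pos u).le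
          _ = _ := by ring
    _ = C1 * (∫ u, gauss u * (1 + u ^ 4)) * |v| ^ (-(1 + 31 / 32 * α)) := by rw [integral_const_mul]; ring
    _ ≤ _ := by gcongr; linarith

theorem Ker.out_lim (h : Sc α d w M) (hα0 : 0 < α) (hα2 : α < 2) (hQ : Ker α w M Q m A b C a)
    {v : ℝ} (hv : 1 / 2 ≤ |v|) :
    Tendsto (fun n => M n ^ (1 + α) * w n ^ (-α) * cvOut (Q n) (w n) (M n * v)) atTop
      (𝓝 (|v| ^ (-(1 + α)) * (A - b * Real.log |v|))) := by
  obtain ⟨C1, hC1, hev⟩ := hQ.R_shift h hα0 hα2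
  have hv0 : v ≠ 0 := by rintro rfl; norm_num at hv
  have key : Tendsto (fun n => ∫ u, gauss u * Rk α (w n) (M n) (Q n) (v - u / M n)) atTop
      (𝓝 (∫ u, gauss u * (|v| ^ (-(1 + α)) * (A - b * Real.log |v|)))) := by
    refine tendsto_integral_filter_of_dominated_convergence
      (fun u => C1 * |v| ^ (-(1 + 31 / 32 * α)) * (gauss u * (1 + u ^ 4))) ?_ ?_ (integrable_gauss_pow.const_mul _) ?_
    · refine Filter.Eventually.of_forall fun n => Measurable.aestronglyMeasurable ?_
      have h1 := measurable_Rk (α := α) (w := w n) (M := M n) (hQ.cont n)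
      exact continuous_gauss.measurable.mul (h1.comp (by fun_prop))
    · filter_upwards [hev] with n hn
      refine Filter.Eventually.of_forall fun u => ?_
      rw [norm_mul, Real.norm_of_nonneg (gauss_pos u).le, Real.norm_eq_abs]
      calc _ ≤ gauss u * (C1 * |v| ^ (-(1 + 31 / 32 * α)) * (1 + u ^ 4)) :=
              mul_le_mul_of_nonneg_left (hn v u hv) (gauss_pos u).le
          _ = _ := by ring
    · exact Filter.Eventually.of_forall fun u => (hQ.R_lim h hα0 hv0 u).const_mul _
  rw [integral_mul_const, integral_gauss, one_mul] at key
  refine key.congr' ?_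
  filter_upwards [h.Mtop.eventually_ge_atTop 1, h.wpos] with n hM hw
  rw [scal_out hw (by linarith)]

theorem exp_neg_le_pow {x : ℝ} (hx : 0 < x) : Real.exp (-x) ≤ 24 / x ^ 4 := by
  have h1 := Real.pow_div_factorial_le_exp x hx.le 4
  have h2 : ((Nat.factorial 4 : ℕ) : ℝ) = 24 := by norm_num [Nat.factorial]
  rw [h2] at h1
  rw [Real.exp_neg, inv_eq_one_div, div_le_div_iff₀ (Real.exp_pos _) (by positivity)]
  linarith

theorem Mpow_le {x : ℝ} (hx : 1 ≤ x) (hα2 : α < 2) : x ^ (1 + α) * (1 + x ^ 2) ≤ 2 * x ^ 5 := by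
  have h1 : x ^ (1 + α) ≤ x ^ 3 := by
    calc x ^ (1 + α) ≤ x ^ (3:ℝ) := Real.rpow_le_rpow_of_exponent_le hx (by linarith)
      _ = _ := by norm_cast
  have h2 : 1 + x ^ 2 ≤ 2 * x ^ 2 := by nlinarith
  calc _ ≤ x ^ 3 * (2 * x ^ 2) := by gcongr
    _ = _ := by ring

theorem Ker.in_bound (h : Sc α d w M) (hα0 : 0 < α) (hα2 : α < 2) (hQ : Ker α w M Q m A b C a) :
    ∃ C' : ℝ, 0 < C' ∧ ∀ᶠ n in atTop, ∀ v : ℝ, 1 / 2 ≤ |v| →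
      M n ^ (1 + α) * w n ^ (-α) * |cvIn (Q n) (w n) (M n * v) - gauss (M n * v) * m|
        ≤ C' * (M n)⁻¹ * |v| ^ (-(1 + 31 / 32 * α)) := by
  obtain ⟨C1, hC1, hb⟩ := cvIn_bound
  have hC := hQ.Cpos
  have hd := h.dpos
  refine ⟨C1 * C * d ^ (-(1 / 32) : ℝ) * 2 * 24 * 16 ^ 4 * 16 * 16, by positivity, ?_⟩
  filter_upwards [hQ.mom, h.Mtop.eventually_ge_atTop 1, h.wpos, h.wpow hα0 (-(1 / 32))] with n hmom hM hw hwp v hv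
  have hM0 : 0 < M n := by linarith
  have hv0 : 0 < |v| := by linarith
  have h1 := hb (Q n) (31 / 32 * α) (w n) (M n * v) (by positivity) (by linarith) hw (hQ.int n) (hQ.even n) (hQ.momint n)
  rw [hQ.mass n] at h1
  have hv2 : 1 / 4 ≤ v ^ 2 := by rw [← sq_abs]; nlinarith
  set p := 1 + 31 / 32 * α with hp
  have e1 : w n ^ (-α) * w n ^ (31 / 32 * α) = d ^ (-(1 / 32) : ℝ) * Real.exp (M n ^ 2 / 64) := by
    rw [← Real.rpow_add hw, show -α + 31 / 32 * α = -(1 / 32) * α by ring, hwp]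
    congr 2; ring
  have e2 : Real.exp (M n ^ 2 / 64) * Real.exp (-((M n * v) ^ 2) / 8) ≤ 24 * 16 ^ 4 / (M n ^ 8 * |v| ^ 8) := by
    have : Real.exp (M n ^ 2 / 64) * Real.exp (-((M n * v) ^ 2) / 8) ≤ Real.exp (-((M n * v) ^ 2 / 16)) := by
      rw [← Real.exp_add, Real.exp_le_exp]
      nlinarith [mul_le_mul_of_nonneg_left hv2 (sq_nonneg (M n))]
    refine this.trans ((exp_neg_le_pow ?_).trans (le_of_eq ?_))
    · rw [mul_pow]; have : 0 < v ^ 2 := by linarith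
      positivity
    · have : (M n * v) ^ 2 = (M n * |v|) ^ 2 := by rw [mul_pow, mul_pow, sq_abs]
      rw [this]; field_simp
  have e3 : (|v| ^ 4)⁻¹ ≤ 16 * |v| ^ (-p) := by
    have := rpow_half hv (show 0 ≤ p by rw [hp]; positivity) (show p ≤ 4 by rw [hp]; linarith)
    have e : (2:ℝ) ^ (4:ℝ) = 16 := by norm_num
    have e' : |v| ^ (-(4:ℝ)) = (|v| ^ 4)⁻¹ := by rw [Real.rpow_neg hv0.le]; norm_cast
    rwa [e, e'] at this
  have e4 : (|v| ^ 4)⁻¹ ≤ 16 := by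
    rw [inv_le_comm₀ (by positivity) (by norm_num)]
    calc (16:ℝ)⁻¹ = (1 / 2) ^ 4 := by norm_num
      _ ≤ _ := by gcongr
  have e5 : M n ^ 5 * (1 / (M n ^ 8 * |v| ^ 8)) ≤ (M n)⁻¹ * (16 * (16 * |v| ^ (-p))) := by
    calc M n ^ 5 * (1 / (M n ^ 8 * |v| ^ 8)) = (M n ^ 3)⁻¹ * ((|v| ^ 4)⁻¹ * (|v| ^ 4)⁻¹) := by field_simp
      _ ≤ (M n ^ 1)⁻¹ * (16 * (16 * |v| ^ (-p))) := by gcongr; norm_num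
      _ = _ := by rw [pow_one]
  have e6 := Mpow_le hM hα2
  have hw' : 0 < w n ^ (-α) := by positivity
  calc _ ≤ M n ^ (1 + α) * w n ^ (-α) * (C1 * (w n ^ (31 / 32 * α) * (C * (1 + M n ^ 2))) * Real.exp (-((M n * v) ^ 2) / 8)) := by
        refine mul_le_mul_of_nonneg_left (h1.trans ?_) (by positivity)
        gcongr
    _ = C1 * C * (w n ^ (-α) * w n ^ (31 / 32 * α)) * (M n ^ (1 + α) * (1 + M n ^ 2)) * Real.exp (-((M n * v) ^ 2) / 8) := by ring
    _ = C1 * C * d ^ (-(1 / 32) : ℝ) * (M n ^ (1 + α) * (1 + M n ^ 2)) * (Real.exp (M n ^ 2 / 64) * Real.exp (-((M n * v) ^ 2) / 8)) := by rw [e1]; ring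
    _ ≤ C1 * C * d ^ (-(1 / 32) : ℝ) * (2 * M n ^ 5) * (24 * 16 ^ 4 / (M n ^ 8 * |v| ^ 8)) := by gcongr
    _ = C1 * C * d ^ (-(1 / 32) : ℝ) * 2 * 24 * 16 ^ 4 * (M n ^ 5 * (1 / (M n ^ 8 * |v| ^ 8))) := by ring
    _ ≤ C1 * C * d ^ (-(1 / 32) : ℝ) * 2 * 24 * 16 ^ 4 * ((M n)⁻¹ * (16 * (16 * |v| ^ (-p)))) := by gcongr
    _ = _ := by ring

/-- rescaled convolution -/
def sc (α w M : ℝ) (K : ℝ → ℝ) (v : ℝ) : ℝ := M ^ (1 + α) * w ^ (-α) * cv gauss K w (M * v)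

theorem Ker.sc_split (hQ : Ker α w M Q m A b C a) (n : ℕ) (v : ℝ) :
    sc α (w n) (M n) (Q n) v = M n ^ (1 + α) * w n ^ (-α) * cvOut (Q n) (w n) (M n * v)
      + M n ^ (1 + α) * w n ^ (-α) * (cvIn (Q n) (w n) (M n * v) - gauss (M n * v) * m)
      + m * (M n ^ (1 + α) * w n ^ (-α) * gauss (M n * v)) := by
  unfold sc
  rw [cv_split (hQ.int n)]; ring

theorem Ker.sc_bound (h : Sc α d w M) (hα0 : 0 < α) (hα2 : α < 2) (hQ : Ker α w M Q 0 A b C a) :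
    ∃ C' : ℝ, 0 < C' ∧ ∀ᶠ n in atTop, ∀ v : ℝ, 1 / 2 ≤ |v| →
      |sc α (w n) (M n) (Q n) v| ≤ C' * |v| ^ (-(1 + 31 / 32 * α)) := by
  obtain ⟨C1, hC1, h1⟩ := hQ.out_bound h hα0 hα2
  obtain ⟨C2, hC2, h2⟩ := hQ.in_bound h hα0 hα2
  refine ⟨C1 + C2, by positivity, ?_⟩
  filter_upwards [h1, h2, h.Mtop.eventually_ge_atTop 1, h.wpos] with n h1 h2 hM hw v hv
  have hv0 : 0 < |v| := by linarith
  have hM0 : 0 < M n := by linarith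
  rw [hQ.sc_split, zero_mul, add_zero]
  refine (abs_add_le _ _).trans ?_
  have h3 := h2 v hv
  rw [← abs_of_pos (show 0 < M n ^ (1 + α) * w n ^ (-α) by positivity), ← abs_mul] at h3
  have h4 : C2 * (M n)⁻¹ * |v| ^ (-(1 + 31 / 32 * α)) ≤ C2 * |v| ^ (-(1 + 31 / 32 * α)) := by
    have : (M n)⁻¹ ≤ 1 := inv_le_one_of_one_le₀ hM
    have : C2 * (M n)⁻¹ ≤ C2 := mul_le_of_le_one_right hC2.le this
    gcongr
  linarith [h1 v hv]

theorem Sc.winv (h : Sc α d w M) (hα0 : 0 < α) : ∀ᶠ n in atTop, w n ^ (-α) = d⁻¹ * Real.exp (M n ^ 2 / 2) := by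
  filter_upwards [h.wpow hα0 (-1)] with n hn
  rw [neg_one_mul] at hn
  rw [hn, Real.rpow_neg_one]; congr 2; ring

theorem Sc.gauss_lim (h : Sc α d w M) (hα0 : 0 < α) (hα2 : α < 2) {v : ℝ} (hv : 1 < |v|) :
    Tendsto (fun n => M n ^ (1 + α) * w n ^ (-α) * gauss (M n * v)) atTop (𝓝 0) := by
  have hv2 : 1 < v ^ 2 := by rw [← sq_abs]; nlinarith
  have h1 := ((tendsto_pow_exp_sq (c := (v ^ 2 - 1) / 2) (by linarith) 5).comp h.Mtop).const_mul (2 * d⁻¹)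
  rw [mul_zero] at h1
  have hd := h.dpos
  refine squeeze_zero' ?_ ?_ h1
  · filter_upwards [h.wpos, h.Mtop.eventually_ge_atTop 1] with n hw hM
    have := gauss_pos (M n * v)
    positivity
  · filter_upwards [h.wpos, h.Mtop.eventually_ge_atTop 1, h.winv hα0] with n hw hM hwi
    simp only [Function.comp]
    have hM0 : 0 < M n := by linarith
    have e1 : M n ^ (1 + α) ≤ 2 * M n ^ 5 := by
      refine le_trans ?_ (Mpow_le hM hα2)
      exact le_mul_of_one_le_right (by positivity) (by nlinarith)
    rw [hwi]
    calc _ ≤ 2 * M n ^ 5 * (d⁻¹ * Real.exp (M n ^ 2 / 2)) * Real.exp (-((M n * v) ^ 2) / 2) := by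
          have := gauss_pos (M n * v)
          gcongr; exact gauss_le_exp _
      _ = 2 * d⁻¹ * (M n ^ 5 * (Real.exp (M n ^ 2 / 2) * Real.exp (-((M n * v) ^ 2) / 2))) := by ring
      _ = _ := by rw [← Real.exp_add]; congr 3; ring_nf

theorem Ker.sc_lim (h : Sc α d w M) (hα0 : 0 < α) (hα2 : α < 2) (hQ : Ker α w M Q m A b C a)
    {v : ℝ} (hv : 1 < |v|) :
    Tendsto (fun n => sc α (w n) (M n) (Q n) v) atTop (𝓝 (|v| ^ (-(1 + α)) * (A - b * Real.log |v|))) := by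
  have h1 := hQ.out_lim h hα0 hα2 (show 1 / 2 ≤ |v| by linarith)
  obtain ⟨C2, hC2, h2⟩ := hQ.in_bound h hα0 hα2
  have h3 : Tendsto (fun n => M n ^ (1 + α) * w n ^ (-α) * (cvIn (Q n) (w n) (M n * v) - gauss (M n * v) * m)) atTop (𝓝 0) := by
    have h4 : Tendsto (fun n => C2 * (M n)⁻¹ * |v| ^ (-(1 + 31 / 32 * α))) atTop (𝓝 0) := by
      have := (h.Mtop.inv_tendsto_atTop.const_mul C2).mul_const (|v| ^ (-(1 + 31 / 32 * α)))
      simpa using this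
    refine squeeze_zero_norm' ?_ h4
    filter_upwards [h2, h.wpos, h.Mtop.eventually_ge_atTop 1] with n hn hw hM
    have hM0 : 0 < M n := by linarith
    rw [norm_mul, Real.norm_of_nonneg (by positivity), Real.norm_eq_abs]
    exact hn v (by linarith)
  have h5 := (h1.add h3).add ((h.gauss_lim hα0 hα2 hv).const_mul m)
  simp only [add_zero, mul_zero] at h5
  exact h5.congr fun n => (hQ.sc_split n v).symm

theorem Ker.sc_small (h : Sc α d w M) (hα0 : 0 < α) (hα2 : α < 2) (hQ : Ker α w M Q 0 A b C a) :
    ∃ C' : ℝ, 0 < C' ∧ ∀ᶠ n in atTop, ∀ v : ℝ,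
      |sc α (w n) (M n) (Q n) v| ≤ C' * (M n ^ 5 * w n ^ (-(1 / 32) * α)) := by
  obtain ⟨C1, hC1, hb⟩ := cvIn_bound
  have hC := hQ.Cpos
  refine ⟨(C1 + 1) * C * 2, by positivity, ?_⟩
  filter_upwards [hQ.mom, h.Mtop.eventually_ge_atTop 1, h.wpos] with n hmom hM hw v
  have hM0 : 0 < M n := by linarith
  have h1 := hb (Q n) (31 / 32 * α) (w n) (M n * v) (by positivity) (by linarith) hw (hQ.int n) (hQ.even n) (hQ.momint n)
  rw [hQ.mass n, mul_zero, sub_zero] at h1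
  have h2 := cvOut_le (show 0 < 31 / 32 * α by positivity) hw (hQ.int n) (hQ.momint n) (M n * v)
  have h3 : Real.exp (-((M n * v) ^ 2) / 8) ≤ 1 := Real.exp_le_one_iff.mpr (by nlinarith [sq_nonneg (M n * v)])
  have hI0 : 0 ≤ ∫ z, |z| ^ (31 / 32 * α) * |Q n z| := integral_nonneg fun z => by positivity
  have h4 : |cv gauss (Q n) (w n) (M n * v)| ≤ (C1 + 1) * (w n ^ (31 / 32 * α) * (C * (1 + M n ^ 2))) := by
    rw [cv_split (hQ.int n)]
    refine (abs_add_le _ _).trans ?_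
    have h5 : C1 * (w n ^ (31 / 32 * α) * ∫ z, |z| ^ (31 / 32 * α) * |Q n z|) * Real.exp (-((M n * v) ^ 2) / 8)
      ≤ C1 * (w n ^ (31 / 32 * α) * ∫ z, |z| ^ (31 / 32 * α) * |Q n z|) * 1 := by gcongr
    have h6 : w n ^ (31 / 32 * α) * (∫ z, |z| ^ (31 / 32 * α) * |Q n z|) ≤ w n ^ (31 / 32 * α) * (C * (1 + M n ^ 2)) := by gcongr
    nlinarith
  unfold sc
  have hpos : 0 < M n ^ (1 + α) * w n ^ (-α) := by positivity
  rw [abs_mul, abs_of_pos hpos]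
  have e1 : w n ^ (-α) * w n ^ (31 / 32 * α) = w n ^ (-(1 / 32) * α) := by
    rw [← Real.rpow_add hw]; congr 1; ring
  calc _ ≤ M n ^ (1 + α) * w n ^ (-α) * ((C1 + 1) * (w n ^ (31 / 32 * α) * (C * (1 + M n ^ 2)))) := by gcongr
    _ = (C1 + 1) * C * (w n ^ (-α) * w n ^ (31 / 32 * α)) * (M n ^ (1 + α) * (1 + M n ^ 2)) := by ring
    _ ≤ (C1 + 1) * C * (w n ^ (-α) * w n ^ (31 / 32 * α)) * (2 * M n ^ 5) := mul_le_mul_of_nonneg_left (Mpow_le hM hα2) (by positivity)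
    _ = _ := by rw [e1]; ring

end

theorem f_lower1 {α : ℝ} (hα0 : 0 < α) (hα2 : α < 2) : ∃ c : ℝ, 0 < c ∧ ∀ w y : ℝ, 0 < w → w ≤ 1 →
    c * gauss y ≤ cv gauss (stableDensity α) w y := by
  have hKi : Integrable (stableDensity α) :=
    (KB_stable hα0 hα2 (β := α / 2) (by linarith) (by linarith)).integrable (by linarith) (continuous_stable hα0)
  have hpos : 0 < ∫ z in Icc (-1:ℝ) 1, stableDensity α z := by
    rw [← integral_indicator measurableSet_Icc]
    rw [integral_pos_iff_support_of_nonneg (fun z => indicator_nonneg (fun z _ => stable_nonneg hα0 hα2 z) z)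
      (hKi.indicator measurableSet_Icc)]
    have hU : IsOpen (Ioo (-1:ℝ) 1 ∩ {z | 0 < stableDensity α z}) :=
      isOpen_Ioo.inter (isOpen_lt continuous_const (continuous_stable hα0))
    refine (hU.measure_pos volume ⟨0, by simp, stable_zero_pos hα0⟩).trans_le (measure_mono ?_)
    intro z hz
    rw [Function.mem_support, indicator_of_mem (Ioo_subset_Icc_self hz.1)]
    exact (ne_of_gt hz.2)
  refine ⟨Real.exp (-1 / 2) * ∫ z in Icc (-1:ℝ) 1, stableDensity α z, by positivity, fun w y hw hw1 => ?_⟩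
  have hI1 := cv_integrand continuous_gauss abs_gauss_le_one hKi w y
  have hI2 : Integrable (fun z => gauss (y + w * z) * stableDensity α z) := by
    simpa using cv_integrand continuous_gauss abs_gauss_le_one hKi (-w) y
  have hsym : ∫ z, gauss (y + w * z) * stableDensity α z = cv gauss (stableDensity α) w y := by
    unfold cv
    rw [← integral_neg_eq_self]
    simp only [mul_neg, ← sub_eq_add_neg, stable_neg]
  have h1 : cv gauss (stableDensity α) w y = ∫ z, ((gauss (y - w * z) + gauss (y + w * z)) / 2) * stableDensity α z := by
    have : ∀ z, ((gauss (y - w * z) + gauss (y + w * z)) / 2) * stableDensity α z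
      = (gauss (y - w * z) * stableDensity α z + gauss (y + w * z) * stableDensity α z) / 2 := fun z => by ring
    simp only [this]
    rw [integral_div, integral_add hI1 hI2, hsym]
    unfold cv; ring
  have hI3 : Integrable (fun z => ((gauss (y - w * z) + gauss (y + w * z)) / 2) * stableDensity α z) := by
    refine ((hI1.add hI2).div_const 2).congr (Filter.Eventually.of_forall fun z => ?_)
    simp only [Pi.add_apply]; ring
  rw [h1]
  calc _ = ∫ z in Icc (-1:ℝ) 1, Real.exp (-1 / 2) * gauss y * stableDensity α z := by
        rw [integral_const_mul]; ring
    _ ≤ ∫ z in Icc (-1:ℝ) 1, ((gauss (y - w * z) + gauss (y + w * z)) / 2) * stableDensity α z := by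
        refine setIntegral_mono_on (hKi.const_mul _).integrableOn hI3.integrableOn measurableSet_Icc fun z hz => ?_
        refine mul_le_mul_of_nonneg_right ?_ (stable_nonneg hα0 hα2 z)
        rw [sym_gauss, mul_comm]
        refine mul_le_mul_of_nonneg_left ?_ (gauss_pos y).le
        have c1 := Real.one_le_cosh (w * z * y)
        have hz1 : |w * z| ≤ 1 := by
          rw [abs_mul, abs_of_pos hw]
          have : |z| ≤ 1 := abs_le.mpr hz
          nlinarith [abs_nonneg z]
        have c2 : Real.exp (-1 / 2) ≤ Real.exp (-((w * z) ^ 2) / 2) := by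
          rw [Real.exp_le_exp]
          have := (sq_le_one_iff_abs_le_one (w * z)).mpr hz1
          linarith
        calc _ ≤ Real.exp (-((w * z) ^ 2) / 2) * 1 := by rw [mul_one]; exact c2
          _ ≤ _ := by gcongr
    _ ≤ _ := setIntegral_le_integral hI3 (Filter.Eventually.of_forall fun z => by
        have := gauss_pos (y - w * z); have := gauss_pos (y + w * z); have := stable_nonneg hα0 hα2 z
        simp only [Pi.zero_apply]; positivity)

theorem f_lower2 {α : ℝ} (hα0 : 0 < α) (hα2 : α < 2) : ∃ c w0 : ℝ, 0 < c ∧ 0 < w0 ∧ ∀ w y : ℝ, 0 < w → w ≤ w0 →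
    2 ≤ |y| → c * (w ^ α * |y| ^ (-(1 + α))) ≤ cv gauss (stableDensity α) w y := by
  have hKi : Integrable (stableDensity α) :=
    (KB_stable hα0 hα2 (β := α / 2) (by linarith) (by linarith)).integrable (by linarith) (continuous_stable hα0)
  obtain ⟨C, hC, has⟩ := stable_asymp hα0 hα2
  have hc := cAlpha_pos hα0 hα2
  -- threshold
  have hth : ∀ᶠ r : ℝ in atTop, C * r ^ (-(α / 2)) ≤ cAlpha α / 2 := by
    have := (tendsto_rpow_neg_atTop (show 0 < α / 2 by linarith)).const_mul C
    rw [mul_zero] at this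
    exact (this.eventually (gt_mem_nhds (show 0 < cAlpha α / 2 by linarith))).mono fun r hr => le_of_lt hr
  obtain ⟨r0, hr0⟩ := eventually_atTop.mp hth
  have hlow : ∀ z : ℝ, max 1 r0 ≤ |z| → cAlpha α / 2 * |z| ^ (-(1 + α)) ≤ stableDensity α z := by
    intro z hz
    have hz1 : 1 ≤ |z| := (le_max_left _ _).trans hz
    have hz0 : 0 < |z| := by linarith
    have h1 := (abs_le.mp (has z hz1)).1
    have h2 := hr0 |z| ((le_max_right _ _).trans hz)
    have h3 : |z| ^ (-(1 + 3 * α / 2)) = |z| ^ (-(α / 2)) * |z| ^ (-(1 + α)) := by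
      rw [← Real.rpow_add hz0]; congr 1; ring
    rw [h3] at h1
    have h4 := mul_le_mul_of_nonneg_right h2 (Real.rpow_nonneg hz0.le (-(1 + α)))
    linarith
  refine ⟨gauss 1 * (cAlpha α / 2) * 2 ^ (-(1 + α)) * 2, 1 / max 1 r0, ?_, by positivity, fun w y hw hw0 hy => ?_⟩
  · have := gauss_pos 1; positivity
  have hI1 := cv_integrand continuous_gauss abs_gauss_le_one hKi w y
  have hy0 : 0 < |y| := by linarith
  set S := Icc ((y - 1) / w) ((y + 1) / w) with hS
  have hvol : volume.real S = 2 / w := by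
    rw [hS, Real.volume_real_Icc_of_le (by gcongr; linarith)]; ring
  have hzS : ∀ z ∈ S, |y - w * z| ≤ 1 := by
    intro z hz
    have h1 := hz.1; have h2 := hz.2
    rw [div_le_iff₀ hw] at h1
    rw [le_div_iff₀ hw] at h2
    rw [abs_le]; constructor <;> linarith
  have hg1 : ∀ u : ℝ, |u| ≤ 1 → gauss 1 ≤ gauss u := by
    intro u hu
    unfold gauss
    have := (sq_le_one_iff_abs_le_one u).mpr hu
    refine mul_le_mul_of_nonneg_left (Real.exp_le_exp.mpr ?_) gauss_const_pos.le
    linarith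
  calc _ = ∫ z in S, gauss 1 * (cAlpha α / 2 * (2 * |y| / w) ^ (-(1 + α))) := by
        rw [setIntegral_const, hvol, smul_eq_mul, Real.div_rpow (by positivity) hw.le, Real.mul_rpow (by norm_num) hy0.le,
          Real.rpow_neg hw.le, div_inv_eq_mul, Real.rpow_add hw, Real.rpow_one]
        field_simp
    _ ≤ ∫ z in S, gauss (y - w * z) * stableDensity α z := by
        refine setIntegral_mono_on (integrableOn_const (by rw [hS]; simp)) hI1.integrableOn measurableSet_Icc fun z hz => ?_
        have hz1 := hzS z hz
        have hwz : |w * z| = w * |z| := by rw [abs_mul, abs_of_pos hw]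
        have h1 : w * |z| ≤ 2 * |y| := by
          have : |w * z| ≤ |y| + |y - w * z| := by
            calc |w * z| = |y - (y - w * z)| := by ring_nf
              _ ≤ _ := abs_sub _ _
          linarith
        have h2 : 1 ≤ w * |z| := by
          have := abs_sub_abs_le_abs_sub y (w * z)
          linarith
        have h3 : max 1 r0 ≤ |z| := by
          have hm : 0 < max 1 r0 := by positivity
          rw [le_div_iff₀ hm] at hw0
          by_contra hcon
          push Not at hcon
          nlinarith
        have hz0 : 0 < |z| := by
          have : 1 ≤ |z| := (le_max_left _ _).trans h3
          linarith
        have h4 : (2 * |y| / w) ^ (-(1 + α)) ≤ |z| ^ (-(1 + α)) :=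
          Real.rpow_le_rpow_of_nonpos hz0 (by rw [le_div_iff₀ hw]; linarith) (by linarith)
        have h5 := hlow z h3
        have := gauss_pos (y - w * z)
        have h6 : cAlpha α / 2 * (2 * |y| / w) ^ (-(1 + α)) ≤ cAlpha α / 2 * |z| ^ (-(1 + α)) := by gcongr
        exact mul_le_mul (hg1 _ hz1) (h6.trans h5) (by positivity) (gauss_pos _).le
    _ ≤ _ := setIntegral_le_integral hI1 (Filter.Eventually.of_forall fun z => by
        have := gauss_pos (y - w * z); have := stable_nonneg hα0 hα2 z
        simp only [Pi.zero_apply]; positivity)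


theorem integrable_stable {α : ℝ} (hα0 : 0 < α) (hα2 : α < 2) : Integrable (stableDensity α) :=
  (KB_stable hα0 hα2 (β := α / 2) (by linarith) (by linarith)).integrable (by linarith) (continuous_stable hα0)

theorem f_pos {α : ℝ} (hα0 : 0 < α) (hα2 : α < 2) (w y : ℝ) : 0 < cv gauss (stableDensity α) w y := by
  unfold cv
  have hnn : ∀ z, 0 ≤ gauss (y - w * z) * stableDensity α z := fun z =>
    mul_nonneg (gauss_pos _).le (stable_nonneg hα0 hα2 z)
  rw [integral_pos_iff_support_of_nonneg hnn
    (cv_integrand continuous_gauss abs_gauss_le_one (integrable_stable hα0 hα2) w y)]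
  have hU : IsOpen {z | 0 < stableDensity α z} := isOpen_lt continuous_const (continuous_stable hα0)
  refine (hU.measure_pos volume ⟨0, stable_zero_pos hα0⟩).trans_le (measure_mono ?_)
  intro z hz
  exact (mul_pos (gauss_pos _) hz).ne'

/-- rescaled integrand of the information -/
def Phi (α w M : ℝ) (K : ℝ → ℝ) (v : ℝ) : ℝ := sc α w M K v ^ 2 / sc α w M (stableDensity α) v

section
variable {α d : ℝ} {w M : ℕ → ℝ} {Q : ℕ → ℝ → ℝ} {A b C : ℝ} {a : ℕ → ℝ}

theorem sc_f_pos (hα0 : 0 < α) (hα2 : α < 2) {w M : ℝ} (hw : 0 < w) (hM : 0 < M) (v : ℝ) :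
    0 < sc α w M (stableDensity α) v := by
  unfold sc
  have := f_pos hα0 hα2 w (M * v)
  positivity

theorem sc_f_low1 (h : Sc α d w M) (hα0 : 0 < α) (hα2 : α < 2) : ∃ c : ℝ, 0 < c ∧ ∀ᶠ n in atTop, ∀ v : ℝ,
    c * Real.exp ((1 - v ^ 2) / 2 * M n ^ 2) ≤ sc α (w n) (M n) (stableDensity α) v := by
  obtain ⟨c, hc, hl⟩ := f_lower1 hα0 hα2
  have hd := h.dpos
  refine ⟨c * d⁻¹ * (Real.sqrt (2 * Real.pi))⁻¹, mul_pos (by positivity) gauss_const_pos, ?_⟩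
  filter_upwards [h.wpos, h.winv hα0, h.Mtop.eventually_ge_atTop 1,
    (h.w_zero hα0).eventually (gt_mem_nhds (show (0:ℝ) < 1 by norm_num))] with n hw hwi hM hw1 v
  have h1 := hl (w n) (M n * v) hw hw1.le
  unfold sc
  have h2 : 1 ≤ M n ^ (1 + α) := Real.one_le_rpow hM (by linarith)
  have h3 := f_pos hα0 hα2 (w n) (M n * v)
  have h4 : 0 < w n ^ (-α) := by positivity
  calc _ = w n ^ (-α) * (c * gauss (M n * v)) := by
        rw [hwi]; unfold gauss
        rw [show (1 - v ^ 2) / 2 * M n ^ 2 = M n ^ 2 / 2 + -((M n * v) ^ 2) / 2 by ring, Real.exp_add]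
        ring
    _ ≤ w n ^ (-α) * cv gauss (stableDensity α) (w n) (M n * v) := by gcongr
    _ ≤ _ := by
      rw [mul_assoc]
      exact le_mul_of_one_le_left (by positivity) h2

theorem sc_f_low2 (h : Sc α d w M) (hα0 : 0 < α) (hα2 : α < 2) : ∃ c : ℝ, 0 < c ∧ ∀ᶠ n in atTop, ∀ v : ℝ, 1 / 2 ≤ |v| →
    c * |v| ^ (-(1 + α)) ≤ sc α (w n) (M n) (stableDensity α) v := by
  obtain ⟨c, w0, hc, hw0, hl⟩ := f_lower2 hα0 hα2
  refine ⟨c, hc, ?_⟩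
  filter_upwards [h.wpos, h.Mtop.eventually_ge_atTop 4, (h.w_zero hα0).eventually (gt_mem_nhds hw0)] with n hw hM hw1 v hv
  have hM0 : 0 < M n := by linarith
  have hv0 : 0 < |v| := by linarith
  have ha : |M n * v| = M n * |v| := by rw [abs_mul, abs_of_pos hM0]
  have h1 := hl (w n) (M n * v) hw hw1.le (by rw [ha]; nlinarith)
  unfold sc
  have h2 : 0 < M n ^ (1 + α) * w n ^ (-α) := by positivity
  refine le_trans (le_of_eq ?_) (mul_le_mul_of_nonneg_left h1 h2.le)
  rw [ha, Real.mul_rpow hM0.le hv0.le, Real.rpow_neg hw.le, Real.rpow_neg hM0.le]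
  field_simp

theorem Phi_nonneg (hα0 : 0 < α) (hα2 : α < 2) {w M : ℝ} (hw : 0 < w) (hM : 0 < M) (K : ℝ → ℝ) (v : ℝ) :
    0 ≤ Phi α w M K v := div_nonneg (sq_nonneg _) (sc_f_pos hα0 hα2 hw hM v).le

theorem Ker.Phi_small (h : Sc α d w M) (hα0 : 0 < α) (hα2 : α < 2) (hQ : Ker α w M Q 0 A b C a) :
    ∃ e : ℕ → ℝ, Tendsto e atTop (𝓝 0) ∧ ∀ᶠ n in atTop, ∀ v : ℝ, |v| ≤ 1 / 2 → Phi α (w n) (M n) (Q n) v ≤ e n := by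
  obtain ⟨C1, hC1, h1⟩ := hQ.sc_small h hα0 hα2
  obtain ⟨c, hc, h2⟩ := sc_f_low1 h hα0 hα2
  have hd := h.dpos
  refine ⟨fun n => C1 ^ 2 * (d ^ (-(1 / 32) : ℝ)) ^ 2 / c * (M n ^ 10 * Real.exp (-(1 / 4 * M n ^ 2))), ?_, ?_⟩
  · have := ((tendsto_pow_exp_sq (c := 1 / 4) (by norm_num) 10).comp h.Mtop).const_mul (C1 ^ 2 * (d ^ (-(1 / 32) : ℝ)) ^ 2 / c)
    simpa using this
  · filter_upwards [h1, h2, h.wpos, h.Mtop.eventually_ge_atTop 1, h.wpow hα0 (-(1 / 32))] with n h1 h2 hw hM hwp v hv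
    have hM0 : 0 < M n := by linarith
    have hv2 : v ^ 2 ≤ 1 / 4 := by rw [← sq_abs]; nlinarith [abs_nonneg v]
    have k1 : sc α (w n) (M n) (Q n) v ^ 2 ≤ (C1 * (M n ^ 5 * w n ^ (-(1 / 32) * α))) ^ 2 := by
      rw [← sq_abs]; gcongr; exact h1 v
    have k2 : c * Real.exp (3 / 8 * M n ^ 2) ≤ sc α (w n) (M n) (stableDensity α) v := by
      refine le_trans ?_ (h2 v)
      refine mul_le_mul_of_nonneg_left (Real.exp_le_exp.mpr (mul_le_mul_of_nonneg_right (by linarith) (sq_nonneg _))) hc.le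
    unfold Phi
    calc _ ≤ (C1 * (M n ^ 5 * w n ^ (-(1 / 32) * α))) ^ 2 / (c * Real.exp (3 / 8 * M n ^ 2)) := by gcongr
      _ = C1 ^ 2 * (d ^ (-(1 / 32) : ℝ)) ^ 2 / c * (M n ^ 10 * (Real.exp (-(M n) ^ 2 / 2 * -(1 / 32)) ^ 2 * (Real.exp (3 / 8 * M n ^ 2))⁻¹)) := by
        rw [hwp]; field_simp
      _ ≤ _ := by
        rw [← Real.exp_neg, ← Real.exp_nat_mul, ← Real.exp_add]
        gcongr
        push_cast
        nlinarith [sq_nonneg (M n)]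

theorem Ker.Phi_large (h : Sc α d w M) (hα0 : 0 < α) (hα2 : α < 2) (hQ : Ker α w M Q 0 A b C a) :
    ∃ C' : ℝ, 0 < C' ∧ ∀ᶠ n in atTop, ∀ v : ℝ, 1 / 2 ≤ |v| →
      Phi α (w n) (M n) (Q n) v ≤ C' * |v| ^ (-(1 + 15 / 16 * α)) := by
  obtain ⟨C1, hC1, h1⟩ := hQ.sc_bound h hα0 hα2
  obtain ⟨c, hc, h2⟩ := sc_f_low2 h hα0 hα2
  refine ⟨C1 ^ 2 / c, by positivity, ?_⟩
  filter_upwards [h1, h2] with n h1 h2 v hv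
  have hv0 : 0 < |v| := by linarith
  have k1 : sc α (w n) (M n) (Q n) v ^ 2 ≤ (C1 * |v| ^ (-(1 + 31 / 32 * α))) ^ 2 := by
    rw [← sq_abs]; gcongr; exact h1 v hv
  unfold Phi
  calc _ ≤ (C1 * |v| ^ (-(1 + 31 / 32 * α))) ^ 2 / (c * |v| ^ (-(1 + α))) := by
        have := h2 v hv
        gcongr
    _ = C1 ^ 2 / c * (|v| ^ (-(1 + 31 / 32 * α)) * |v| ^ (-(1 + 31 / 32 * α)) * |v| ^ (1 + α)) := by
        rw [Real.rpow_neg hv0.le (1 + α)]; field_simp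
    _ = _ := by
        rw [← Real.rpow_add hv0, ← Real.rpow_add hv0]; congr 2; ring

theorem Ker.Phi_bound (h : Sc α d w M) (hα0 : 0 < α) (hα2 : α < 2) (hQ : Ker α w M Q 0 A b C a) :
    ∃ C' : ℝ, 0 < C' ∧ ∀ᶠ n in atTop, ∀ v : ℝ,
      Phi α (w n) (M n) (Q n) v ≤ C' * (1 + |v|) ^ (-(1 + 15 / 16 * α)) := by
  obtain ⟨e, he, h1⟩ := hQ.Phi_small h hα0 hα2
  obtain ⟨C1, hC1, h2⟩ := hQ.Phi_large h hα0 hα2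
  refine ⟨(C1 + 1) * 3 ^ (1 + 15 / 16 * α), by positivity, ?_⟩
  filter_upwards [h1, h2, he.eventually (gt_mem_nhds (show (0:ℝ) < 1 by norm_num))] with n h1 h2 h3 v
  set p := 1 + 15 / 16 * α with hp
  have hp0 : 0 < p := by rw [hp]; positivity
  have e3 : (3:ℝ) ^ p * (1 + |v|) ^ (-p) = ((1 + |v|) / 3) ^ (-p) := by
    rw [Real.div_rpow (by positivity) (by norm_num), Real.rpow_neg (by norm_num : (0:ℝ) ≤ 3), div_inv_eq_mul, mul_comm]
  rw [mul_assoc, e3]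
  rcases le_total (1 / 2) |v| with hv | hv
  · have k : |v| ^ (-p) ≤ ((1 + |v|) / 3) ^ (-p) :=
      Real.rpow_le_rpow_of_nonpos (by positivity) (by linarith) (by linarith)
    calc _ ≤ C1 * |v| ^ (-p) := h2 v hv
      _ ≤ (C1 + 1) * ((1 + |v|) / 3) ^ (-p) := by gcongr; linarith
  · have k : 1 ≤ ((1 + |v|) / 3) ^ (-p) :=
      Real.one_le_rpow_of_pos_of_le_one_of_nonpos (by positivity) (by linarith) (by linarith)
    have := h1 v hv
    nlinarith

/-- limit of the rescaled integrand -/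
def PhiLim (α A b c v : ℝ) : ℝ := if 1 < |v| then |v| ^ (-(1 + α)) * (A - b * Real.log |v|) ^ 2 / c else 0

theorem Ker.Phi_lim (h : Sc α d w M) (hα0 : 0 < α) (hα2 : α < 2) (hQ : Ker α w M Q 0 A b C a)
    {c Cf : ℝ} {af : ℕ → ℝ} (hf : Ker α w M (fun _ => stableDensity α) 1 c 0 Cf af) (hc : 0 < c)
    {v : ℝ} (hv : |v| ≠ 1) : Tendsto (fun n => Phi α (w n) (M n) (Q n) v) atTop (𝓝 (PhiLim α A b c v)) := by
  unfold PhiLim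
  rcases lt_or_gt_of_ne hv with hv | hv
  · rw [if_neg (not_lt.mpr hv.le)]
    rcases le_total |v| (1 / 2) with hv' | hv'
    · obtain ⟨e, he, h1⟩ := hQ.Phi_small h hα0 hα2
      refine squeeze_zero' ?_ ?_ he
      · filter_upwards [h.wpos, h.Mtop.eventually_ge_atTop 1] with n hw hM
        exact Phi_nonneg hα0 hα2 hw (by linarith) _ _
      · filter_upwards [h1] with n h1 using h1 v hv'
    · obtain ⟨C1, hC1, h1⟩ := hQ.sc_bound h hα0 hα2
      obtain ⟨c', hc', h2⟩ := sc_f_low1 h hα0 hα2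
      have hv2 : v ^ 2 < 1 := by rw [← sq_abs]; nlinarith [abs_nonneg v]
      have h3 := ((tendsto_pow_exp_sq (c := (1 - v ^ 2) / 2) (by linarith) 0).comp h.Mtop).const_mul
        ((C1 * |v| ^ (-(1 + 31 / 32 * α))) ^ 2 / c')
      rw [mul_zero] at h3
      refine squeeze_zero' ?_ ?_ h3
      · filter_upwards [h.wpos, h.Mtop.eventually_ge_atTop 1] with n hw hM
        exact Phi_nonneg hα0 hα2 hw (by linarith) _ _
      · filter_upwards [h1, h2] with n h1 h2
        have k1 : sc α (w n) (M n) (Q n) v ^ 2 ≤ (C1 * |v| ^ (-(1 + 31 / 32 * α))) ^ 2 := by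
          rw [← sq_abs]; gcongr; exact h1 v hv'
        have k2 := h2 v
        unfold Phi
        simp only [Function.comp, pow_zero, one_mul]
        calc _ ≤ (C1 * |v| ^ (-(1 + 31 / 32 * α))) ^ 2 / (c' * Real.exp ((1 - v ^ 2) / 2 * M n ^ 2)) := by gcongr
          _ = _ := by rw [Real.exp_neg]; field_simp
  · rw [if_pos hv]
    have hv0 : 0 < |v| := by linarith
    have h1 := hQ.sc_lim h hα0 hα2 hv
    have h2 := hf.sc_lim h hα0 hα2 hv
    have hne : |v| ^ (-(1 + α)) * (c - 0 * Real.log |v|) ≠ 0 := by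
      rw [zero_mul, sub_zero]; positivity
    have h3 := (h1.pow 2).div h2 hne
    have e : |v| ^ (-(1 + α)) * (A - b * Real.log |v|) ^ 2 / c = (|v| ^ (-(1 + α)) * (A - b * Real.log |v|)) ^ 2 /
      (|v| ^ (-(1 + α)) * (c - 0 * Real.log |v|)) := by
      have : |v| ^ (-(1 + α)) ≠ 0 := by positivity
      rw [zero_mul, sub_zero]; field_simp
    rw [e]
    exact h3

theorem continuous_sc {K : ℝ → ℝ} (hK : Integrable K) (w M : ℝ) : Continuous (sc α w M K) := by
  unfold sc
  exact continuous_const.mul ((continuous_cv continuous_gauss abs_gauss_le_one hK w).comp (by fun_prop))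

theorem continuous_Phi (hα0 : 0 < α) (hα2 : α < 2) {w M : ℝ} (hw : 0 < w) (hM : 0 < M) {K : ℝ → ℝ} (hK : Integrable K) :
    Continuous (Phi α w M K) :=
  ((continuous_sc hK w M).pow 2).div (continuous_sc (integrable_stable hα0 hα2) w M)
    fun v => (sc_f_pos hα0 hα2 hw hM v).ne'

theorem integrable_one_add_rpow {p : ℝ} (hp : 0 < p) : Integrable (fun v : ℝ => (1 + |v|) ^ (-(1 + p))) := by
  have := integrable_one_add_norm (E := ℝ) (μ := volume) (r := 1 + p) (by simp; linarith)
  simpa using this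

theorem ae_abs_ne_one : ∀ᵐ v : ℝ, |v| ≠ 1 := by
  have : ({1, -1} : Set ℝ)ᶜ ∈ ae (volume : Measure ℝ) := by
    rw [compl_mem_ae_iff]
    exact (Set.toFinite _).measure_zero _
  filter_upwards [this] with v hv hv1
  rcases eq_or_eq_neg_of_abs_eq hv1 with h | h <;> simp [h] at hv

theorem Ker.Phi_dct (h : Sc α d w M) (hα0 : 0 < α) (hα2 : α < 2) (hQ : Ker α w M Q 0 A b C a)
    (S : ℕ → Set ℝ) (hS : ∀ᶠ n in atTop, MeasurableSet (S n)) (L : ℝ → ℝ)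
    (hL : ∀ v : ℝ, |v| ≠ 1 → Tendsto (fun n => (S n).indicator (Phi α (w n) (M n) (Q n)) v) atTop (𝓝 (L v))) :
    Tendsto (fun n => ∫ v, (S n).indicator (Phi α (w n) (M n) (Q n)) v) atTop (𝓝 (∫ v, L v)) := by
  obtain ⟨C', hC', hb⟩ := hQ.Phi_bound h hα0 hα2
  refine tendsto_integral_filter_of_dominated_convergence (fun v => C' * (1 + |v|) ^ (-(1 + 15 / 16 * α))) ?_ ?_
    ((integrable_one_add_rpow (by positivity)).const_mul _) ?_
  · filter_upwards [h.wpos, h.Mtop.eventually_ge_atTop 1, hS] with n hw hM hS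
    exact (continuous_Phi hα0 hα2 hw (by linarith) (hQ.int n)).aestronglyMeasurable.indicator hS
  · filter_upwards [h.wpos, h.Mtop.eventually_ge_atTop 1, hb] with n hw hM hb
    refine Filter.Eventually.of_forall fun v => ?_
    refine (norm_indicator_le_norm_self _ _).trans ?_
    rw [Real.norm_of_nonneg (Phi_nonneg hα0 hα2 hw (by linarith) _ _)]
    exact hb v
  · filter_upwards [ae_abs_ne_one] with v hv using hL v hv

theorem Ker.Phi_integrable (h : Sc α d w M) (hα0 : 0 < α) (hα2 : α < 2) (hQ : Ker α w M Q 0 A b C a) :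
    ∀ᶠ n in atTop, Integrable (Phi α (w n) (M n) (Q n)) := by
  obtain ⟨C', hC', hb⟩ := hQ.Phi_bound h hα0 hα2
  filter_upwards [h.wpos, h.Mtop.eventually_ge_atTop 1, hb] with n hw hM hb
  refine ((integrable_one_add_rpow (p := 15 / 16 * α) (by positivity)).const_mul C').mono'
    (continuous_Phi hα0 hα2 hw (by linarith) (hQ.int n)).aestronglyMeasurable (Filter.Eventually.of_forall fun v => ?_)
  rw [Real.norm_of_nonneg (Phi_nonneg hα0 hα2 hw (by linarith) _ _)]
  exact hb v

end

theorem integral_PhiLim {α : ℝ} (hα0 : 0 < α) (A b c : ℝ) :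
    ∫ v, PhiLim α A b c v = 2 / (α * c) * ((A - b / α) ^ 2 + (b / α) ^ 2) := by
  have h1 : ∫ v, PhiLim α A b c v = 2 * ∫ x in Ioi (0:ℝ), (Ioi (1:ℝ)).indicator (fun x => x ^ (-(1 + α)) * (A - b * Real.log x) ^ 2 / c) x := by
    rw [← integral_comp_abs (f := (Ioi (1:ℝ)).indicator (fun x => x ^ (-(1 + α)) * (A - b * Real.log x) ^ 2 / c))]
    rfl
  rw [h1, setIntegral_indicator measurableSet_Ioi, Ioi_inter_Ioi, show max (0:ℝ) 1 = 1 by norm_num, integral_div]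
  set G : ℝ → ℝ := fun x => -(x ^ (-α) / α) * ((A - b * Real.log x) ^ 2 - 2 * b / α * (A - b * Real.log x) + 2 * b ^ 2 / α ^ 2) with hG
  have hd : ∀ x ∈ Ici (1:ℝ), HasDerivAt G (x ^ (-(1 + α)) * (A - b * Real.log x) ^ 2) x := by
    intro x hx
    have hx0 : (0:ℝ) < x := lt_of_lt_of_le one_pos hx
    have d1 : HasDerivAt (fun x : ℝ => x ^ (-α)) (-α * x ^ (-α - 1)) x := Real.hasDerivAt_rpow_const (Or.inl hx0.ne')
    have d2 : HasDerivAt (fun x : ℝ => A - b * Real.log x) (-(b * x⁻¹)) x := ((Real.hasDerivAt_log hx0.ne').const_mul b).const_sub A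
    have d3 := ((d1.div_const α).neg).mul (((d2.pow 2).sub (d2.const_mul (2 * b / α))).add_const (2 * b ^ 2 / α ^ 2))
    refine d3.congr_deriv ?_
    have e1 : x ^ (-α) = x * x ^ (-(1 + α)) := by
      rw [show -(1 + α) = -α - 1 by ring, Real.rpow_sub_one hx0.ne']; field_simp
    have e2 : x ^ (-α - 1) = x ^ (-(1 + α)) := by congr 1; ring
    simp only [Pi.pow_apply, Pi.sub_apply, Pi.mul_apply, Pi.neg_apply, Nat.cast_ofNat]
    rw [e1, e2]
    field_simp
    ring
  have hlim : Tendsto G atTop (𝓝 0) := by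
    have k : ∀ j : ℕ, Tendsto (fun x : ℝ => Real.log x ^ j * x ^ (-α)) atTop (𝓝 0) := by
      intro j
      have := (isLittleO_log_rpow_rpow_atTop (j : ℝ) hα0).tendsto_div_nhds_zero
      refine this.congr' ?_
      filter_upwards [eventually_gt_atTop 0] with x hx
      rw [Real.rpow_natCast, Real.rpow_neg hx.le]; rfl
    have k0 := (k 0).const_mul (-(A ^ 2 - 2 * b / α * A + 2 * b ^ 2 / α ^ 2) / α)
    have k1 := (k 1).const_mul (-(-2 * A * b + 2 * b / α * b) / α)
    have k2 := (k 2).const_mul (-(b ^ 2) / α)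
    have := (k0.add k1).add k2
    simp only [mul_zero, add_zero] at this
    refine this.congr fun x => ?_
    rw [hG]
    ring
  have hintg : IntegrableOn (fun x : ℝ => x ^ (-(1 + α)) * (A - b * Real.log x) ^ 2) (Ioi 1) := by
    refine integrableOn_Ioi_deriv_of_nonneg (g := G) ?_ (fun x hx => hd x (mem_Ici.mpr (le_of_lt hx))) ?_ hlim
    · exact (hd 1 (by simp)).continuousAt.continuousWithinAt
    · intro x hx
      have hx0 : (0:ℝ) < x := lt_trans one_pos hx
      positivity
  rw [integral_Ioi_of_hasDerivAt_of_tendsto' hd hintg hlim, hG]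
  simp only [Real.one_rpow, Real.log_one]
  by_cases hc : c = 0
  · subst hc; simp
  · field_simp; ring


theorem KB.mom {β p : ℝ} {K : ℝ → ℝ} (hp0 : 0 ≤ p) (hp : p < β) (h : KB β K) (hc : Continuous K) :
    Integrable fun z => |z| ^ p * |K z| := by
  obtain ⟨C, hC, hb⟩ := h
  refine ((integrable_one_add_rpow (p := β - p) (by linarith)).const_mul C).mono'
    (((continuous_abs.rpow_const fun _ => Or.inr hp0).mul hc.abs).aestronglyMeasurable)
    (Filter.Eventually.of_forall fun z => ?_)
  rw [Real.norm_of_nonneg (by positivity)]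
  have h1 : (0:ℝ) < 1 + |z| := by positivity
  calc |z| ^ p * |K z| ≤ (1 + |z|) ^ p * (C * (1 + |z|) ^ (-(1 + β))) := by
        refine mul_le_mul (Real.rpow_le_rpow (abs_nonneg _) (by linarith) hp0) (hb z) (abs_nonneg _) (by positivity)
    _ = C * ((1 + |z|) ^ p * (1 + |z|) ^ (-(1 + β))) := by ring
    _ = _ := by rw [← Real.rpow_add h1]; ring_nf

theorem log_nat_tendsto : Tendsto (fun n : ℕ => Real.log n) atTop atTop :=
  Real.tendsto_log_atTop.comp tendsto_natCast_atTop_atTop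

theorem Mn_sq {α : ℝ} (hα2 : α < 2) (n : ℕ) : Mn n α ^ 2 = (2 - α) * Real.log n := by
  unfold Mn
  exact Real.sq_sqrt (mul_nonneg (by linarith) (Real.log_natCast_nonneg n))

theorem wn_pos {σ δ α : ℝ} (hσ : 0 < σ) (hδ : 0 < δ) {n : ℕ} (hn : 0 < n) : 0 < wn n σ δ α := by
  unfold wn; positivity

theorem log_wn {σ δ α : ℝ} (hσ : 0 < σ) (hδ : 0 < δ) {n : ℕ} (hn : 0 < n) :
    Real.log (wn n σ δ α) = (1 / 2 - 1 / α) * Real.log n + Real.log (δ / σ) := by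
  unfold wn
  have : (0:ℝ) < n := by exact_mod_cast hn
  rw [mul_div_assoc, Real.log_mul (by positivity) (by positivity), Real.log_rpow this]

theorem Sc_main {σ δ α : ℝ} (hσ : 0 < σ) (hδ : 0 < δ) (hα0 : 0 < α) (hα2 : α < 2) :
    Sc α ((δ / σ) ^ α) (fun n => wn n σ δ α) (fun n => Mn n α) where
  dpos := by positivity
  wpos := by filter_upwards [eventually_gt_atTop 0] with n hn using wn_pos hσ hδ hn
  Mtop := by
    unfold Mn
    exact Real.tendsto_sqrt_atTop.comp (log_nat_tendsto.const_mul_atTop (by linarith))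
  rel := by
    filter_upwards [eventually_gt_atTop 0] with n hn
    have hw := wn_pos (α := α) hσ hδ hn
    rw [Real.rpow_def_of_pos hw, log_wn hσ hδ hn, Real.rpow_def_of_pos (by positivity), ← Real.exp_add,
      neg_div, Mn_sq hα2]
    congr 1
    field_simp
    ring

theorem Ker_stable {σ δ α : ℝ} (hα0 : 0 < α) (hα2 : α < 2) :
    ∃ C : ℝ, Ker α (fun n => wn n σ δ α) (fun n => Mn n α) (fun _ => stableDensity α) 1 (cAlpha α) 0 C (fun _ => cAlpha α) := by
  obtain ⟨C1, hC1, h1⟩ := stable_asymp hα0 hα2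
  have hm := (KB_stable hα0 hα2 (β := 63 / 64 * α) (by linarith) (by linarith)).mom (p := 31 / 32 * α) (by linarith)
    (by linarith) (continuous_stable hα0)
  have hm0 : 0 ≤ ∫ z, |z| ^ (31 / 32 * α) * |stableDensity α z| := integral_nonneg fun z => by positivity
  refine ⟨C1 + ∫ z, |z| ^ (31 / 32 * α) * |stableDensity α z|, by positivity, fun _ => continuous_stable hα0,
    fun _ => stable_neg α, fun _ => integrable_stable hα0 hα2, fun _ => integral_stable hα0 hα2, fun _ => hm, ?_, ?_, ?_⟩
  · refine Filter.Eventually.of_forall fun n => ?_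
    nlinarith [sq_nonneg (Mn n α), mul_nonneg hm0 (sq_nonneg (Mn n α)), mul_nonneg hC1.le (sq_nonneg (Mn n α))]
  · refine Filter.Eventually.of_forall fun n z hz => ?_
    have := h1 z hz
    rw [zero_mul, sub_zero, mul_comm (|z| ^ _)]
    refine this.trans (mul_le_mul_of_nonneg_right ?_ (by positivity))
    nlinarith [sq_nonneg (Mn n α), mul_nonneg hm0 (sq_nonneg (Mn n α)), mul_nonneg hC1.le (sq_nonneg (Mn n α))]
  · exact Filter.Eventually.of_forall fun n => by ring

def An (n : ℕ) (α : ℝ) : ℝ := (Real.log n - Real.log (Real.log n)) / (2 * α) - Real.log n / α ^ 2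

def Qn (δ α t2 t3 : ℝ) (n : ℕ) (z : ℝ) : ℝ :=
  (-(t2 / δ) + t3 * An n α) * Dop (stableDensity α) z + t3 * stableDensityDalpha α z

theorem An_bound {α : ℝ} (hα0 : 0 < α) : ∀ᶠ n : ℕ in atTop, |An n α| ≤ (1 / (2 * α) + 1 / α ^ 2) * Real.log n := by
  filter_upwards [log_nat_tendsto.eventually_ge_atTop 1] with n hn
  have h1 := Real.log_nonneg hn
  have h2 := Real.log_le_sub_one_of_pos (show 0 < Real.log n by linarith)
  unfold An
  refine (abs_sub _ _).trans ?_
  rw [add_mul, abs_div, abs_div, abs_of_pos (show 0 < 2 * α by linarith), abs_of_pos (show 0 < α ^ 2 by positivity),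
    abs_of_nonneg (show 0 ≤ Real.log n by linarith), abs_of_nonneg (show 0 ≤ Real.log n - Real.log (Real.log n) by linarith),
    div_mul_eq_mul_div, div_mul_eq_mul_div, one_mul]
  gcongr
  linarith

theorem Ker_Q {σ δ α : ℝ} (hσ : 0 < σ) (hδ : 0 < δ) (hα0 : 0 < α) (hα2 : α < 2) (t2 t3 : ℝ) :
    ∃ (C : ℝ) (a : ℕ → ℝ), Ker α (fun n => wn n σ δ α) (fun n => Mn n α) (Qn δ α t2 t3) 0
      (cAlpha α * (α * t2 / δ + t3 * (kappa1 σ δ α + 1 / α))) (t3 * cAlpha α) C a := by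
  obtain ⟨C1, hC1, h1⟩ := Dstable_asymp hα0 hα2
  obtain ⟨C2, hC2, h2⟩ := dalpha_asymp hα0 hα2
  have kb1 := KB_Dstable hα0 hα2 (β := 63 / 64 * α) (by linarith) (by linarith)
  have kb2 := KB_dalpha hα0 hα2 (β := 63 / 64 * α) (by linarith) (by linarith)
  have c1 := continuous_Dstable hα0
  have c2 := continuous_dalpha hα0
  have hm1 := kb1.mom (p := 31 / 32 * α) (by linarith) (by linarith) c1
  have hm2 := kb2.mom (p := 31 / 32 * α) (by linarith) (by linarith) c2
  have i1 := kb1.integrable (by linarith) c1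
  have i2 := kb2.integrable (by linarith) c2
  set m1 := ∫ z, |z| ^ (31 / 32 * α) * |Dop (stableDensity α) z| with hm1d
  set m2 := ∫ z, |z| ^ (31 / 32 * α) * |stableDensityDalpha α z| with hm2d
  have m10 : 0 ≤ m1 := integral_nonneg fun z => by positivity
  have m20 : 0 ≤ m2 := integral_nonneg fun z => by positivity
  have hcp := cAlpha_pos hα0 hα2
  set B : ℝ := |t2 / δ| + |t3| * ((1 / (2 * α) + 1 / α ^ 2) / (2 - α)) with hB
  have h2α : 0 < 2 - α := by linarith
  have B0 : 0 ≤ B := by positivity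
  have hs : ∀ᶠ n : ℕ in atTop, |-(t2 / δ) + t3 * An n α| ≤ B * (1 + Mn n α ^ 2) := by
    filter_upwards [An_bound hα0] with n hn
    have hL : Real.log n = Mn n α ^ 2 / (2 - α) := by rw [Mn_sq hα2]; field_simp
    refine (abs_add_le _ _).trans ?_
    rw [abs_neg, abs_mul]
    rw [hL] at hn
    have e1 : |t3| * |An n α| ≤ |t3| * ((1 / (2 * α) + 1 / α ^ 2) / (2 - α)) * Mn n α ^ 2 := by
      refine (mul_le_mul_of_nonneg_left hn (abs_nonneg _)).trans (le_of_eq (by ring))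
    have e2 : 0 ≤ |t2 / δ| * Mn n α ^ 2 := by positivity
    have e3 : 0 ≤ |t3| * ((1 / (2 * α) + 1 / α ^ 2) / (2 - α)) := by positivity
    rw [hB]
    nlinarith
  set X : ℝ := (B * C1 + |t3| * C2) + (B * m1 + |t3| * m2) + 1 with hX
  have hQint : ∀ n, Integrable fun z => |z| ^ (31 / 32 * α) * |Qn δ α t2 t3 n z| := by
    intro n
    refine ((hm1.const_mul |-(t2 / δ) + t3 * An n α|).add (hm2.const_mul |t3|)).mono'
      (((continuous_abs.rpow_const fun _ => Or.inr (by linarith)).mul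
        (((c1.const_mul _).add (c2.const_mul _)).abs)).aestronglyMeasurable)
      (Filter.Eventually.of_forall fun z => ?_)
    rw [Real.norm_of_nonneg (by positivity)]
    simp only [Pi.add_apply]
    have := abs_add_le ((-(t2 / δ) + t3 * An n α) * Dop (stableDensity α) z) (t3 * stableDensityDalpha α z)
    rw [abs_mul, abs_mul] at this
    exact (mul_le_mul_of_nonneg_left this (by positivity)).trans (le_of_eq (by ring))
  refine ⟨X, fun n => -(α * cAlpha α) * (-(t2 / δ) + t3 * An n α) + t3 * deriv cAlpha α, by positivity,
    fun n => (c1.const_mul _).add (c2.const_mul _), fun n z => ?_, fun n => (i1.const_mul _).add (i2.const_mul _),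
    fun n => ?_, hQint, ?_, ?_, ?_⟩
  · unfold Qn; rw [Dstable_neg hα0, dalpha_neg]
  · unfold Qn
    rw [integral_add (i1.const_mul _) (i2.const_mul _), integral_const_mul, integral_const_mul, integral_Dstable hα0 hα2,
      integral_dalpha hα0 hα2]; simp
  · filter_upwards [hs] with n hn
    calc ∫ z, |z| ^ (31 / 32 * α) * |Qn δ α t2 t3 n z|
        ≤ ∫ z, (|-(t2 / δ) + t3 * An n α| * (|z| ^ (31 / 32 * α) * |Dop (stableDensity α) z|)
            + |t3| * (|z| ^ (31 / 32 * α) * |stableDensityDalpha α z|)) := by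
          refine integral_mono (hQint n) ((hm1.const_mul _).add (hm2.const_mul _)) fun z => ?_
          have := abs_add_le ((-(t2 / δ) + t3 * An n α) * Dop (stableDensity α) z) (t3 * stableDensityDalpha α z)
          rw [abs_mul, abs_mul] at this
          exact (mul_le_mul_of_nonneg_left this (by positivity)).trans (le_of_eq (by ring))
      _ = |-(t2 / δ) + t3 * An n α| * m1 + |t3| * m2 := by
          rw [integral_add (hm1.const_mul _) (hm2.const_mul _), integral_const_mul, integral_const_mul]
      _ ≤ (B * (1 + Mn n α ^ 2)) * m1 + |t3| * m2 * (1 + Mn n α ^ 2) := by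
          refine add_le_add (mul_le_mul_of_nonneg_right hn m10) (le_mul_of_one_le_right (by positivity) ?_)
          nlinarith [sq_nonneg (Mn n α)]
      _ = (B * m1 + |t3| * m2) * (1 + Mn n α ^ 2) := by ring
      _ ≤ _ := by
          refine mul_le_mul_of_nonneg_right ?_ (by positivity)
          rw [hX]
          have : 0 ≤ B * C1 + |t3| * C2 := by positivity
          linarith
  · filter_upwards [hs] with n hn z hz
    have k1 := h1 z hz
    have k2 := h2 z hz
    set P := |z| ^ (-(1 + 3 * α / 2)) with hP
    have hP0 : 0 ≤ P := by positivity
    have e : Qn δ α t2 t3 n z - |z| ^ (-(1 + α)) * (-(α * cAlpha α) * (-(t2 / δ) + t3 * An n α) + t3 * deriv cAlpha α - t3 * cAlpha α * Real.log |z|)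
      = (-(t2 / δ) + t3 * An n α) * (Dop (stableDensity α) z - (-(α * cAlpha α)) * |z| ^ (-(1 + α)))
        + t3 * (stableDensityDalpha α z - (deriv cAlpha α - cAlpha α * Real.log |z|) * |z| ^ (-(1 + α))) := by
      unfold Qn; ring
    rw [e]
    refine (abs_add_le _ _).trans ?_
    rw [abs_mul, abs_mul]
    calc _ ≤ (B * (1 + Mn n α ^ 2)) * (C1 * P) + |t3| * (C2 * P) * (1 + Mn n α ^ 2) := by
          refine add_le_add (mul_le_mul hn k1 (abs_nonneg _) (by positivity)) ?_
          refine (mul_le_mul_of_nonneg_left k2 (abs_nonneg _)).trans (le_mul_of_one_le_right (by positivity) ?_)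
          nlinarith [sq_nonneg (Mn n α)]
      _ = (B * C1 + |t3| * C2) * ((1 + Mn n α ^ 2) * P) := by ring
      _ ≤ X * ((1 + Mn n α ^ 2) * P) := by
          refine mul_le_mul_of_nonneg_right ?_ (by positivity)
          rw [hX]
          have : 0 ≤ B * m1 + |t3| * m2 := by positivity
          linarith
      _ = _ := by ring
  · filter_upwards [log_nat_tendsto.eventually_ge_atTop 1, eventually_gt_atTop 0] with n hn hn0
    have hL : 0 < Real.log n := by linarith
    have hM : Real.log (Mn n α) = (Real.log (2 - α) + Real.log (Real.log n)) / 2 := by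
      unfold Mn
      rw [Real.log_sqrt (by positivity), Real.log_mul (by positivity) (by positivity)]
    rw [log_wn hσ hδ hn0, hM]
    unfold An kappa1
    field_simp
    ring


theorem Phi_scale {α w M : ℝ} (hw : 0 < w) (hM : 0 < M) (K : ℝ → ℝ) (v : ℝ) :
    Phi α w M K v = M ^ (1 + α) * w ^ (-α) * (cv gauss K w (M * v) ^ 2 / cv gauss (stableDensity α) w (M * v)) := by
  unfold Phi sc
  have : M ^ (1 + α) * w ^ (-α) ≠ 0 := by positivity
  field_simp

theorem Phi_int_scale {α w M : ℝ} (hw : 0 < w) (hM : 0 < M) (K : ℝ → ℝ) (S : Set ℝ) :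
    ∫ y, S.indicator (fun y => cv gauss K w y ^ 2 / cv gauss (stableDensity α) w y) y
      = M ^ (-α) * w ^ α * ∫ v, ((fun v => M * v) ⁻¹' S).indicator (Phi α w M K) v := by
  set F := S.indicator (fun y => cv gauss K w y ^ 2 / cv gauss (stableDensity α) w y) with hF
  have h1 : ∀ v, ((fun v => M * v) ⁻¹' S).indicator (Phi α w M K) v = M ^ (1 + α) * w ^ (-α) * F (M * v) := by
    intro v
    by_cases hv : M * v ∈ S
    · rw [indicator_of_mem (show v ∈ (fun v => M * v) ⁻¹' S from hv), hF, indicator_of_mem hv, Phi_scale hw hM]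
    · rw [indicator_of_notMem (show v ∉ (fun v => M * v) ⁻¹' S from hv), hF, indicator_of_notMem hv, mul_zero]
  simp_rw [h1]
  rw [integral_const_mul, Measure.integral_comp_mul_left, abs_of_pos (inv_pos.mpr hM), smul_eq_mul,
    Real.rpow_neg hM.le, Real.rpow_neg hw.le, Real.rpow_add hM, Real.rpow_one]
  field_simp

theorem rate_scale {σ δ α : ℝ} (hσ : 0 < σ) (hδ : 0 < δ) (hα0 : 0 < α) (hα2 : α < 2) {n : ℕ} (hn : 2 ≤ n) :
    n * rate n α ^ 2 * (Mn n α ^ (-α) * wn n σ δ α ^ α) = (δ / σ) ^ α * (2 - α) ^ (-(α / 2)) := by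
  have hn0 : (0:ℝ) < n := by exact_mod_cast (by omega : 0 < n)
  have hL : 0 < Real.log n := Real.log_pos (by exact_mod_cast (by omega : 1 < n))
  have h2 : 0 < 2 - α := by linarith
  have hw := wn_pos (α := α) hσ hδ (show 0 < n by omega)
  have hM : 0 < Mn n α := by unfold Mn; positivity
  have hlM : Real.log (Mn n α) = (Real.log (2 - α) + Real.log (Real.log n)) / 2 := by
    unfold Mn
    rw [Real.log_sqrt (by positivity), Real.log_mul (by positivity) (by positivity)]
  have hr : rate n α = Real.exp (α / 4 * (Real.log (Real.log n) - Real.log n)) := by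
    unfold rate
    rw [Real.rpow_def_of_pos hL, Real.rpow_def_of_pos hn0, ← Real.exp_sub]; ring_nf
  rw [hr, Real.rpow_def_of_pos hM, Real.rpow_def_of_pos hw, log_wn hσ hδ (by omega), hlM, ← Real.exp_nat_mul]
  nth_rw 1 [← Real.exp_log hn0]
  rw [Real.rpow_def_of_pos (show 0 < δ / σ by positivity), Real.rpow_def_of_pos h2, ← Real.exp_add, ← Real.exp_add,
    ← Real.exp_add, ← Real.exp_add]
  congr 1
  push_cast
  field_simp
  ring

theorem rate_zero {α : ℝ} (hα0 : 0 < α) : Tendsto (fun n : ℕ => rate n α) atTop (𝓝 0) := by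
  have h1 : Tendsto (fun n : ℕ => (Real.log n / n) ^ (α / 4)) atTop (𝓝 ((0:ℝ) ^ (α / 4))) := by
    have : Tendsto (fun x : ℝ => Real.log x / x) atTop (𝓝 0) := by
      simpa using (Real.isLittleO_log_id_atTop.tendsto_div_nhds_zero)
    exact (this.comp tendsto_natCast_atTop_atTop).rpow_const (Or.inr (by positivity))
  rw [Real.zero_rpow (by positivity)] at h1
  refine h1.congr fun n => ?_
  unfold rate
  rw [Real.div_rpow (Real.log_natCast_nonneg n) (Nat.cast_nonneg n)]

theorem rate_nonneg (n : ℕ) (α : ℝ) : 0 ≤ rate n α := by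
  unfold rate
  have := Real.log_natCast_nonneg n
  positivity

def fn (σ δ α : ℝ) (n : ℕ) : ℝ → ℝ := cv gauss (stableDensity α) (wn n σ δ α)
def qn (σ δ α t2 t3 : ℝ) (n : ℕ) : ℝ → ℝ := cv gauss (Qn δ α t2 t3 n) (wn n σ δ α)

section
variable {σ δ α : ℝ}


theorem q_gen (hσ : 0 < σ) (hδ : 0 < δ) (hα0 : 0 < α) (hα2 : α < 2) (t2 t3 : ℝ) (S : ℕ → Set ℝ) (hS : ∀ n, MeasurableSet (S n)) (L : ℝ → ℝ)
    (hL : ∀ v : ℝ, |v| ≠ 1 → Tendsto (fun n => ((fun v => Mn n α * v) ⁻¹' S n).indicator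
      (Phi α (wn n σ δ α) (Mn n α) (Qn δ α t2 t3 n)) v) atTop (𝓝 (L v))) :
    Tendsto (fun n : ℕ => n * rate n α ^ 2 * ∫ y, (S n).indicator (fun y => qn σ δ α t2 t3 n y ^ 2 / fn σ δ α n y) y)
      atTop (𝓝 ((δ / σ) ^ α * (2 - α) ^ (-(α / 2)) * ∫ v, L v)) := by
  obtain ⟨C, a, hQ⟩ := Ker_Q hσ hδ hα0 hα2 t2 t3
  have hSc := Sc_main hσ hδ hα0 hα2
  have h1 := hQ.Phi_dct hSc hα0 hα2 (fun n => (fun v => Mn n α * v) ⁻¹' S n)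
    (Filter.Eventually.of_forall fun n => (hS n).preimage (by fun_prop)) L hL
  refine (h1.const_mul ((δ / σ) ^ α * (2 - α) ^ (-(α / 2)))).congr' ?_
  filter_upwards [hSc.wpos, hSc.Mtop.eventually_gt_atTop 0, eventually_ge_atTop 2] with n hw hM hn
  unfold qn fn
  rw [Phi_int_scale hw hM, ← rate_scale hσ hδ hα0 hα2 hn]
  ring

theorem q_integrable (hσ : 0 < σ) (hδ : 0 < δ) (hα0 : 0 < α) (hα2 : α < 2) (t2 t3 : ℝ) : ∀ᶠ n : ℕ in atTop, Integrable (fun y => qn σ δ α t2 t3 n y ^ 2 / fn σ δ α n y) := by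
  obtain ⟨C, a, hQ⟩ := Ker_Q hσ hδ hα0 hα2 t2 t3
  have hSc := Sc_main hσ hδ hα0 hα2
  filter_upwards [hSc.wpos, hSc.Mtop.eventually_gt_atTop 0, hQ.Phi_integrable hSc hα0 hα2] with n hw hM hi
  have h1 : ∀ y, qn σ δ α t2 t3 n y ^ 2 / fn σ δ α n y =
      (Mn n α ^ (1 + α) * wn n σ δ α ^ (-α))⁻¹ * Phi α (wn n σ δ α) (Mn n α) (Qn δ α t2 t3 n) (y / Mn n α) := by
    intro y
    rw [Phi_scale hw hM, mul_div_cancel₀ _ hM.ne', ← mul_assoc, inv_mul_cancel₀ (by positivity), one_mul]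
    rfl
  simp_rw [h1]
  exact (hi.comp_div hM.ne').const_mul _

theorem q_var (hσ : 0 < σ) (hδ : 0 < δ) (hα0 : 0 < α) (hα2 : α < 2) (t2 t3 : ℝ) : Tendsto (fun n : ℕ => n * rate n α ^ 2 * ∫ y, qn σ δ α t2 t3 n y ^ 2 / fn σ δ α n y)
    atTop (𝓝 (kappa0 σ δ α * ((α * t2 / δ + kappa1 σ δ α * t3) ^ 2 + t3 ^ 2 / α ^ 2))) := by
  obtain ⟨C, a, hQ⟩ := Ker_Q hσ hδ hα0 hα2 t2 t3
  obtain ⟨C', hf⟩ := Ker_stable (σ := σ) (δ := δ) hα0 hα2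
  have hSc := Sc_main hσ hδ hα0 hα2
  have hc := cAlpha_pos hα0 hα2
  have h2 : 0 < 2 - α := by linarith
  have h1 := q_gen hσ hδ hα0 hα2 t2 t3 (fun _ => univ) (fun _ => MeasurableSet.univ) _ (fun v hv => by
    simpa using hQ.Phi_lim hSc hα0 hα2 hf hc hv)
  simp only [indicator_univ] at h1
  rw [integral_PhiLim hα0] at h1
  convert h1 using 2
  unfold kappa0
  rw [Real.rpow_neg h2.le]
  have : (2 - α) ^ (α / 2) ≠ 0 := by positivity
  field_simp
  ring

theorem q_small (hσ : 0 < σ) (hδ : 0 < δ) (hα0 : 0 < α) (hα2 : α < 2) (t2 t3 : ℝ) : Tendsto (fun n : ℕ => n * rate n α ^ 2 * ∫ y, {y : ℝ | |y| ≤ Mn n α / 2}.indicator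
      (fun y => qn σ δ α t2 t3 n y ^ 2 / fn σ δ α n y) y) atTop (𝓝 0) := by
  obtain ⟨C, a, hQ⟩ := Ker_Q hσ hδ hα0 hα2 t2 t3
  obtain ⟨C', hf⟩ := Ker_stable (σ := σ) (δ := δ) hα0 hα2
  have hSc := Sc_main hσ hδ hα0 hα2
  have hc := cAlpha_pos hα0 hα2
  have h1 := q_gen hσ hδ hα0 hα2 t2 t3 (fun n => {y : ℝ | |y| ≤ Mn n α / 2})
    (fun _ => measurableSet_le (by fun_prop) measurable_const) (fun _ => 0) (fun v hv => by
    rcases lt_or_gt_of_ne hv with hv1 | hv1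
    · have h := hQ.Phi_lim hSc hα0 hα2 hf hc hv
      unfold PhiLim at h
      rw [if_neg (not_lt.mpr hv1.le)] at h
      refine squeeze_zero' ?_ ?_ h
      · filter_upwards [hSc.wpos, hSc.Mtop.eventually_gt_atTop 0] with n hw hM
        exact indicator_nonneg (fun v _ => Phi_nonneg hα0 hα2 hw hM _ v) v
      · filter_upwards [hSc.wpos, hSc.Mtop.eventually_gt_atTop 0] with n hw hM
        exact indicator_le_self' (fun v _ => Phi_nonneg hα0 hα2 hw hM _ v) v
    · refine tendsto_const_nhds.congr' ?_
      filter_upwards [hSc.Mtop.eventually_gt_atTop 0] with n hM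
      rw [indicator_of_notMem]
      simp only [mem_preimage, mem_ofPred_eq, not_le, abs_mul, abs_of_pos hM]
      nlinarith)
  simpa using h1

theorem q_lind (hσ : 0 < σ) (hδ : 0 < δ) (hα0 : 0 < α) (hα2 : α < 2) (t2 t3 : ℝ) (ε : ℝ) (hε : 0 < ε) : Tendsto (fun n : ℕ => n * rate n α ^ 2 * ∫ y,
      {y : ℝ | ε < |rate n α * (qn σ δ α t2 t3 n y / fn σ δ α n y)|}.indicator
      (fun y => qn σ δ α t2 t3 n y ^ 2 / fn σ δ α n y) y) atTop (𝓝 0) := by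
  obtain ⟨C, a, hQ⟩ := Ker_Q hσ hδ hα0 hα2 t2 t3
  obtain ⟨C', hf⟩ := Ker_stable (σ := σ) (δ := δ) hα0 hα2
  have hSc := Sc_main hσ hδ hα0 hα2
  have hc := cAlpha_pos hα0 hα2
  have hqc : ∀ n, Continuous (qn σ δ α t2 t3 n) := fun n => continuous_cv continuous_gauss abs_gauss_le_one (hQ.int n) _
  have hfc : ∀ n, Continuous (fn σ δ α n) := fun n => continuous_cv continuous_gauss abs_gauss_le_one (integrable_stable hα0 hα2) _
  have h1 := q_gen hσ hδ hα0 hα2 t2 t3 (fun n => {y : ℝ | ε < |rate n α * (qn σ δ α t2 t3 n y / fn σ δ α n y)|})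
    (fun n => measurableSet_lt measurable_const
      ((((hqc n).measurable.div (hfc n).measurable).const_mul _).abs)) (fun _ => 0) (fun v hv => by
    rcases lt_or_gt_of_ne hv with hv1 | hv1
    · have h := hQ.Phi_lim hSc hα0 hα2 hf hc hv
      unfold PhiLim at h
      rw [if_neg (not_lt.mpr hv1.le)] at h
      refine squeeze_zero' ?_ ?_ h
      · filter_upwards [hSc.wpos, hSc.Mtop.eventually_gt_atTop 0] with n hw hM
        exact indicator_nonneg (fun v _ => Phi_nonneg hα0 hα2 hw hM _ v) v
      · filter_upwards [hSc.wpos, hSc.Mtop.eventually_gt_atTop 0] with n hw hM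
        exact indicator_le_self' (fun v _ => Phi_nonneg hα0 hα2 hw hM _ v) v
    · refine tendsto_const_nhds.congr' ?_
      have k1 := hQ.sc_lim hSc hα0 hα2 hv1
      have k2 := hf.sc_lim hSc hα0 hα2 hv1
      have hv0 : 0 < |v| := by linarith
      have k3 := k1.div k2 (by rw [zero_mul, sub_zero]; positivity)
      have k4 := ((rate_zero hα0).mul k3).abs
      rw [zero_mul, abs_zero] at k4
      filter_upwards [hSc.wpos, hSc.Mtop.eventually_gt_atTop 0, k4.eventually (gt_mem_nhds hε)] with n hw hM hk
      rw [indicator_of_notMem]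
      simp only [mem_preimage, mem_ofPred_eq, not_lt]
      refine le_trans (le_of_eq ?_) hk.le
      simp only [Pi.div_apply, sc, qn, fn]
      rw [mul_div_mul_left _ _ (by positivity)])
  simpa using h1

end


theorem hasDerivAt_gauss (y : ℝ) : HasDerivAt gauss (-(y * gauss y)) y := by
  unfold gauss
  have h := ((((hasDerivAt_id y).pow 2).neg.div_const 2).exp).const_mul (Real.sqrt (2 * Real.pi))⁻¹
  refine h.congr_deriv ?_
  simp only [id, Pi.neg_apply, Pi.pow_apply]
  push_cast
  ring

theorem Dop_gauss (y : ℝ) : Dop gauss y = (1 - y ^ 2) * gauss y := by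
  unfold Dop
  rw [(hasDerivAt_gauss y).deriv]; ring

def psi (y : ℝ) : ℝ := (1 - y ^ 2) ^ 2 * gauss y

theorem continuous_psi : Continuous psi := by
  unfold psi; exact (by fun_prop : Continuous fun y : ℝ => (1 - y ^ 2) ^ 2).mul continuous_gauss

theorem Dop_gauss_fun : Dop gauss = fun y => (1 - y ^ 2) * gauss y := funext Dop_gauss

theorem continuous_Dop_gauss : Continuous (Dop gauss) := by
  rw [Dop_gauss_fun]; exact (by fun_prop : Continuous fun y : ℝ => (1 - y ^ 2)).mul continuous_gauss

theorem gauss_poly_bound (y : ℝ) : (1 + y ^ 2) ^ 2 * gauss y ≤ 8 := by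
  have h1 := gauss_le_exp y
  have h2 : 1 + y ^ 2 / 2 + (y ^ 2 / 2) ^ 2 / 2 ≤ Real.exp (y ^ 2 / 2) :=
    Real.quadratic_le_exp_of_nonneg (by positivity)
  have h3 : Real.exp (-(y ^ 2) / 2) * Real.exp (y ^ 2 / 2) = 1 := by
    rw [← Real.exp_add]; ring_nf; simp
  have h4 := Real.exp_pos (-(y ^ 2) / 2)
  calc (1 + y ^ 2) ^ 2 * gauss y ≤ (8 * Real.exp (y ^ 2 / 2)) * Real.exp (-(y ^ 2) / 2) := by
        refine mul_le_mul ?_ h1 (gauss_pos y).le (by positivity)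
        nlinarith [sq_nonneg y]
    _ = 8 := by linarith

theorem psi_bound (y : ℝ) : |psi y| ≤ 8 := by
  unfold psi
  rw [abs_of_nonneg (mul_nonneg (sq_nonneg _) (gauss_pos y).le)]
  refine le_trans (mul_le_mul_of_nonneg_right ?_ (gauss_pos y).le) (gauss_poly_bound y)
  nlinarith [sq_nonneg y]

theorem Dop_gauss_bound (y : ℝ) : |Dop gauss y| ≤ 8 := by
  rw [Dop_gauss, abs_mul, abs_of_pos (gauss_pos y)]
  refine le_trans (mul_le_mul_of_nonneg_right ?_ (gauss_pos y).le) (gauss_poly_bound y)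
  rw [abs_le]
  constructor <;> nlinarith [sq_nonneg y, sq_nonneg (y ^ 2)]

theorem integrable_pow_gauss (k : ℕ) : Integrable fun y => y ^ k * gauss y := by
  have h := (integrable_rpow_mul_exp_neg_mul_sq (b := 1 / 2) (by norm_num) (s := k)
    (lt_of_lt_of_le (by norm_num) (Nat.cast_nonneg k))).const_mul (Real.sqrt (2 * Real.pi))⁻¹
  refine h.congr (Filter.Eventually.of_forall fun y => ?_)
  simp only [Real.rpow_natCast, gauss]
  rw [show -(1 / 2) * y ^ 2 = -y ^ 2 / 2 by ring]; ring

theorem integrable_Dop_gauss : Integrable (Dop gauss) := by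
  have := (integrable_pow_gauss 0).sub (integrable_pow_gauss 2)
  refine this.congr (Filter.Eventually.of_forall fun y => ?_)
  simp only [Pi.sub_apply]; rw [Dop_gauss]; ring

theorem integral_Dop_gauss : ∫ y, Dop gauss y = 0 := by
  refine integral_eq_zero_of_hasDerivAt_of_integrable (f := fun y => y * gauss y) (fun y => ?_) integrable_Dop_gauss
    (by simpa using integrable_pow_gauss 1)
  have := (hasDerivAt_id y).mul (hasDerivAt_gauss y)
  refine this.congr_deriv ?_
  rw [Dop_gauss]; simp only [id]; ring

theorem integrable_psi : Integrable psi := by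
  have := ((integrable_pow_gauss 0).sub ((integrable_pow_gauss 2).const_mul 2)).add (integrable_pow_gauss 4)
  refine this.congr (Filter.Eventually.of_forall fun y => ?_)
  simp only [Pi.sub_apply, Pi.add_apply]; unfold psi; ring

theorem integral_psi : ∫ y, psi y = 2 := by
  have h1 : ∫ y, (3 * (y ^ 2 * gauss y) - y ^ 4 * gauss y) = 0 := by
    refine integral_eq_zero_of_hasDerivAt_of_integrable (f := fun y => y ^ 3 * gauss y) (fun y => ?_)
      (((integrable_pow_gauss 2).const_mul 3).sub (integrable_pow_gauss 4)) (integrable_pow_gauss 3)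
    have := ((hasDerivAt_id y).pow 3).mul (hasDerivAt_gauss y)
    refine this.congr_deriv ?_
    simp only [id, Pi.pow_apply]; push_cast; ring
  have h2 := integral_Dop_gauss
  have e : psi = fun y => 2 * gauss y - (3 * (y ^ 2 * gauss y) - y ^ 4 * gauss y) - Dop gauss y := by
    funext y; rw [Dop_gauss]; unfold psi; ring
  have i1 : Integrable fun y => 3 * (y ^ 2 * gauss y) - y ^ 4 * gauss y :=
    ((integrable_pow_gauss 2).const_mul 3).sub (integrable_pow_gauss 4)
  have i2 : Integrable fun y => 2 * gauss y := integrable_gauss.const_mul 2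
  have i3 : Integrable fun y => 2 * gauss y - (3 * (y ^ 2 * gauss y) - y ^ 4 * gauss y) := i2.sub i1
  rw [e, integral_sub i3 integrable_Dop_gauss, integral_sub i2 i1, h1, h2, integral_const_mul, integral_gauss]
  norm_num

/-- generalized dominated convergence -/
theorem gdct {h G : ℕ → ℝ → ℝ} {h' G' : ℝ → ℝ} (hm : ∀ n, AEStronglyMeasurable (h n) volume)
    (hG : ∀ n, Integrable (G n)) (hG' : Integrable G') (h0 : ∀ n y, 0 ≤ h n y) (hle : ∀ n y, h n y ≤ G n y)
    (hl : ∀ y, Tendsto (fun n => h n y) atTop (𝓝 (h' y))) (hGl : ∀ y, Tendsto (fun n => G n y) atTop (𝓝 (G' y)))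
    (hI : Tendsto (fun n => ∫ y, G n y) atTop (𝓝 (∫ y, G' y))) :
    Tendsto (fun n => ∫ y, h n y) atTop (𝓝 (∫ y, h' y)) := by
  have hle' : ∀ y, h' y ≤ G' y := fun y => le_of_tendsto_of_tendsto' (hl y) (hGl y) fun n => hle n y
  have hG0 : ∀ y, 0 ≤ G' y := fun y => ge_of_tendsto' (hGl y) fun n => (h0 n y).trans (hle n y)
  have hh : ∀ n, Integrable (h n) := fun n => (hG n).mono' (hm n) (Filter.Eventually.of_forall fun y => by
    rw [Real.norm_of_nonneg (h0 n y)]; exact hle n y)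
  have t1 : Tendsto (fun n => ∫ y, min (h n y) (G' y)) atTop (𝓝 (∫ y, h' y)) := by
    refine tendsto_integral_of_dominated_convergence G' (fun n => ((hh n).inf hG').aestronglyMeasurable) hG' ?_ ?_
    · refine fun n => Filter.Eventually.of_forall fun y => ?_
      rw [Real.norm_of_nonneg (le_min (h0 n y) (hG0 y))]
      exact min_le_right _ _
    · refine Filter.Eventually.of_forall fun y => ?_
      have := (hl y).min (tendsto_const_nhds (x := G' y))
      rwa [min_eq_left (hle' y)] at this
  have t2 : Tendsto (fun n => ∫ y, min (G n y) (G' y)) atTop (𝓝 (∫ y, G' y)) := by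
    refine tendsto_integral_of_dominated_convergence G' (fun n => ((hG n).inf hG').aestronglyMeasurable) hG' ?_ ?_
    · refine fun n => Filter.Eventually.of_forall fun y => ?_
      rw [Real.norm_of_nonneg (le_min ((h0 n y).trans (hle n y)) (hG0 y))]
      exact min_le_right _ _
    · refine Filter.Eventually.of_forall fun y => ?_
      have := (hGl y).min (tendsto_const_nhds (x := G' y))
      rwa [min_self] at this
  have t3 : Tendsto (fun n => ∫ y, (h n y - min (h n y) (G' y))) atTop (𝓝 0) := by
    have := hI.sub t2
    rw [sub_self] at this
    refine squeeze_zero (fun n => integral_nonneg fun y => sub_nonneg.mpr (min_le_left _ _)) (fun n => ?_) this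
    have i1 : Integrable fun y => min (G n y) (G' y) := (hG n).inf hG'
    have i2 : Integrable fun y => min (h n y) (G' y) := (hh n).inf hG'
    rw [← integral_sub (hG n) i1]
    refine integral_mono ((hh n).sub i2) ((hG n).sub i1) fun y => ?_
    have := hle n y
    simp only
    rcases le_total (h n y) (G' y) with h1 | h1 <;> rcases le_total (G n y) (G' y) with h2 | h2 <;>
      simp only [min_eq_left, min_eq_right, h1, h2] <;> linarith
  have := t3.add t1
  rw [zero_add] at this
  refine this.congr fun n => ?_
  have i2 : Integrable fun y => min (h n y) (G' y) := (hh n).inf hG'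
  rw [integral_sub (hh n) i2]; ring

theorem cv_tendsto {P K : ℝ → ℝ} {B : ℝ} (hP : Continuous P) (hB : ∀ u, |P u| ≤ B) (hK : Integrable K)
    {w : ℕ → ℝ} (hw : Tendsto w atTop (𝓝 0)) (y : ℝ) :
    Tendsto (fun n => cv P K (w n) y) atTop (𝓝 (P y * ∫ z, K z)) := by
  unfold cv
  rw [← integral_const_mul]
  refine tendsto_integral_of_dominated_convergence (fun z => B * |K z|)
    (fun n => (cv_integrand hP hB hK _ y).aestronglyMeasurable) (hK.abs.const_mul B) ?_ ?_
  · refine fun n => Filter.Eventually.of_forall fun z => ?_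
    rw [Real.norm_eq_abs, abs_mul]
    exact mul_le_mul_of_nonneg_right (hB _) (abs_nonneg _)
  · refine Filter.Eventually.of_forall fun z => ?_
    have h1 : Tendsto (fun n => y - w n * z) atTop (𝓝 (y - 0 * z)) := tendsto_const_nhds.sub (hw.mul_const z)
    rw [zero_mul, sub_zero] at h1
    exact ((hP.tendsto y).comp h1).mul_const _

theorem g_cs {α : ℝ} (hα0 : 0 < α) (hα2 : α < 2) (w y : ℝ) :
    cv (Dop gauss) (stableDensity α) w y ^ 2 / cv gauss (stableDensity α) w y ≤ cv psi (stableDensity α) w y := by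
  have hf := f_pos hα0 hα2 w y
  have hK := integrable_stable hα0 hα2
  have i1 := cv_integrand continuous_gauss abs_gauss_le_one hK w y
  have i2 := cv_integrand continuous_Dop_gauss Dop_gauss_bound hK w y
  have i3 := cv_integrand continuous_psi psi_bound hK w y
  have key : ∀ l : ℝ, 0 ≤ cv psi (stableDensity α) w y - 2 * l * cv (Dop gauss) (stableDensity α) w y
      + l ^ 2 * cv gauss (stableDensity α) w y := by
    intro l
    have e : cv psi (stableDensity α) w y - 2 * l * cv (Dop gauss) (stableDensity α) w y
      + l ^ 2 * cv gauss (stableDensity α) w y = ∫ z, (1 - (y - w * z) ^ 2 - l) ^ 2 * (gauss (y - w * z) * stableDensity α z) := by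
      unfold cv
      have i4 : Integrable fun z => psi (y - w * z) * stableDensity α z - 2 * l * (Dop gauss (y - w * z) * stableDensity α z) :=
        i3.sub (i2.const_mul _)
      rw [← integral_const_mul, ← integral_const_mul, ← integral_sub i3 (i2.const_mul _), ← integral_add i4 (i1.const_mul _)]
      congr 1; funext z; rw [Dop_gauss, psi]; ring
    rw [e]
    exact integral_nonneg fun z => mul_nonneg (sq_nonneg _) (mul_nonneg (gauss_pos _).le (stable_nonneg hα0 hα2 z))
  have := key (cv (Dop gauss) (stableDensity α) w y / cv gauss (stableDensity α) w y)
  have e : cv psi (stableDensity α) w y - 2 * (cv (Dop gauss) (stableDensity α) w y / cv gauss (stableDensity α) w y) * cv (Dop gauss) (stableDensity α) w y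
      + (cv (Dop gauss) (stableDensity α) w y / cv gauss (stableDensity α) w y) ^ 2 * cv gauss (stableDensity α) w y
      = cv psi (stableDensity α) w y - cv (Dop gauss) (stableDensity α) w y ^ 2 / cv gauss (stableDensity α) w y := by
    field_simp; ring
  rw [e] at this
  linarith

def gn (σ δ α : ℝ) (n : ℕ) : ℝ → ℝ := cv (Dop gauss) (stableDensity α) (wn n σ δ α)

section
variable {σ δ α : ℝ}

theorem continuous_gn (hα0 : 0 < α) (hα2 : α < 2) (n : ℕ) : Continuous (gn σ δ α n) :=
  continuous_cv continuous_Dop_gauss Dop_gauss_bound (integrable_stable hα0 hα2) _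

theorem continuous_fn (hα0 : 0 < α) (hα2 : α < 2) (n : ℕ) : Continuous (fn σ δ α n) :=
  continuous_cv continuous_gauss abs_gauss_le_one (integrable_stable hα0 hα2) _

theorem fn_pos (hα0 : 0 < α) (hα2 : α < 2) (n : ℕ) (y : ℝ) : 0 < fn σ δ α n y := f_pos hα0 hα2 _ y

theorem g_integrable (hα0 : 0 < α) (hα2 : α < 2) (n : ℕ) :
    Integrable (fun y => gn σ δ α n y ^ 2 / fn σ δ α n y) := by
  refine (integrable_cv continuous_psi integrable_psi (continuous_stable hα0) (integrable_stable hα0 hα2) (wn n σ δ α)).mono'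
    ((((continuous_gn hα0 hα2 n).pow 2).div (continuous_fn hα0 hα2 n) fun y => (fn_pos hα0 hα2 n y).ne').aestronglyMeasurable)
    (Filter.Eventually.of_forall fun y => ?_)
  rw [Real.norm_of_nonneg (div_nonneg (sq_nonneg _) (fn_pos hα0 hα2 n y).le)]
  exact g_cs hα0 hα2 _ y

theorem g_gen (hσ : 0 < σ) (hδ : 0 < δ) (hα0 : 0 < α) (hα2 : α < 2) (S : ℕ → Set ℝ) (hS : ∀ n, MeasurableSet (S n)) (L : ℝ → ℝ)
    (hL : ∀ y, Tendsto (fun n => (S n).indicator (fun y => gn σ δ α n y ^ 2 / fn σ δ α n y) y) atTop (𝓝 (L y))) :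
    Tendsto (fun n : ℕ => ∫ y, (S n).indicator (fun y => gn σ δ α n y ^ 2 / fn σ δ α n y) y) atTop (𝓝 (∫ y, L y)) := by
  have hw := (Sc_main hσ hδ hα0 hα2).w_zero hα0
  have hK := integrable_stable hα0 hα2
  have hKc := continuous_stable hα0
  have h0 : ∀ n y, 0 ≤ gn σ δ α n y ^ 2 / fn σ δ α n y := fun n y => div_nonneg (sq_nonneg _) (fn_pos hα0 hα2 n y).le
  refine gdct (G := fun n => cv psi (stableDensity α) (wn n σ δ α)) (G' := psi)
    (fun n => ((g_integrable hα0 hα2 n).indicator (hS n)).aestronglyMeasurable)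
    (fun n => integrable_cv continuous_psi integrable_psi hKc hK _) integrable_psi ?_ ?_ hL ?_ ?_
  · exact fun n y => indicator_nonneg (fun y _ => h0 n y) y
  · exact fun n y => (indicator_le_self' (fun y _ => h0 n y) y).trans (g_cs hα0 hα2 _ y)
  · intro y
    have := cv_tendsto continuous_psi psi_bound hK hw y
    rwa [integral_stable hα0 hα2, mul_one] at this
  · refine tendsto_const_nhds.congr fun n => ?_
    rw [integral_cv continuous_psi integrable_psi hKc hK, integral_stable hα0 hα2, mul_one]

theorem f_tendsto (hσ : 0 < σ) (hδ : 0 < δ) (hα0 : 0 < α) (hα2 : α < 2) (y : ℝ) :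
    Tendsto (fun n => fn σ δ α n y) atTop (𝓝 (gauss y)) := by
  have := cv_tendsto continuous_gauss abs_gauss_le_one (integrable_stable hα0 hα2) ((Sc_main hσ hδ hα0 hα2).w_zero hα0) y
  rwa [integral_stable hα0 hα2, mul_one] at this

theorem g_tendsto (hσ : 0 < σ) (hδ : 0 < δ) (hα0 : 0 < α) (hα2 : α < 2) (y : ℝ) :
    Tendsto (fun n => gn σ δ α n y) atTop (𝓝 (Dop gauss y)) := by
  have := cv_tendsto continuous_Dop_gauss Dop_gauss_bound (integrable_stable hα0 hα2) ((Sc_main hσ hδ hα0 hα2).w_zero hα0) y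
  rwa [integral_stable hα0 hα2, mul_one] at this

theorem g_var (hσ : 0 < σ) (hδ : 0 < δ) (hα0 : 0 < α) (hα2 : α < 2) :
    Tendsto (fun n : ℕ => ∫ y, gn σ δ α n y ^ 2 / fn σ δ α n y) atTop (𝓝 2) := by
  have h := g_gen hσ hδ hα0 hα2 (fun _ => univ) (fun _ => MeasurableSet.univ) psi (fun y => by
    simp only [indicator_univ]
    have := ((g_tendsto hσ hδ hα0 hα2 y).pow 2).div (f_tendsto hσ hδ hα0 hα2 y) (gauss_pos y).ne'
    have e : Dop gauss y ^ 2 / gauss y = psi y := by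
      have := gauss_pos y
      rw [Dop_gauss, psi]; field_simp
    rw [← e]; exact this)
  simpa [integral_psi] using h

theorem g_small (hσ : 0 < σ) (hδ : 0 < δ) (hα0 : 0 < α) (hα2 : α < 2) :
    Tendsto (fun n : ℕ => ∫ y, {y : ℝ | |y| ≤ Mn n α / 2}ᶜ.indicator
      (fun y => gn σ δ α n y ^ 2 / fn σ δ α n y) y) atTop (𝓝 0) := by
  have h := g_gen hσ hδ hα0 hα2 (fun n => {y : ℝ | |y| ≤ Mn n α / 2}ᶜ)
    (fun _ => (measurableSet_le (by fun_prop) measurable_const).compl) (fun _ => 0) (fun y => by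
    refine tendsto_const_nhds.congr' ?_
    filter_upwards [(Sc_main hσ hδ hα0 hα2).Mtop.eventually_ge_atTop (2 * |y|)] with n hM
    rw [indicator_of_notMem]
    simp only [mem_compl_iff, mem_ofPred_eq, not_not]
    linarith)
  simpa using h

theorem g_lind (hσ : 0 < σ) (hδ : 0 < δ) (hα0 : 0 < α) (hα2 : α < 2) (ε : ℝ) (hε : 0 < ε) (s : ℕ → ℝ)
    (hs : Tendsto s atTop (𝓝 0)) : Tendsto (fun n : ℕ => ∫ y,
      {y : ℝ | ε < |s n * (gn σ δ α n y / fn σ δ α n y)|}.indicator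
      (fun y => gn σ δ α n y ^ 2 / fn σ δ α n y) y) atTop (𝓝 0) := by
  have h := g_gen hσ hδ hα0 hα2 (fun n => {y : ℝ | ε < |s n * (gn σ δ α n y / fn σ δ α n y)|})
    (fun n => measurableSet_lt measurable_const
      ((((continuous_gn hα0 hα2 n).measurable.div (continuous_fn hα0 hα2 n).measurable).const_mul _).abs)) (fun _ => 0) (fun y => by
    refine tendsto_const_nhds.congr' ?_
    have k3 := (g_tendsto hσ hδ hα0 hα2 y).div (f_tendsto hσ hδ hα0 hα2 y) (gauss_pos y).ne'
    have k4 := (hs.mul k3).abs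
    rw [zero_mul, abs_zero] at k4
    filter_upwards [k4.eventually (gt_mem_nhds hε)] with n hk
    rw [indicator_of_notMem]
    simp only [mem_ofPred_eq, not_lt]
    exact hk.le)
  simpa using h

end


theorem squeeze_eta {u : ℕ → ℝ} (C : ℝ)
    (h : ∀ η : ℝ, 0 < η → η ≤ 1 → ∃ v : ℕ → ℝ, Tendsto v atTop (𝓝 0) ∧ ∀ᶠ n in atTop, |u n| ≤ η * C + v n) :
    Tendsto u atTop (𝓝 0) := by
  rw [Metric.tendsto_atTop']
  intro ε hε
  have hC : 0 < |C| + 1 := by positivity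
  set η := min 1 (ε / (2 * (|C| + 1))) with hη
  have hη0 : 0 < η := by positivity
  obtain ⟨v, hv, hu⟩ := h η hη0 (min_le_left _ _)
  obtain ⟨N, hN⟩ := eventually_atTop.mp (hu.and (hv.eventually (gt_mem_nhds (half_pos hε))))
  refine ⟨N, fun n hn => ?_⟩
  obtain ⟨h1, h2⟩ := hN n hn.le
  rw [Real.dist_eq, sub_zero]
  have h3 : η * C ≤ ε / 2 := by
    have h4 : η ≤ ε / (2 * (|C| + 1)) := min_le_right _ _
    calc η * C ≤ η * (|C| + 1) := mul_le_mul_of_nonneg_left (by linarith [le_abs_self C]) hη0.le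
      _ ≤ ε / (2 * (|C| + 1)) * (|C| + 1) := mul_le_mul_of_nonneg_right h4 hC.le
      _ = ε / 2 := by field_simp
  linarith

theorem exp_rem {η : ℝ} (h0 : 0 < η) (h1 : η ≤ 1) (x : ℝ) :
    ‖Complex.exp (x * Complex.I) - 1 - x * Complex.I + (x : ℂ) ^ 2 / 2‖
      ≤ η * x ^ 2 + (2 / η ^ 2 + 1 / η + 1 / 2) * (if η < |x| then x ^ 2 else 0) := by
  split_ifs with hx
  · have e1 : ‖Complex.exp (x * Complex.I) - 1 - x * Complex.I + (x : ℂ) ^ 2 / 2‖ ≤ 1 + 1 + |x| + |x| ^ 2 / 2 := by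
      refine (norm_add_le _ _).trans (add_le_add ((norm_sub_le _ _).trans (add_le_add ((norm_sub_le _ _).trans ?_) ?_)) ?_)
      · rw [Complex.norm_exp_ofReal_mul_I]; simp
      · simp
      · simp
    have e2 : 2 ≤ 2 / η ^ 2 * |x| ^ 2 := by
      rw [div_mul_eq_mul_div, le_div_iff₀ (by positivity)]
      nlinarith
    have e3 : |x| ≤ 1 / η * |x| ^ 2 := by
      rw [div_mul_eq_mul_div, le_div_iff₀ (by positivity)]
      nlinarith [abs_nonneg x]
    have e4 : 0 ≤ η * x ^ 2 := by positivity
    rw [← sq_abs x] at e4 ⊢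
    linarith
  · rw [mul_zero, add_zero]
    push Not at hx
    have := Complex.exp_bound (x := x * Complex.I) (by simpa using hx.trans h1) (n := 3) (by norm_num)
    have e : Complex.exp (x * Complex.I) - 1 - x * Complex.I + (x : ℂ) ^ 2 / 2
        = Complex.exp (x * Complex.I) - ∑ m ∈ Finset.range 3, (x * Complex.I) ^ m / (m.factorial : ℂ) := by
      simp [Finset.sum_range_succ, Nat.factorial, mul_pow]; ring
    rw [e]
    refine this.trans ?_
    simp only [norm_mul, Complex.norm_real, Complex.norm_I, mul_one, Real.norm_eq_abs]
    rw [← sq_abs x]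
    norm_num [Nat.factorial]
    have : |x| ^ 3 ≤ η * |x| ^ 2 := by
      rw [pow_succ, mul_comm]; exact mul_le_mul_of_nonneg_right hx (by positivity)
    have : 0 ≤ |x| ^ 3 := by positivity
    rw [← sq_abs x]
    linarith

theorem rem_bound {η : ℝ} (h0 : 0 < η) (h1 : η ≤ 1) (a b : ℝ) (S : Prop) [Decidable S] :
    ‖Complex.exp ((a + b : ℝ) * Complex.I) - 1 - (a + b : ℝ) * Complex.I + ((a ^ 2 + b ^ 2 : ℝ) : ℂ) / 2‖
      ≤ η * (3 * (a ^ 2 + b ^ 2)) + (2 / η ^ 2 + 1 / η + 1 / 2) * (4 * ((if η / 2 < |a| then a ^ 2 else 0) + (if η / 2 < |b| then b ^ 2 else 0)))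
        + 1 / (2 * η) * ((if S then b ^ 2 else 0) + (if S then 0 else a ^ 2)) := by
  have e : Complex.exp ((a + b : ℝ) * Complex.I) - 1 - (a + b : ℝ) * Complex.I + ((a ^ 2 + b ^ 2 : ℝ) : ℂ) / 2
    = (Complex.exp ((a + b : ℝ) * Complex.I) - 1 - (a + b : ℝ) * Complex.I + ((a + b : ℝ) : ℂ) ^ 2 / 2) - ((a * b : ℝ) : ℂ) := by
    push_cast; ring
  rw [e]
  refine (norm_sub_le _ _).trans ?_
  have k1 := exp_rem h0 h1 (a + b)
  have k2 : (a + b) ^ 2 ≤ 2 * (a ^ 2 + b ^ 2) := by nlinarith [sq_nonneg (a - b)]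
  have k3 : (if η < |a + b| then (a + b) ^ 2 else 0) ≤ 4 * ((if η / 2 < |a| then a ^ 2 else 0) + (if η / 2 < |b| then b ^ 2 else 0)) := by
    have p1 : 0 ≤ (if η / 2 < |a| then a ^ 2 else 0) := by split_ifs <;> positivity
    have p2 : 0 ≤ (if η / 2 < |b| then b ^ 2 else 0) := by split_ifs <;> positivity
    by_cases hx : η < |a + b|
    · rw [if_pos hx]
      have hab := abs_add_le a b
      rcases le_total |b| |a| with h | h
      · have : η / 2 < |a| := by linarith
        rw [if_pos this]
        have : b ^ 2 ≤ a ^ 2 := sq_le_sq.mpr h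
        linarith
      · have : η / 2 < |b| := by linarith
        rw [if_pos this]
        have : a ^ 2 ≤ b ^ 2 := sq_le_sq.mpr h
        linarith
    · rw [if_neg hx]; positivity
  have k4 : ‖((a * b : ℝ) : ℂ)‖ ≤ η * (a ^ 2 + b ^ 2) + 1 / (2 * η) * ((if S then b ^ 2 else 0) + (if S then 0 else a ^ 2)) := by
    rw [Complex.norm_real, Real.norm_eq_abs, abs_mul]
    have am : ∀ p q : ℝ, |p| * |q| ≤ η * p ^ 2 + 1 / (2 * η) * q ^ 2 := by
      intro p q
      rw [← sq_abs p, ← sq_abs q, one_div_mul_eq_div]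
      have : η * |p| ^ 2 + |q| ^ 2 / (2 * η) - |p| * |q| = ((2 * η * |p| - |q|) ^ 2 + |q| ^ 2) / (4 * η) := by
        field_simp; ring
      have : 0 ≤ ((2 * η * |p| - |q|) ^ 2 + |q| ^ 2) / (4 * η) := by positivity
      linarith
    split_ifs
    · have := am a b
      nlinarith [mul_nonneg h0.le (sq_nonneg b)]
    · have := am b a
      rw [mul_comm |b|] at this
      nlinarith [mul_nonneg h0.le (sq_nonneg a)]
  have p0 : 0 ≤ 2 / η ^ 2 + 1 / η + 1 / 2 := by positivity
  have k5 := mul_le_mul_of_nonneg_left k3 p0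
  have k6 := mul_le_mul_of_nonneg_left k2 h0.le
  linarith

theorem lind_clt (μ : ℕ → Measure ℝ) [∀ n, IsProbabilityMeasure (μ n)] (a b : ℕ → ℝ → ℝ) {s1 s2 : ℝ}
    (am : ∀ n, Measurable (a n)) (bm : ∀ n, Measurable (b n))
    (ai : ∀ᶠ n in atTop, Integrable (fun y => a n y ^ 2) (μ n)) (bi : ∀ᶠ n in atTop, Integrable (fun y => b n y ^ 2) (μ n))
    (a0 : ∀ᶠ n in atTop, ∫ y, a n y ∂μ n = 0) (b0 : ∀ᶠ n in atTop, ∫ y, b n y ∂μ n = 0)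
    (av : Tendsto (fun n : ℕ => n * ∫ y, a n y ^ 2 ∂μ n) atTop (𝓝 s1))
    (bv : Tendsto (fun n : ℕ => n * ∫ y, b n y ^ 2 ∂μ n) atTop (𝓝 s2))
    (S : ℕ → Set ℝ) (hS : ∀ n, MeasurableSet (S n))
    (bs : Tendsto (fun n : ℕ => n * ∫ y, (S n).indicator (fun y => b n y ^ 2) y ∂μ n) atTop (𝓝 0))
    (as : Tendsto (fun n : ℕ => n * ∫ y, (S n)ᶜ.indicator (fun y => a n y ^ 2) y ∂μ n) atTop (𝓝 0))
    (al : ∀ ε > 0, Tendsto (fun n : ℕ => n * ∫ y, {y | ε < |a n y|}.indicator (fun y => a n y ^ 2) y ∂μ n) atTop (𝓝 0))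
    (bl : ∀ ε > 0, Tendsto (fun n : ℕ => n * ∫ y, {y | ε < |b n y|}.indicator (fun y => b n y ^ 2) y ∂μ n) atTop (𝓝 0)) :
    Tendsto (fun n : ℕ => (∫ y, Complex.exp ((a n y + b n y : ℝ) * Complex.I) ∂μ n) ^ n) atTop
      (𝓝 (Complex.exp (-((s1 + s2 : ℝ) : ℂ) / 2))) := by
  classical
  set g : ℕ → ℂ := fun n => ∫ y, Complex.exp ((a n y + b n y : ℝ) * Complex.I) ∂μ n - 1 with hg
  have hexp : ∀ n, Integrable (fun y => Complex.exp ((a n y + b n y : ℝ) * Complex.I)) (μ n) := by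
    intro n
    refine (integrable_const (1:ℝ)).mono' ?_ (Filter.Eventually.of_forall fun y => ?_)
    · have := ((am n).add (bm n))
      exact (Complex.measurable_exp.comp ((Complex.measurable_ofReal.comp this).mul_const _)).aestronglyMeasurable
    · rw [Complex.norm_exp_ofReal_mul_I]
  have key : Tendsto (fun n : ℕ => ‖n * g n + ((n * ∫ y, a n y ^ 2 ∂μ n + n * ∫ y, b n y ^ 2 ∂μ n : ℝ) : ℂ) / 2‖) atTop (𝓝 0) := by
    refine squeeze_eta (3 * (s1 + s2 + 1)) fun η h0 h1 => ?_
    refine ⟨fun n => (2 / η ^ 2 + 1 / η + 1 / 2) * (4 * (n * ∫ y, {y | η / 2 < |a n y|}.indicator (fun y => a n y ^ 2) y ∂μ n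
        + n * ∫ y, {y | η / 2 < |b n y|}.indicator (fun y => b n y ^ 2) y ∂μ n))
        + 1 / (2 * η) * (n * ∫ y, (S n).indicator (fun y => b n y ^ 2) y ∂μ n + n * ∫ y, (S n)ᶜ.indicator (fun y => a n y ^ 2) y ∂μ n), ?_, ?_⟩
    · have := ((((al (η / 2) (by positivity)).add (bl (η / 2) (by positivity))).const_mul 4).const_mul
        (2 / η ^ 2 + 1 / η + 1 / 2)).add ((bs.add as).const_mul (1 / (2 * η)))
      simpa using this
    · filter_upwards [ai, bi, a0, b0, (av.add bv).eventually (gt_mem_nhds (show s1 + s2 < s1 + s2 + 1 by linarith))]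
        with n ai bi a0 b0 hv
      have ma : MeasurableSet {y | η / 2 < |a n y|} := measurableSet_lt measurable_const (am n).abs
      have mb : MeasurableSet {y | η / 2 < |b n y|} := measurableSet_lt measurable_const (bm n).abs
      have a1 : Integrable (a n) (μ n) := by
        have : MemLp (a n) 2 (μ n) := (memLp_two_iff_integrable_sq (am n).aestronglyMeasurable).mpr ai
        exact this.integrable (by norm_num)
      have b1 : Integrable (b n) (μ n) := by
        have : MemLp (b n) 2 (μ n) := (memLp_two_iff_integrable_sq (bm n).aestronglyMeasurable).mpr bi
        exact this.integrable (by norm_num)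
      have i1 := ai.indicator ma
      have i2 := bi.indicator mb
      have i3 := bi.indicator (hS n)
      have i4 := ai.indicator (hS n).compl
      set F : ℝ → ℂ := fun y => Complex.exp ((a n y + b n y : ℝ) * Complex.I) - 1 - (a n y + b n y : ℝ) * Complex.I
        + ((a n y ^ 2 + b n y ^ 2 : ℝ) : ℂ) / 2 with hF
      have e1 : g n + ((∫ y, a n y ^ 2 ∂μ n + ∫ y, b n y ^ 2 ∂μ n : ℝ) : ℂ) / 2 = ∫ y, F y ∂μ n := by
        have j1 : Integrable (fun y => Complex.exp ((a n y + b n y : ℝ) * Complex.I) - 1) (μ n) := (hexp n).sub (integrable_const _)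
        have j2 : Integrable (fun y => ((a n y + b n y : ℝ) : ℂ) * Complex.I) (μ n) := (a1.add b1).ofReal.mul_const _
        have j3 : Integrable (fun y => ((a n y ^ 2 + b n y ^ 2 : ℝ) : ℂ) / 2) (μ n) := (ai.add bi).ofReal.div_const _
        have j4 : Integrable (fun y => Complex.exp ((a n y + b n y : ℝ) * Complex.I) - 1 - (a n y + b n y : ℝ) * Complex.I) (μ n) := j1.sub j2
        rw [hF, integral_add j4 j3, integral_sub j1 j2, integral_sub (hexp n) (integrable_const _), integral_mul_const,
          integral_div, integral_complex_ofReal, integral_complex_ofReal, integral_add a1 b1, integral_add ai bi, a0, b0, hg]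
        simp
      have e2 : (n : ℂ) * g n + ((n * ∫ y, a n y ^ 2 ∂μ n + n * ∫ y, b n y ^ 2 ∂μ n : ℝ) : ℂ) / 2 = n * ∫ y, F y ∂μ n := by
        rw [← e1]; push_cast; ring
      rw [e2, abs_of_nonneg (norm_nonneg _), norm_mul, Complex.norm_natCast]
      have j5 : Integrable (fun y => a n y ^ 2 + b n y ^ 2) (μ n) := ai.add bi
      have j6 : Integrable (fun y => {y | η / 2 < |a n y|}.indicator (fun y => a n y ^ 2) y + {y | η / 2 < |b n y|}.indicator (fun y => b n y ^ 2) y) (μ n) := i1.add i2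
      have j7 : Integrable (fun y => (S n).indicator (fun y => b n y ^ 2) y + (S n)ᶜ.indicator (fun y => a n y ^ 2) y) (μ n) := i3.add i4
      have e3 : ‖∫ y, F y ∂μ n‖ ≤ ∫ y, (η * (3 * (a n y ^ 2 + b n y ^ 2)) + (2 / η ^ 2 + 1 / η + 1 / 2) * (4 * ({y | η / 2 < |a n y|}.indicator (fun y => a n y ^ 2) y + {y | η / 2 < |b n y|}.indicator (fun y => b n y ^ 2) y)) + 1 / (2 * η) * ((S n).indicator (fun y => b n y ^ 2) y + (S n)ᶜ.indicator (fun y => a n y ^ 2) y)) ∂μ n := by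
        refine norm_integral_le_of_norm_le ((((j5.const_mul 3).const_mul η).add ((j6.const_mul 4).const_mul _)).add (j7.const_mul _))
          (Filter.Eventually.of_forall fun y => ?_)
        have := rem_bound h0 h1 (a n y) (b n y) (y ∈ S n)
        simp only [indicator_apply, mem_compl_iff, mem_ofPred_eq, ite_not]
        exact this
      have j8 : Integrable (fun y => η * (3 * (a n y ^ 2 + b n y ^ 2)) + (2 / η ^ 2 + 1 / η + 1 / 2) * (4 * ({y | η / 2 < |a n y|}.indicator (fun y => a n y ^ 2) y + {y | η / 2 < |b n y|}.indicator (fun y => b n y ^ 2) y))) (μ n) :=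
        ((j5.const_mul 3).const_mul η).add ((j6.const_mul 4).const_mul _)
      rw [integral_add j8 (j7.const_mul _), integral_add ((j5.const_mul 3).const_mul η) ((j6.const_mul 4).const_mul _)] at e3
      simp only [integral_const_mul] at e3
      rw [integral_add ai bi, integral_add i1 i2, integral_add i3 i4] at e3
      have e4 := mul_le_mul_of_nonneg_left e3 (Nat.cast_nonneg (α := ℝ) n)
      refine e4.trans ?_
      have e5 := mul_le_mul_of_nonneg_left hv.le (show 0 ≤ η * 3 by positivity)
      linarith
  have h1 : Tendsto (fun n : ℕ => (n : ℂ) * g n) atTop (𝓝 (-((s1 + s2 : ℝ) : ℂ) / 2)) := by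
    have h2 := tendsto_zero_iff_norm_tendsto_zero.mpr key
    have h3 : Tendsto (fun n : ℕ => ((n * ∫ y, a n y ^ 2 ∂μ n + n * ∫ y, b n y ^ 2 ∂μ n : ℝ) : ℂ) / 2) atTop (𝓝 (((s1 + s2 : ℝ) : ℂ) / 2)) :=
      ((Complex.continuous_ofReal.tendsto _).comp (av.add bv)).div_const 2
    have h4 := h2.sub h3
    rw [zero_sub, ← neg_div] at h4
    refine h4.congr fun n => ?_
    ring
  have := Complex.tendsto_one_add_pow_exp_of_tendsto h1
  refine this.congr fun n => ?_
  rw [hg]; ring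


theorem dens_integral {E : Type*} [NormedAddCommGroup E] [NormedSpace ℝ E] {f : ℝ → ℝ} (hf : Measurable f)
    (h0 : ∀ y, 0 ≤ f y) (F : ℝ → E) :
    ∫ y, F y ∂(volume.withDensity fun y => ENNReal.ofReal (f y)) = ∫ y, f y • F y := by
  rw [integral_withDensity_eq_integral_toReal_smul hf.ennreal_ofReal (Filter.Eventually.of_forall fun _ => ENNReal.ofReal_lt_top)]
  simp only [ENNReal.toReal_ofReal (h0 _)]

theorem dens_integrable {f : ℝ → ℝ} (hf : Measurable f) (h0 : ∀ y, 0 ≤ f y) (F : ℝ → ℝ) :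
    Integrable F (volume.withDensity fun y => ENNReal.ofReal (f y)) ↔ Integrable fun y => f y * F y := by
  rw [integrable_withDensity_iff_integrable_smul' hf.ennreal_ofReal (Filter.Eventually.of_forall fun _ => ENNReal.ofReal_lt_top)]
  simp only [ENNReal.toReal_ofReal (h0 _), smul_eq_mul]

theorem dens_prob {f : ℝ → ℝ} (h0 : ∀ y, 0 ≤ f y) (hi : Integrable f) (h1 : ∫ y, f y = 1) :
    IsProbabilityMeasure (volume.withDensity fun y => ENNReal.ofReal (f y)) := by
  refine ⟨?_⟩
  rw [withDensity_apply _ MeasurableSet.univ, setLIntegral_univ, ← ofReal_integral_eq_lintegral_ofReal hi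
    (Filter.Eventually.of_forall h0), h1, ENNReal.ofReal_one]

/-- the one dimensional law in the rescaled variable -/
def mu (σ δ α : ℝ) (n : ℕ) : Measure ℝ := volume.withDensity fun y => ENNReal.ofReal (fn σ δ α n y)

section
variable {σ δ α : ℝ}

theorem fn_integrable (hα0 : 0 < α) (hα2 : α < 2) (n : ℕ) : Integrable (fn σ δ α n) :=
  integrable_cv continuous_gauss integrable_gauss (continuous_stable hα0) (integrable_stable hα0 hα2) _

theorem fn_integral (hα0 : 0 < α) (hα2 : α < 2) (n : ℕ) : ∫ y, fn σ δ α n y = 1 := by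
  unfold fn
  rw [integral_cv continuous_gauss integrable_gauss (continuous_stable hα0) (integrable_stable hα0 hα2),
    integral_gauss, integral_stable hα0 hα2, mul_one]

theorem mu_prob (hα0 : 0 < α) (hα2 : α < 2) (n : ℕ) : IsProbabilityMeasure (mu σ δ α n) :=
  dens_prob (fun y => (fn_pos hα0 hα2 n y).le) (fn_integrable hα0 hα2 n) (fn_integral hα0 hα2 n)

theorem mu_sq (hα0 : 0 < α) (hα2 : α < 2) (n : ℕ) (c : ℝ) (q : ℝ → ℝ) (S : Set ℝ) :
    ∫ y, S.indicator (fun y => (c * (q y / fn σ δ α n y)) ^ 2) y ∂mu σ δ α n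
      = c ^ 2 * ∫ y, S.indicator (fun y => q y ^ 2 / fn σ δ α n y) y := by
  unfold mu
  rw [dens_integral (continuous_fn hα0 hα2 n).measurable (fun y => (fn_pos hα0 hα2 n y).le), ← integral_const_mul]
  congr 1
  funext y
  have := fn_pos (σ := σ) (δ := δ) hα0 hα2 n y
  by_cases hy : y ∈ S
  · rw [indicator_of_mem hy, indicator_of_mem hy, smul_eq_mul]
    field_simp
  · rw [indicator_of_notMem hy, indicator_of_notMem hy]; simp

theorem mu_sq_univ (hα0 : 0 < α) (hα2 : α < 2) (n : ℕ) (c : ℝ) (q : ℝ → ℝ) :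
    ∫ y, (c * (q y / fn σ δ α n y)) ^ 2 ∂mu σ δ α n = c ^ 2 * ∫ y, q y ^ 2 / fn σ δ α n y := by
  simpa using mu_sq (σ := σ) (δ := δ) hα0 hα2 n c q univ

theorem mu_sq_integrable (hα0 : 0 < α) (hα2 : α < 2) (n : ℕ) (c : ℝ) (q : ℝ → ℝ)
    (h : Integrable fun y => q y ^ 2 / fn σ δ α n y) :
    Integrable (fun y => (c * (q y / fn σ δ α n y)) ^ 2) (mu σ δ α n) := by
  unfold mu
  rw [dens_integrable (continuous_fn hα0 hα2 n).measurable (fun y => (fn_pos hα0 hα2 n y).le)]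
  refine (h.const_mul (c ^ 2)).congr (Filter.Eventually.of_forall fun y => ?_)
  have := fn_pos (σ := σ) (δ := δ) hα0 hα2 n y
  simp only
  field_simp

theorem mu_mean (hα0 : 0 < α) (hα2 : α < 2) (n : ℕ) (c : ℝ) (q : ℝ → ℝ) (h : ∫ y, q y = 0) :
    ∫ y, c * (q y / fn σ δ α n y) ∂mu σ δ α n = 0 := by
  unfold mu
  rw [dens_integral (continuous_fn hα0 hα2 n).measurable (fun y => (fn_pos hα0 hα2 n y).le)]
  have : ∀ y, fn σ δ α n y • (c * (q y / fn σ δ α n y)) = c * q y := by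
    intro y
    have := fn_pos (σ := σ) (δ := δ) hα0 hα2 n y
    rw [smul_eq_mul]; field_simp
  simp_rw [this]
  rw [integral_const_mul, h, mul_zero]

theorem inv_sqrt_zero (c : ℝ) : Tendsto (fun n : ℕ => c * (1 / Real.sqrt n)) atTop (𝓝 0) := by
  have : Tendsto (fun n : ℕ => Real.sqrt n) atTop atTop := Real.tendsto_sqrt_atTop.comp tendsto_natCast_atTop_atTop
  simpa using (this.inv_tendsto_atTop).const_mul c

theorem n_sq (c : ℝ) {n : ℕ} (hn : 0 < n) : (n : ℝ) * (c * (1 / Real.sqrt n)) ^ 2 = c ^ 2 := by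
  have h : (0:ℝ) < n := by exact_mod_cast hn
  rw [mul_pow, div_pow, Real.sq_sqrt h.le]; field_simp

theorem charfun_one (hσ : 0 < σ) (hδ : 0 < δ) (hα0 : 0 < α) (hα2 : α < 2) (t1 t2 t3 : ℝ) :
    Tendsto (fun n : ℕ => (∫ y, Complex.exp (((-(t1 / σ) * (1 / Real.sqrt n)) * (gn σ δ α n y / fn σ δ α n y)
        + rate n α * (qn σ δ α t2 t3 n y / fn σ δ α n y) : ℝ) * Complex.I) ∂mu σ δ α n) ^ n) atTop
      (𝓝 (Complex.exp (-(((t1 / σ) ^ 2 * 2 + kappa0 σ δ α * ((α * t2 / δ + kappa1 σ δ α * t3) ^ 2 + t3 ^ 2 / α ^ 2) : ℝ) : ℂ) / 2))) := by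
  haveI : ∀ n, IsProbabilityMeasure (mu σ δ α n) := mu_prob hα0 hα2
  obtain ⟨C, a, hQ⟩ := Ker_Q hσ hδ hα0 hα2 t2 t3
  have hqc : ∀ n, Continuous (qn σ δ α t2 t3 n) := fun n => continuous_cv continuous_gauss abs_gauss_le_one (hQ.int n) _
  have tr : ∀ {u : ℕ → ℝ} {l : ℝ}, Tendsto u atTop (𝓝 l) →
      Tendsto (fun n : ℕ => (n : ℝ) * ((-(t1 / σ) * (1 / Real.sqrt n)) ^ 2 * u n)) atTop (𝓝 ((t1 / σ) ^ 2 * l)) := by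
    intro u l hu
    refine (hu.const_mul ((t1 / σ) ^ 2)).congr' ?_
    filter_upwards [eventually_gt_atTop 0] with n hn
    rw [← mul_assoc, n_sq _ hn]; ring
  have tr2 : ∀ {u : ℕ → ℝ} {l : ℝ}, Tendsto (fun n : ℕ => n * rate n α ^ 2 * u n) atTop (𝓝 l) →
      Tendsto (fun n : ℕ => (n : ℝ) * (rate n α ^ 2 * u n)) atTop (𝓝 l) := by
    intro u l hu
    simpa only [mul_assoc] using hu
  refine lind_clt (mu σ δ α) (fun n y => (-(t1 / σ) * (1 / Real.sqrt n)) * (gn σ δ α n y / fn σ δ α n y))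
    (fun n y => rate n α * (qn σ δ α t2 t3 n y / fn σ δ α n y))
    (fun n => ((continuous_gn hα0 hα2 n).measurable.div (continuous_fn hα0 hα2 n).measurable).const_mul _)
    (fun n => ((hqc n).measurable.div (continuous_fn hα0 hα2 n).measurable).const_mul _)
    (Filter.Eventually.of_forall fun n => mu_sq_integrable hα0 hα2 n _ _ (g_integrable hα0 hα2 n))
    ((q_integrable hσ hδ hα0 hα2 t2 t3).mono fun n hn => mu_sq_integrable hα0 hα2 n _ _ hn)
    (Filter.Eventually.of_forall fun n => mu_mean hα0 hα2 n _ _ ?_)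
    (Filter.Eventually.of_forall fun n => mu_mean hα0 hα2 n _ _ ?_) ?_ ?_
    (fun n => {y : ℝ | |y| ≤ Mn n α / 2}) (fun _ => measurableSet_le (by fun_prop) measurable_const) ?_ ?_ ?_ ?_
  · unfold gn
    rw [integral_cv continuous_Dop_gauss integrable_Dop_gauss (continuous_stable hα0) (integrable_stable hα0 hα2),
      integral_Dop_gauss, zero_mul]
  · unfold qn
    rw [integral_cv continuous_gauss integrable_gauss (hQ.cont n) (hQ.int n), hQ.mass n, mul_zero]
  · simp_rw [mu_sq_univ hα0 hα2]
    exact tr (g_var hσ hδ hα0 hα2)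
  · simp_rw [mu_sq_univ hα0 hα2]
    exact tr2 (q_var hσ hδ hα0 hα2 t2 t3)
  · simp_rw [mu_sq hα0 hα2]
    exact tr2 (q_small hσ hδ hα0 hα2 t2 t3)
  · simp_rw [mu_sq hα0 hα2]
    have := tr (g_small hσ hδ hα0 hα2)
    rwa [mul_zero] at this
  · intro ε hε
    simp_rw [mu_sq hα0 hα2]
    have := tr (g_lind hσ hδ hα0 hα2 ε hε _ (inv_sqrt_zero (-(t1 / σ))))
    rwa [mul_zero] at this
  · intro ε hε
    simp_rw [mu_sq hα0 hα2]
    exact tr2 (q_lind hσ hδ hα0 hα2 t2 t3 ε hε)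

end


section
variable {σ δ α : ℝ}

theorem kappa0_pos (hσ : 0 < σ) (hδ : 0 < δ) (hα0 : 0 < α) (hα2 : α < 2) : 0 < kappa0 σ δ α := by
  have h1 := cAlpha_pos hα0 hα2
  have h2 : 0 < 2 - α := by linarith
  unfold kappa0
  positivity

theorem Imat_posDef (hσ : 0 < σ) (hδ : 0 < δ) (hα0 : 0 < α) (hα2 : α < 2) : (Imat ![σ, δ, α]).PosDef := by
  have hk := kappa0_pos hσ hδ hα0 hα2
  refine Matrix.PosDef.of_dotProduct_mulVec_pos ?_ ?_
  · ext i j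
    fin_cases i <;> fin_cases j <;> simp [Imat]
  · intro x hx
    have e : star x ⬝ᵥ (Imat ![σ, δ, α] *ᵥ x) = 2 / σ ^ 2 * x 0 ^ 2
        + kappa0 σ δ α * ((α * x 1 / δ + kappa1 σ δ α * x 2) ^ 2 + x 2 ^ 2 / α ^ 2) := by
      simp [Imat, dotProduct, mulVec, Fin.sum_univ_three]
      ring
    rw [e]
    by_contra hcon
    push Not at hcon
    have h1 : 0 ≤ 2 / σ ^ 2 * x 0 ^ 2 := by positivity
    have h2 : 0 ≤ (α * x 1 / δ + kappa1 σ δ α * x 2) ^ 2 := sq_nonneg _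
    have h3 : 0 ≤ x 2 ^ 2 / α ^ 2 := by positivity
    have h4 : (α * x 1 / δ + kappa1 σ δ α * x 2) ^ 2 + x 2 ^ 2 / α ^ 2 = 0 := by
      by_contra hne
      have : 0 < (α * x 1 / δ + kappa1 σ δ α * x 2) ^ 2 + x 2 ^ 2 / α ^ 2 := lt_of_le_of_ne (by linarith) (Ne.symm hne)
      have := mul_pos hk this
      linarith
    rw [h4] at hcon
    have x0 : x 0 = 0 := by
      have : 2 / σ ^ 2 * x 0 ^ 2 = 0 := by linarith
      have hs : 2 / σ ^ 2 ≠ 0 := by positivity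
      simpa [hs, hσ.ne'] using this
    have x2 : x 2 = 0 := by
      have : x 2 ^ 2 / α ^ 2 = 0 := by linarith
      simpa [hα0.ne'] using this
    have x1 : x 1 = 0 := by
      have : (α * x 1 / δ + kappa1 σ δ α * x 2) ^ 2 = 0 := by linarith
      simpa [x2, hα0.ne', hδ.ne'] using this
    apply hx
    ext i
    fin_cases i <;> simp [x0, x1, x2]

theorem Dstable_int (hα0 : 0 < α) (hα2 : α < 2) : Integrable (Dop (stableDensity α)) :=
  (KB_Dstable hα0 hα2 (β := α / 2) (by linarith) (by linarith)).integrable (by linarith) (continuous_Dstable hα0)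

theorem dalpha_int (hα0 : 0 < α) (hα2 : α < 2) : Integrable (stableDensityDalpha α) :=
  (KB_dalpha hα0 hα2 (β := α / 2) (by linarith) (by linarith)).integrable (by linarith) (continuous_dalpha hα0)

theorem qn_eq (hα0 : 0 < α) (hα2 : α < 2) (t2 t3 : ℝ) (n : ℕ) (y : ℝ) :
    qn σ δ α t2 t3 n y = -(t2 / δ) * hFun α y (wn n σ δ α) + t3 * lFun n α y (wn n σ δ α) := by
  have i1 := cv_integrand continuous_gauss abs_gauss_le_one (Dstable_int hα0 hα2) (wn n σ δ α) y
  have i2 := cv_integrand continuous_gauss abs_gauss_le_one (dalpha_int hα0 hα2) (wn n σ δ α) y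
  have : qn σ δ α t2 t3 n y = (-(t2 / δ) + t3 * An n α) * hFun α y (wn n σ δ α) + t3 * kFun α y (wn n σ δ α) := by
    unfold qn cv Qn hFun kFun
    rw [← integral_const_mul, ← integral_const_mul, ← integral_add (i1.const_mul _) (i2.const_mul _)]
    congr 1
    funext z
    ring
  rw [this]
  unfold lFun An
  ring

theorem continuous_hFun (hα0 : 0 < α) (hα2 : α < 2) (w : ℝ) : Continuous fun y => hFun α y w :=
  continuous_cv continuous_gauss abs_gauss_le_one (Dstable_int hα0 hα2) w

theorem continuous_kFun (hα0 : 0 < α) (hα2 : α < 2) (w : ℝ) : Continuous fun y => kFun α y w :=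
  continuous_cv continuous_gauss abs_gauss_le_one (dalpha_int hα0 hα2) w

theorem continuous_lFun (hα0 : 0 < α) (hα2 : α < 2) (n : ℕ) (w : ℝ) : Continuous fun y => lFun n α y w := by
  have := continuous_hFun hα0 hα2 w
  have := continuous_kFun hα0 hα2 w
  unfold lFun
  fun_prop

theorem continuous_Tstat (hα0 : 0 < α) (hα2 : α < 2) (n : ℕ) : Continuous (Tstat σ δ α n) := by
  have hf : Continuous fun y => fFun α y (wn n σ δ α) := continuous_fn hα0 hα2 n
  have hf0 : ∀ y, fFun α y (wn n σ δ α) ≠ 0 := fun y => (fn_pos hα0 hα2 n y).ne'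
  have hg : Continuous fun y => gFun α y (wn n σ δ α) := continuous_gn hα0 hα2 n
  have hh := (continuous_hFun hα0 hα2 (wn n σ δ α)).div hf hf0
  have hl := (continuous_lFun hα0 hα2 n (wn n σ δ α)).div hf hf0
  have hgf := hg.div hf hf0
  have aff : ∀ i : Fin n, Continuous fun x : Fin n → ℝ => Real.sqrt n * x i / σ := by
    intro i; fun_prop
  refine continuous_pi fun j => ?_
  fin_cases j
  · exact continuous_const.mul (continuous_finsetSum _ fun i _ => continuous_const.mul (hgf.comp (aff i)))
  · exact continuous_const.mul (continuous_finsetSum _ fun i _ => continuous_const.mul (hh.comp (aff i)))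
  · exact continuous_const.mul (continuous_finsetSum _ fun i _ => hl.comp (aff i))

theorem pdens_nonneg (hσ : 0 < σ) (hα0 : 0 < α) (hα2 : α < 2) (n : ℕ) (y : ℝ) : 0 ≤ pdens n ![σ, δ, α] y := by
  have : 0 ≤ fFun α (Real.sqrt n * y / σ) (wn n σ δ α) := (fn_pos hα0 hα2 n _).le
  simp only [pdens, cons_val_zero, cons_val_one, cons_val]
  positivity

theorem pdens_eq (n : ℕ) (y : ℝ) :
    pdens n ![σ, δ, α] y = Real.sqrt n / σ * fn σ δ α n (Real.sqrt n / σ * y) := by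
  simp only [pdens, cons_val_zero, cons_val_one, cons_val]
  rw [mul_div_right_comm]
  rfl

theorem pdens_measurable (hα0 : 0 < α) (hα2 : α < 2) (n : ℕ) : Measurable (pdens n ![σ, δ, α]) := by
  have := continuous_fn (σ := σ) (δ := δ) hα0 hα2 n
  rw [show pdens n ![σ, δ, α] = fun y => Real.sqrt n / σ * fn σ δ α n (Real.sqrt n / σ * y) from funext (pdens_eq n)]
  exact (by fun_prop : Continuous _).measurable

theorem pdens_integral {E : Type*} [NormedAddCommGroup E] [NormedSpace ℝ E] (hσ : 0 < σ) (hα0 : 0 < α) (hα2 : α < 2)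
    {n : ℕ} (hn : 0 < n) (F : ℝ → E) :
    ∫ y, F (Real.sqrt n * y / σ) ∂(volume.withDensity fun y => ENNReal.ofReal (pdens n ![σ, δ, α] y))
      = ∫ y, F y ∂mu σ δ α n := by
  unfold mu
  rw [dens_integral (pdens_measurable hα0 hα2 n) (pdens_nonneg hσ hα0 hα2 n),
    dens_integral (continuous_fn hα0 hα2 n).measurable (fun y => (fn_pos hα0 hα2 n y).le)]
  have hc : 0 < Real.sqrt n / σ := div_pos (Real.sqrt_pos.mpr (by exact_mod_cast hn)) hσ
  have key := Measure.integral_comp_mul_left (fun y => fn σ δ α n y • F y) (Real.sqrt n / σ)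
  have : ∀ y, pdens n ![σ, δ, α] y • F (Real.sqrt n * y / σ)
      = (Real.sqrt n / σ) • (fn σ δ α n (Real.sqrt n / σ * y) • F (Real.sqrt n / σ * y)) := by
    intro y
    rw [pdens_eq, mul_smul, mul_div_right_comm]
  simp_rw [this]
  rw [integral_smul, key, smul_smul, abs_of_pos (inv_pos.mpr hc), mul_inv_cancel₀ hc.ne', one_smul]

theorem pdens_prob (hσ : 0 < σ) (hα0 : 0 < α) (hα2 : α < 2) {n : ℕ} (hn : 0 < n) :
    IsProbabilityMeasure (volume.withDensity fun y => ENNReal.ofReal (pdens n ![σ, δ, α] y)) := by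
  have hc : 0 < Real.sqrt n / σ := div_pos (Real.sqrt_pos.mpr (by exact_mod_cast hn)) hσ
  have e : pdens n ![σ, δ, α] = fun y => Real.sqrt n / σ * fn σ δ α n (Real.sqrt n / σ * y) := funext (pdens_eq n)
  refine dens_prob (pdens_nonneg hσ hα0 hα2 n) ?_ ?_
  · rw [e]
    exact ((fn_integrable hα0 hα2 n).comp_mul_left' hc.ne').const_mul _
  · rw [e, integral_const_mul, Measure.integral_comp_mul_left, fn_integral hα0 hα2 n,
      abs_of_pos (inv_pos.mpr hc), smul_eq_mul, mul_one, mul_inv_cancel₀ hc.ne']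

theorem Pn_prob (hσ : 0 < σ) (hα0 : 0 < α) (hα2 : α < 2) (n : ℕ) : IsProbabilityMeasure (Pn n ![σ, δ, α]) := by
  unfold Pn
  haveI : ∀ _ : Fin n, IsProbabilityMeasure (volume.withDensity fun y => ENNReal.ofReal (pdens n ![σ, δ, α] y)) :=
    fun i => pdens_prob hσ hα0 hα2 i.pos
  infer_instance

theorem Pn_charfun (hσ : 0 < σ) (hα0 : 0 < α) (hα2 : α < 2) {n : ℕ} (hn : 0 < n) (t1 t2 t3 : ℝ) :
    ∫ x, Complex.exp ((t1 * Tstat σ δ α n x 0 + t2 * Tstat σ δ α n x 1 + t3 * Tstat σ δ α n x 2 : ℝ) * Complex.I)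
        ∂Pn n ![σ, δ, α]
      = (∫ y, Complex.exp (((-(t1 / σ) * (1 / Real.sqrt n)) * (gn σ δ α n y / fn σ δ α n y)
        + rate n α * (qn σ δ α t2 t3 n y / fn σ δ α n y) : ℝ) * Complex.I) ∂mu σ δ α n) ^ n := by
  haveI := pdens_prob (δ := δ) hσ hα0 hα2 hn
  rw [← pdens_integral hσ hα0 hα2 hn]
  have h := integral_fintype_prod_eq_pow (ι := Fin n)
    (μ := volume.withDensity fun y => ENNReal.ofReal (pdens n ![σ, δ, α] y))
    (fun y : ℝ => Complex.exp (((-(t1 / σ) * (1 / Real.sqrt n)) * (gn σ δ α n (Real.sqrt n * y / σ) / fn σ δ α n (Real.sqrt n * y / σ))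
        + rate n α * (qn σ δ α t2 t3 n (Real.sqrt n * y / σ) / fn σ δ α n (Real.sqrt n * y / σ)) : ℝ) * Complex.I))
  rw [Fintype.card_fin] at h
  rw [← h]
  unfold Pn
  congr 1
  funext x
  rw [← Complex.exp_sum, ← Finset.sum_mul, ← Complex.ofReal_sum]
  congr 3
  simp only [Tstat, cons_val_zero, cons_val_one, cons_val]
  simp only [Finset.mul_sum]
  rw [← Finset.sum_add_distrib, ← Finset.sum_add_distrib]
  refine Finset.sum_congr rfl fun i _ => ?_
  rw [qn_eq hα0 hα2]
  simp only [gn, fn, cv, gFun, fFun]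
  ring

theorem gauss_charfun (B : Matrix (Fin 3) (Fin 3) ℝ) (t : Fin 3 → ℝ) :
    ∫ v, Complex.exp ((t ⬝ᵥ (B *ᵥ v) : ℝ) * Complex.I) ∂stdGauss3
      = Complex.exp (-((t ⬝ᵥ ((B * Bᵀ) *ᵥ t) : ℝ) : ℂ) / 2) := by
  have h := integral_fintype_prod_eq_prod (ι := Fin 3) (μ := fun _ => ProbabilityTheory.gaussianReal 0 1)
    (fun k (y : ℝ) => Complex.exp (((t ᵥ* B) k : ℝ) * y * Complex.I))
  simp_rw [← charFun_apply_real, ProbabilityTheory.charFun_gaussianReal, ← Complex.exp_sum] at h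
  unfold stdGauss3
  calc _ = _ := ?_
    _ = _ := h
    _ = _ := ?_
  · congr 1
    funext v
    congr 1
    rw [Matrix.dotProduct_mulVec, dotProduct]
    push_cast
    rw [Finset.sum_mul]
  · congr 1
    have : t ⬝ᵥ ((B * Bᵀ) *ᵥ t) = ∑ k, (t ᵥ* B) k ^ 2 := by
      rw [← Matrix.mulVec_mulVec, Matrix.dotProduct_mulVec, Matrix.mulVec_transpose]
      simp [dotProduct, sq]
    rw [this]
    push_cast
    rw [← Finset.sum_neg_distrib, Finset.sum_div]
    refine Finset.sum_congr rfl fun k _ => ?_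
    simp [neg_div]

end

theorem main_tendsto {σ δ α : ℝ} (hσ : 0 < σ) (hδ : 0 < δ) (hα0 : 0 < α) (hα2 : α < 2)
    (B : Matrix (Fin 3) (Fin 3) ℝ) (hB : B * Bᵀ = Imat ![σ, δ, α]) (F : BoundedContinuousFunction (Fin 3 → ℝ) ℝ) :
    Tendsto (fun n : ℕ => ∫ x, F (Tstat σ δ α n x) ∂Pn n ![σ, δ, α]) atTop (𝓝 (∫ v, F v ∂stdGauss3.map B.mulVec)) := by
  haveI : ∀ n, IsProbabilityMeasure (Pn n ![σ, δ, α]) := Pn_prob hσ hα0 hα2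
  haveI : IsProbabilityMeasure stdGauss3 := by unfold stdGauss3; infer_instance
  have hBc : Continuous B.mulVec := by fun_prop
  have hL : Continuous (WithLp.toLp 2 : (Fin 3 → ℝ) → EuclideanSpace ℝ (Fin 3)) := PiLp.continuous_toLp 2 _
  have hT : ∀ n, Continuous (fun x => (WithLp.toLp 2 (Tstat σ δ α n x) : EuclideanSpace ℝ (Fin 3))) :=
    fun n => hL.comp (continuous_Tstat hα0 hα2 n)
  have hBL : Continuous (fun v => (WithLp.toLp 2 (B *ᵥ v) : EuclideanSpace ℝ (Fin 3))) := hL.comp hBc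
  let ν : ℕ → ProbabilityMeasure (EuclideanSpace ℝ (Fin 3)) := fun n =>
    ⟨(Pn n ![σ, δ, α]).map (fun x => WithLp.toLp 2 (Tstat σ δ α n x)), Measure.isProbabilityMeasure_map (hT n).aemeasurable⟩
  let ν₀ : ProbabilityMeasure (EuclideanSpace ℝ (Fin 3)) :=
    ⟨stdGauss3.map (fun v => WithLp.toLp 2 (B *ᵥ v)), Measure.isProbabilityMeasure_map hBL.aemeasurable⟩
  have key : Tendsto ν atTop (𝓝 ν₀) := by
    refine ProbabilityMeasure.tendsto_iff_tendsto_charFun.2 fun t => ?_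
    have hexp : Continuous fun x : EuclideanSpace ℝ (Fin 3) => Complex.exp (((inner ℝ x t : ℝ) : ℂ) * Complex.I) := by
      fun_prop
    have e0 : charFun (ν₀ : Measure (EuclideanSpace ℝ (Fin 3))) t = Complex.exp (-(((t 0 / σ) ^ 2 * 2
        + kappa0 σ δ α * ((α * t 1 / δ + kappa1 σ δ α * t 2) ^ 2 + t 2 ^ 2 / α ^ 2) : ℝ) : ℂ) / 2) := by
      rw [charFun_apply]
      change ∫ x, _ ∂(stdGauss3.map (fun v => (WithLp.toLp 2 (B *ᵥ v) : EuclideanSpace ℝ (Fin 3)))) = _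
      rw [integral_map hBL.aemeasurable hexp.aestronglyMeasurable]
      have := gauss_charfun B (fun i => t i)
      calc _ = _ := ?_
        _ = _ := this
        _ = _ := ?_
      · rfl
      · rw [hB]
        congr 4
        simp [Imat, dotProduct, mulVec, Fin.sum_univ_three]
        ring
    have e1 : ∀ n : ℕ, 0 < n → charFun (ν n : Measure (EuclideanSpace ℝ (Fin 3))) t
        = (∫ y, Complex.exp (((-(t 0 / σ) * (1 / Real.sqrt n)) * (gn σ δ α n y / fn σ δ α n y)
        + rate n α * (qn σ δ α (t 1) (t 2) n y / fn σ δ α n y) : ℝ) * Complex.I) ∂mu σ δ α n) ^ n := by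
      intro n hn
      rw [charFun_apply]
      change ∫ x, _ ∂((Pn n ![σ, δ, α]).map (fun x => (WithLp.toLp 2 (Tstat σ δ α n x) : EuclideanSpace ℝ (Fin 3)))) = _
      rw [integral_map (hT n).aemeasurable hexp.aestronglyMeasurable, ← Pn_charfun hσ hα0 hα2 hn]
      congr 1
      funext x
      congr 3
      simp [PiLp.inner_apply, Fin.sum_univ_three]
    rw [e0]
    refine (charfun_one hσ hδ hα0 hα2 (t 0) (t 1) (t 2)).congr' ?_
    filter_upwards [eventually_gt_atTop 0] with n hn
    exact (e1 n hn).symm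
  have hO : Continuous (WithLp.ofLp : EuclideanSpace ℝ (Fin 3) → (Fin 3 → ℝ)) := PiLp.continuous_ofLp 2 _
  have fin := (ProbabilityMeasure.tendsto_iff_forall_integral_tendsto.1 key) (F.compContinuous ⟨_, hO⟩)
  have hFO : Continuous fun x : EuclideanSpace ℝ (Fin 3) => (F.compContinuous ⟨_, hO⟩) x := by fun_prop
  have r0 : ∫ x, (F.compContinuous ⟨_, hO⟩) x ∂(ν₀ : Measure (EuclideanSpace ℝ (Fin 3))) = ∫ v, F v ∂stdGauss3.map B.mulVec := by
    change ∫ x, _ ∂(stdGauss3.map (fun v => (WithLp.toLp 2 (B *ᵥ v) : EuclideanSpace ℝ (Fin 3)))) = _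
    rw [integral_map hBL.aemeasurable hFO.aestronglyMeasurable,
      integral_map hBc.aemeasurable F.continuous.aestronglyMeasurable]
    rfl
  have r1 : ∀ n, ∫ x, (F.compContinuous ⟨_, hO⟩) x ∂(ν n : Measure (EuclideanSpace ℝ (Fin 3)))
      = ∫ x, F (Tstat σ δ α n x) ∂Pn n ![σ, δ, α] := by
    intro n
    change ∫ x, _ ∂((Pn n ![σ, δ, α]).map (fun x => (WithLp.toLp 2 (Tstat σ δ α n x) : EuclideanSpace ℝ (Fin 3)))) = _
    rw [integral_map (hT n).aemeasurable hFO.aestronglyMeasurable]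
    rfl
  rw [r0] at fin
  simpa only [r1] using fin


/-- CLT for the normalized score. `I(θ₀)` is symmetric positive definite and the
law of `T_n` under `ℙ_n` converges weakly to the centered Gaussian with covariance `I(θ₀)`
(realized as the image of the standard Gaussian on `ℝ³` under any square root `B` of `I(θ₀)`). -/
theorem statement0 (σ₀ δ₀ α₀ : ℝ) (hσ : 0 < σ₀) (hδ : 0 < δ₀) (hα : α₀ ∈ Set.Ioo (0 : ℝ) 2) :
    (Imat ![σ₀, δ₀, α₀]).PosDef ∧
    ∀ B : Matrix (Fin 3) (Fin 3) ℝ, B * Bᵀ = Imat ![σ₀, δ₀, α₀] →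
      ∀ F : BoundedContinuousFunction (Fin 3 → ℝ) ℝ,
        Tendsto (fun n : ℕ => ∫ x, F (Tstat σ₀ δ₀ α₀ n x) ∂ Pn n ![σ₀, δ₀, α₀])
          atTop (𝓝 (∫ v, F v ∂ stdGauss3.map B.mulVec)) := by
  exact ⟨Imat_posDef hσ hδ hα.1 hα.2, fun B hB F => main_tendsto hσ hδ hα.1 hα.2 B hB F⟩

end LevyLAN
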